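/- arXiv:1103.3455 — 3 statements merged into one kernel-verified Lean document; each statement's English description precedes it below -/
import Mathlib

section
/- Let M be a finitely generated A-module with dim M = d ≥ 1 and I an m-primary ideal. Then: (i) ℓ(M/I^{n+1}M) ≤ C(n+d, d) · ℓ(M/QM) for every n ≥ 0, where Q is a minimal reduction of the ideal I(A/Ann(M)); (ii) ℓ(M/I^{n+1}M) ≤ C(n+d, d) · D(I,M) for every n ≥ 0 and any extended degree D(I,M). -/
/-!
Formalization of results from:
L.X. Dung, L.T. Hoa, "Castelnuovo-Mumford regularity of associated graded modules
and fiber cones of filtered modules".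

Setting: `(A, 𝔪)` is a Noetherian local ring with infinite residue field, `I` an
`𝔪`-primary ideal, `M` a finitely generated `A`-module, and `𝓜 = {M_n}` a good
`I`-filtration of `M`.

Notions that are not available in Mathlib (the Castelnuovo–Mumford regularity of the
associated graded module `G(𝓜) = ⊕ M_n/M_{n+1}` over `G_I(A)`, defined via graded local
cohomology, and similar graded invariants) are taken as explicit parameters of the
theorems, documented where they occur.  Everything else is defined concretely below.
-/

open Filter IsLocalRing

universe u

section Preliminaries

variable {A : Type u} [CommRing A] {M : Type u} [AddCommGroup M] [Module A M]

/-- The length `ℓ(M)` of a module, as the Krull dimension of its lattice of submodules. -/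
noncomputable def moduleLength (A : Type u) (M : Type u) [CommRing A] [AddCommGroup M]
    [Module A M] : WithBot ℕ∞ :=
  Order.krullDim (Submodule A M)

/-- The zeroth local cohomology `H⁰_J(M)`, i.e. the `J`-torsion submodule
`{m ∈ M ∣ J^k • m = 0 for some k}`. -/
noncomputable def lcZero (J : Ideal A) (M : Type u) [AddCommGroup M] [Module A M] :
    Submodule A M :=
  ⨆ k : ℕ, Submodule.torsionBySet A M ((J ^ k : Ideal A) : Set A)

/-- `I` is an `𝔪`-primary (proper) ideal of the local ring `A`. -/
def IsMaxPrimary [IsLocalRing A] (I : Ideal A) : Prop :=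
  I ≠ ⊤ ∧ I.radical = maximalIdeal A

/-- A good `I`-filtration `𝓜 : M = M₀ ⊇ M₁ ⊇ ⋯`: an `I`-filtration
(`I • M_n ⊆ M_{n+1}`, packaged in Mathlib's `Ideal.Filtration`) which starts at `M`
and satisfies `I • M_n = M_{n+1}` for all large `n` (stability). -/
def Ideal.Filtration.IsGood {I : Ideal A} (F : I.Filtration M) : Prop :=
  F.N 0 = ⊤ ∧ F.Stable

/-- `r(𝓜) = min {t ≥ 0 ∣ M_{n+1} = I•M_n for all n ≥ t}`, the maximal generating
degree of `G(𝓜)` over `G_I(A)`. -/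
noncomputable def Ideal.Filtration.genDeg {I : Ideal A} (F : I.Filtration M) : ℕ :=
  sInf {t | ∀ n, t ≤ n → F.N (n + 1) = I • F.N n}

/-- The initial form `x*` of `x ∈ I` is a (linear) filter-regular element on `G(𝓜)`,
expressed elementwise: `(M_{n+2} :_M x) ∩ M_n = M_{n+1}` for all `n ≫ 0`. -/
def Ideal.Filtration.FilterRegular {I : Ideal A} (F : I.Filtration M) (x : A) : Prop :=
  ∀ᶠ n : ℕ in atTop,
    (F.N (n + 2)).comap (LinearMap.lsmul A M x) ⊓ F.N n = F.N (n + 1)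

/-- The quotient filtration `𝓜/p = {(M_n + p)/p}` on `M/p`. -/
def Ideal.Filtration.quot {I : Ideal A} (F : I.Filtration M) (p : Submodule A M) :
    I.Filtration (M ⧸ p) where
  N n := (F.N n).map p.mkQ
  mono n := Submodule.map_mono (F.mono n)
  smul_le n := by
    rw [← Submodule.map_smul'']
    exact Submodule.map_mono (F.smul_le n)

/-- Vanishing of the degree-`n` graded piece of `H⁰_{G₊}(G(𝓜))`, expressed elementwise:
every `m ∈ M_n` with `I^k • m ⊆ M_{n+k+1}` for some `k` lies in `M_{n+1}`. -/
def Ideal.Filtration.H0GradedVanish {I : Ideal A} (F : I.Filtration M) (n : ℕ) : Prop :=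
  ∀ m ∈ F.N n, (∃ k : ℕ, ∀ c ∈ I ^ k, c • m ∈ F.N (n + k + 1)) → m ∈ F.N (n + 1)

/-- An extended degree `D(I,·)` on finitely generated `A`-modules with respect to an
`𝔪`-primary ideal `I`:
(i) `D(I,N) = D(I,N/H⁰_𝔪(N)) + ℓ(H⁰_𝔪(N))`;
(ii) `D(I,N) ≥ D(I,N/xN)` for a generic element `x ∈ I ∖ 𝔪I` on `N` (genericity is
     rendered as the existence of such an `x` which is moreover filter-regular);
(iii) `D(I,N) = e(I,N)`, the multiplicity, if `N` is Cohen–Macaulay (Cohen–Macaulayness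
      is rendered via the existence of a regular sequence of parameters, and the
      multiplicity via the leading coefficient of the Hilbert–Samuel polynomial). -/
structure IsExtendedDegree [IsLocalRing A] (I : Ideal A)
    (D : (N : Type u) → [AddCommGroup N] → [Module A N] → ℕ) : Prop where
  h0_add : ∀ (N : Type u) [AddCommGroup N] [Module A N] [Module.Finite A N],
    (D N : WithBot ℕ∞) =
      (D (N ⧸ lcZero (maximalIdeal A) N) : WithBot ℕ∞) +
        moduleLength A (lcZero (maximalIdeal A) N)
  generic : ∀ (N : Type u) [AddCommGroup N] [Module A N] [Module.Finite A N],
    Nontrivial N →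
    ∃ x ∈ I, x ∉ maximalIdeal A * I ∧
      (Ideal.stableFiltration I (⊤ : Submodule A N)).FilterRegular x ∧
      D (N ⧸ (Ideal.span {x} • (⊤ : Submodule A N))) ≤ D N
  cohenMacaulay : ∀ (N : Type u) [AddCommGroup N] [Module A N] [Module.Finite A N]
    (d : ℕ) (c : ℕ → ℤ) (H : ℕ → ℕ),
    (∃ rs : List A, (∀ y ∈ rs, y ∈ maximalIdeal A) ∧ RingTheory.Sequence.IsRegular N rs ∧
        moduleLength A (N ⧸ (Ideal.ofList rs • (⊤ : Submodule A N))) ≠ ⊤) →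
    ringKrullDim (A ⧸ Module.annihilator A N) = (d : WithBot ℕ∞) →
    (∀ n : ℕ, moduleLength A (N ⧸ ((I ^ (n + 1)) • (⊤ : Submodule A N))) = (H n : WithBot ℕ∞)) →
    (∀ᶠ n : ℕ in atTop,
      (H n : ℤ) = ∑ i ∈ Finset.range (d + 1),
        (-1) ^ i * c i * ((n + d - i).choose (d - i) : ℤ)) →
    (D N : ℤ) = c 0

end Preliminaries

/-- `Q` is a reduction of `J`: `Q ⊆ J` and `J^{n+1} = Q·J^n` for all `n ≫ 0`. -/
def IsReduction {R : Type u} [CommRing R] (J Q : Ideal R) : Prop :=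
  Q ≤ J ∧ ∃ n₀ : ℕ, ∀ n, n₀ ≤ n → J ^ (n + 1) = Q * J ^ n

/-- `Q` is a minimal reduction of `J`: a reduction not properly containing a reduction. -/
def IsMinimalReduction {R : Type u} [CommRing R] (J Q : Ideal R) : Prop :=
  IsReduction J Q ∧ ∀ Q' : Ideal R, IsReduction J Q' → Q' ≤ Q → Q' = Q

section Len
variable {A : Type u} [CommRing A] {N : Type u} [AddCommGroup N] [Module A N]

theorem length_quot_le_add (U V : Submodule A N) (x : A) (h : ∀ y ∈ U, x • y ∈ V) :
    Module.length A (N ⧸ V) ≤ Module.length A (N ⧸ U) +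
      Module.length A (N ⧸ ((Ideal.span {x} • (⊤ : Submodule A N)) ⊔ V)) := by
  let f : (N ⧸ U) →ₗ[A] (N ⧸ V) := U.mapQ V (LinearMap.lsmul A N x) h
  let g : (N ⧸ V) →ₗ[A] (N ⧸ ((Ideal.span {x} • (⊤ : Submodule A N)) ⊔ V)) :=
    Submodule.factor le_sup_right
  have hg : Function.Surjective g := Submodule.factor_surjective _
  have hk : LinearMap.range f = LinearMap.ker g := by
    ext z
    obtain ⟨z, rfl⟩ := Submodule.Quotient.mk_surjective _ z
    constructor
    · rintro ⟨w, hw⟩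
      obtain ⟨w, rfl⟩ := Submodule.Quotient.mk_surjective _ w
      rw [← hw]
      change g (Submodule.Quotient.mk (x • w)) = 0
      change Submodule.Quotient.mk (x • w) = _
      rw [Submodule.Quotient.mk_eq_zero]
      exact Submodule.mem_sup_left (Submodule.smul_mem_smul (Ideal.mem_span_singleton_self x) trivial)
    · intro hz
      change Submodule.Quotient.mk z = _ at hz
      rw [Submodule.Quotient.mk_eq_zero, Submodule.mem_sup] at hz
      obtain ⟨a, ha, b, hb, rfl⟩ := hz
      rw [Submodule.ideal_span_singleton_smul] at ha
      obtain ⟨w, -, rfl⟩ := (Submodule.mem_smul_pointwise_iff_exists _ _ _).1 ha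
      refine ⟨Submodule.Quotient.mk w, ?_⟩
      change Submodule.Quotient.mk (x • w) = _
      rw [Submodule.Quotient.eq]
      simpa using V.neg_mem hb
  rw [Module.length_eq_add_of_exact (LinearMap.ker g).subtype g (Submodule.subtype_injective _) hg
    (LinearMap.exact_subtype_ker_map g), ← hk]
  gcongr
  exact Module.length_le_of_surjective _ f.surjective_rangeRestrict

theorem length_quot_quot (p : Submodule A N) (J : Ideal A) :
    Module.length A ((N ⧸ p) ⧸ (J • (⊤ : Submodule A (N ⧸ p)))) =
      Module.length A (N ⧸ (p ⊔ J • (⊤ : Submodule A N))) := by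
  have : J • (⊤ : Submodule A (N ⧸ p)) = (J • (⊤ : Submodule A N)).map p.mkQ := by
    rw [Submodule.map_smul'', Submodule.map_top, Submodule.range_mkQ]
  rw [this]
  exact (Submodule.quotientQuotientEquivQuotientSup _ _).length_eq

theorem length_step (I : Ideal A) (x : A) (hx : x ∈ I) (n : ℕ) :
    Module.length A (N ⧸ (I ^ (n + 1) • (⊤ : Submodule A N))) ≤
      Module.length A (N ⧸ (I ^ n • (⊤ : Submodule A N))) +
      Module.length A ((N ⧸ (Ideal.span {x} • (⊤ : Submodule A N))) ⧸
        (I ^ (n + 1) • (⊤ : Submodule A (N ⧸ (Ideal.span {x} • (⊤ : Submodule A N)))))) := by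
  rw [length_quot_quot]
  apply length_quot_le_add
  intro y hy
  rw [pow_succ', mul_smul]
  exact Submodule.smul_mem_smul hx hy

theorem length_sum (I : Ideal A) (x : A) (hx : x ∈ I) (d : ℕ) (c : ℕ∞)
    (h : ∀ n, Module.length A ((N ⧸ (Ideal.span {x} • (⊤ : Submodule A N))) ⧸
        (I ^ (n + 1) • (⊤ : Submodule A (N ⧸ (Ideal.span {x} • (⊤ : Submodule A N))))))
        ≤ ((n + d).choose d : ℕ) * c) (n : ℕ) :
    Module.length A (N ⧸ (I ^ (n + 1) • (⊤ : Submodule A N))) ≤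
      ((n + (d + 1)).choose (d + 1) : ℕ) * c := by
  induction n with
  | zero =>
    refine (length_step I x hx 0).trans ?_
    have h0 : Module.length A (N ⧸ (I ^ 0 • (⊤ : Submodule A N))) = 0 := by
      rw [Module.length_eq_zero_iff, Submodule.Quotient.subsingleton_iff]
      simp
    rw [h0, zero_add]
    simpa using h 0
  | succ n ih =>
    refine (length_step I x hx (n + 1)).trans ?_
    refine (add_le_add ih (h (n + 1))).trans ?_
    rw [← add_mul, ← Nat.cast_add]
    have : (n + 1 + (d + 1)).choose (d + 1) =
      (n + (d + 1)).choose (d + 1) + (n + 1 + d).choose d := by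
      rw [show n + 1 + (d + 1) = (n + 1 + d) + 1 by ring, Nat.choose_succ_succ, add_comm,
        show n + (d + 1) = n + 1 + d by ring]
    rw [this]

theorem ofList_smul_quot (x : A) (rs : List A) (m : ℕ) :
    (Ideal.ofList (x :: rs)) ^ m •
      (⊤ : Submodule A (N ⧸ (Ideal.span {x} • (⊤ : Submodule A N)))) =
    (Ideal.ofList rs) ^ m • (⊤ : Submodule A (N ⧸ (Ideal.span {x} • (⊤ : Submodule A N)))) := by
  have h1 : Ideal.span {x} • (⊤ : Submodule A (N ⧸ (Ideal.span {x} • (⊤ : Submodule A N)))) = ⊥ := by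
    rw [← Submodule.range_mkQ, ← Submodule.map_top, ← Submodule.map_smul'']
    exact Submodule.mkQ_map_self _
  induction m with
  | zero => simp
  | succ m ih =>
    rw [pow_succ', mul_smul, ih, Ideal.ofList_cons, Submodule.sup_smul, pow_succ', mul_smul]
    have : Ideal.span {x} • ((Ideal.ofList rs) ^ m •
      (⊤ : Submodule A (N ⧸ (Ideal.span {x} • (⊤ : Submodule A N))))) = ⊥ := by
      rw [eq_bot_iff, ← h1]
      exact Submodule.smul_mono le_rfl le_top
    rw [this, bot_sup_eq]

theorem length_ofList (rs : List A) : ∀ (N : Type u) [AddCommGroup N] [Module A N] (n : ℕ),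
    Module.length A (N ⧸ ((Ideal.ofList rs) ^ (n + 1) • (⊤ : Submodule A N))) ≤
      ((n + rs.length).choose rs.length : ℕ) *
        Module.length A (N ⧸ (Ideal.ofList rs • (⊤ : Submodule A N))) := by
  induction rs with
  | nil =>
    intro N _ _ n
    have h0 : Ideal.ofList ([] : List A) = ⊥ := Ideal.ofList_nil
    rw [h0, ← Ideal.zero_eq_bot, zero_pow (Nat.succ_ne_zero n)]
    simp
  | cons x rs ih =>
    intro N _ _ n
    have hx : x ∈ Ideal.ofList (x :: rs) := Ideal.subset_span (by simp)
    refine length_sum _ x hx rs.length _ ?_ n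
    intro n
    rw [ofList_smul_quot]
    refine (ih _ n).trans ?_
    gcongr
    rw [length_quot_quot, Ideal.ofList_cons, Submodule.sup_smul]

end Len

section Dim
variable {A : Type u} [CommRing A] [IsLocalRing A] [IsNoetherianRing A]

/-- elementwise filter-regularity -/
def FR (I : Ideal A) (N : Type u) [AddCommGroup N] [Module A N] (x : A) : Prop :=
  ∃ c : ℕ, ∀ n, c ≤ n → ∀ y ∈ I ^ n • (⊤ : Submodule A N),
    x • y ∈ I ^ (n + 2) • (⊤ : Submodule A N) → y ∈ I ^ (n + 1) • (⊤ : Submodule A N)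

variable {N : Type u} [AddCommGroup N] [Module A N] [Module.Finite A N]

theorem FR.ann {I : Ideal A} (hI : I ≠ ⊤) {x : A} (h : FR I N x) :
    ∃ n, ∀ y : N, x • y = 0 → ∀ r ∈ I ^ n, r • y = 0 := by
  obtain ⟨c, hc⟩ := h
  refine ⟨c, fun y hy r hr => ?_⟩
  have key : ∀ k, r • y ∈ I ^ (c + k) • (⊤ : Submodule A N) := by
    intro k
    induction k with
    | zero => exact Submodule.smul_mem_smul hr trivial
    | succ k ih =>
      refine hc (c + k) (Nat.le_add_right _ _) _ ih ?_
      rw [smul_comm, hy, smul_zero]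
      exact zero_mem _
  have hk := Ideal.iInf_pow_smul_eq_bot_of_isLocalRing (M := N) I hI
  rw [← Submodule.mem_bot A, ← hk, Submodule.mem_iInf]
  intro i
  refine Submodule.smul_mono (Ideal.pow_le_pow_right (Nat.le_add_left i c)) le_rfl (key i)

theorem prime_eq_of_dim_zero (h : Module.supportDim A N ≤ 0) (p : Ideal A) [hp : p.IsPrime]
    (hpa : Module.annihilator A N ≤ p) : p = maximalIdeal A := by
  have h1 : (⟨p, hp⟩ : PrimeSpectrum A) ∈ Module.support A N :=
    Module.mem_support_iff_of_finite.2 hpa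
  have hle : p ≤ maximalIdeal A := le_maximalIdeal hp.ne_top
  have h2 : (⟨maximalIdeal A, inferInstance⟩ : PrimeSpectrum A) ∈ Module.support A N :=
    Module.mem_support_iff_of_finite.2 (hpa.trans hle)
  rw [Module.supportDim, Order.krullDim_nonpos_iff_forall_isMax] at h
  have := h ⟨_, h1⟩ (b := ⟨_, h2⟩) hle
  exact le_antisymm hle this

theorem exists_pow_le_ann (h : Module.supportDim A N ≤ 0) :
    ∃ k, maximalIdeal A ^ k ≤ Module.annihilator A N := by
  apply Ideal.exists_pow_le_of_le_radical_of_fg _ (IsNoetherian.noetherian _)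
  rw [Ideal.radical_eq_sInf]
  refine le_sInf ?_
  rintro p ⟨hpa, hp⟩
  exact (prime_eq_of_dim_zero h p hpa).ge

theorem dim_drop {I : Ideal A} (hI : I ≠ ⊤) (k : ℕ) (hk : maximalIdeal A ^ k ≤ I) {x : A}
    (h : FR I N x) (d : ℕ) (hd : Module.supportDim A N ≤ ((d + 1 : ℕ) : WithBot ℕ∞)) :
    Module.supportDim A (N ⧸ (Ideal.span {x} • (⊤ : Submodule A N))) ≤ (d : WithBot ℕ∞) := by
  by_cases h0 : Module.supportDim A N ≤ 0
  · refine (Module.supportDim_le_of_surjective _ (Submodule.mkQ_surjective _)).trans (h0.trans ?_)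
    exact_mod_cast Nat.zero_le d
  · have hn : ∀ p ∈ (Module.annihilator A N).minimalPrimes, x ∉ p := by
      intro p hp hxp
      have hpp := hp.1.1
      apply h0
      have hass := Module.associatedPrimes.minimalPrimes_annihilator_subset_associatedPrimes A N hp
      obtain ⟨-, y, hy⟩ := isAssociatedPrime_iff.1 hass
      obtain ⟨n, hn⟩ := h.ann hI
      have hxy : x • y = 0 := by
        rw [hy, Submodule.mem_colon_singleton] at hxp
        simpa using hxp
      have hmp : maximalIdeal A ≤ p := by
        apply hpp.le_of_pow_le (n := k * n)
        rw [pow_mul]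
        refine (Ideal.pow_right_mono hk n).trans ?_
        intro r hr
        rw [hy, Submodule.mem_colon_singleton]
        simpa using hn y hxy r hr
      have hpm : p = maximalIdeal A := le_antisymm (le_maximalIdeal hpp.ne_top) hmp
      rw [Module.supportDim, Order.krullDim_nonpos_iff_forall_isMax]
      rintro ⟨q, hq⟩ ⟨q', hq'⟩ hqq
      change q'.asIdeal ≤ q.asIdeal
      refine (le_maximalIdeal q'.2.ne_top).trans ?_
      rw [← hpm]
      exact hp.2 ⟨q.2, Module.mem_support_iff_of_finite.1 hq⟩
        (by rw [hpm]; exact le_maximalIdeal q.2.ne_top)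
    have h1 := (Module.supportDim_quotSMulTop_succ_le_of_notMem_minimalPrimes hn).trans hd
    rw [Submodule.ideal_span_singleton_smul]
    change Module.supportDim A (QuotSMulTop x N) ≤ _
    generalize Module.supportDim A (QuotSMulTop x N) = s at h1
    induction s with
    | bot => exact bot_le
    | coe s =>
      have h2 : s + 1 ≤ ((d : ℕ∞) + 1) := by exact_mod_cast h1
      have h3 : s ≤ (d : ℕ∞) := by
        rcases eq_or_ne s ⊤ with rfl | hs
        · exfalso
          have : ((d : ℕ∞) + 1) = ((d + 1 : ℕ) : ℕ∞) := by push_cast; rfl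
          rw [this] at h2
          simp at h2
        · exact (ENat.add_le_add_iff_right (by simp)).1 h2
      exact_mod_cast h3

end Dim

section PartTwo
variable {A : Type u} [CommRing A] [IsLocalRing A] [IsNoetherianRing A]

theorem IsMaxPrimary.exists_pow {I : Ideal A} (hI : IsMaxPrimary I) :
    ∃ k, maximalIdeal A ^ k ≤ I :=
  Ideal.exists_pow_le_of_le_radical_of_fg hI.2.ge (IsNoetherian.noetherian _)

theorem FR_of_filterRegular {I : Ideal A} {N : Type u} [AddCommGroup N] [Module A N] {x : A}
    (h : (Ideal.stableFiltration I (⊤ : Submodule A N)).FilterRegular x) : FR I N x := by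
  obtain ⟨c, hc⟩ := eventually_atTop.1 h
  refine ⟨c, fun n hn y hy hxy => ?_⟩
  have := hc n hn
  simp only [Ideal.stableFiltration_N] at this
  rw [← this]
  exact ⟨hxy, hy⟩

theorem length_le_extDeg (I : Ideal A) (hI : IsMaxPrimary I)
    (D : (N : Type u) → [AddCommGroup N] → [Module A N] → ℕ)
    (hD : IsExtendedDegree I D) (d : ℕ) :
    ∀ (N : Type u) [AddCommGroup N] [Module A N] [Module.Finite A N],
      Module.supportDim A N ≤ (d : WithBot ℕ∞) → ∀ n : ℕ,
      Module.length A (N ⧸ (I ^ (n + 1) • (⊤ : Submodule A N))) ≤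
        ((n + d).choose d : ℕ) * (D N : ℕ∞) := by
  induction d with
  | zero =>
    intro N _ _ _ hN n
    obtain ⟨k, hk⟩ := exists_pow_le_ann (by simpa using hN)
    have htop : lcZero (maximalIdeal A) N = ⊤ := by
      rw [eq_top_iff]
      refine le_trans ?_ (le_iSup _ k)
      intro y _
      rw [Submodule.mem_torsionBySet_iff]
      rintro ⟨a, ha⟩
      exact Module.mem_annihilator.1 (hk ha) y
    have h := hD.h0_add N
    rw [moduleLength, ← Module.coe_length, htop, Module.length_top] at h
    have h' : (D N : ℕ∞) = (D (N ⧸ (⊤ : Submodule A N)) : ℕ∞) + Module.length A N := by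
      rw [← WithBot.coe_inj]
      exact_mod_cast h
    simp only [add_zero, Nat.choose_zero_right, Nat.cast_one, one_mul]
    refine (Module.length_le_of_surjective _ (Submodule.mkQ_surjective _)).trans ?_
    rw [h']
    exact le_add_self
  | succ d ih =>
    intro N _ _ _ hN n
    rcases subsingleton_or_nontrivial N with hs | hs
    · have : Module.length A (N ⧸ (I ^ (n + 1) • (⊤ : Submodule A N))) = 0 :=
        Module.length_eq_zero
      rw [this]
      exact zero_le
    · obtain ⟨x, hxI, -, hfr, hDx⟩ := hD.generic N hs
      obtain ⟨k, hk⟩ := hI.exists_pow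
      refine length_sum I x hxI d _ ?_ n
      intro m
      refine (ih _ (dim_drop hI.1 k hk (FR_of_filterRegular hfr) d hN) m).trans ?_
      gcongr
end PartTwo

section Superficial
open Polynomial

theorem avoid {R : Type u} [CommRing R] [IsLocalRing R] [Infinite (ResidueField R)]
    {E : Type u} [AddCommGroup E] [Module R E] (s : Set (Submodule R E)) (hs : s.Finite)
    (h : ∀ P ∈ s, P ≠ ⊤) : ∃ x : E, ∀ P ∈ s, x ∉ P := by
  by_contra! hcon
  have hc : ⋃ i ∈ hs.toFinset, ((id i : Submodule R E) : Set E) = Set.univ := by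
    rw [Set.eq_univ_iff_forall]
    intro x
    obtain ⟨P, hP, hx⟩ := hcon x
    simp only [Set.mem_iUnion]
    exact ⟨P, by simpa using hP, hx⟩
  obtain ⟨P, hP, hfi⟩ := Submodule.exists_finiteIndex_of_cover hc
  have hfin : Finite (E ⧸ P) := by
    have hfi' : P.toAddSubgroup.FiniteIndex := hfi
    exact AddSubgroup.finite_quotient_of_finiteIndex (H := P.toAddSubgroup)
  have hnt : Nontrivial (E ⧸ P) :=
    Submodule.Quotient.nontrivial_iff.mpr (h P (by simpa using hP))
  obtain ⟨y, hy⟩ := exists_ne (0 : E ⧸ P)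
  have hker : LinearMap.ker (LinearMap.toSpanSingleton R (E ⧸ P) y) ≤ maximalIdeal R := by
    apply le_maximalIdeal
    intro htop
    apply hy
    have : (1 : R) ∈ LinearMap.ker (LinearMap.toSpanSingleton R (E ⧸ P) y) := by
      rw [htop]; trivial
    simpa using this
  have : Finite (ResidueField R) := by
    have h2 : ∀ z : Set.range (LinearMap.toSpanSingleton R (E ⧸ P) y), ∃ r : R,
      LinearMap.toSpanSingleton R (E ⧸ P) y r = z := fun z => z.2
    choose g hg using h2
    have : Finite (Set.range (LinearMap.toSpanSingleton R (E ⧸ P) y)) :=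
      Subtype.finite
    refine Finite.of_surjective (fun z => residue R (g z)) ?_
    intro b
    obtain ⟨r, rfl⟩ := residue_surjective b
    refine ⟨⟨_, r, rfl⟩, ?_⟩
    rw [← sub_eq_zero, ← map_sub, residue_eq_zero_iff]
    apply hker
    rw [LinearMap.mem_ker, map_sub, hg, sub_self]
  exact not_finite (ResidueField R)

variable {R : Type u} [CommRing R] (Q : Ideal R)

/-- degree one part of the Rees algebra -/
noncomputable def degOne : Q →ₗ[R] reesAlgebra Q :=
  LinearMap.codRestrict (Subalgebra.toSubmodule (reesAlgebra Q))
    ((Polynomial.monomial 1).comp Q.subtype) (by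
      intro x
      exact reesAlgebra.monomial_mem.2 (by simp))

theorem degOne_coe (x : Q) : ((degOne Q x : reesAlgebra Q) : R[X]) = monomial 1 (x : R) := rfl

/-- irrelevant ideal -/
noncomputable def irr : Ideal (reesAlgebra Q) := Ideal.span (Set.range (degOne Q))

theorem mem_irr_pow (n : ℕ) : ∀ y ∈ Q ^ n, ∃ h : monomial n y ∈ reesAlgebra Q,
    (⟨monomial n y, h⟩ : reesAlgebra Q) ∈ irr Q ^ n := by
  induction n with
  | zero => intro y hy; exact ⟨reesAlgebra.monomial_mem.2 hy, by simp⟩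
  | succ n ih =>
    intro y hy
    rw [pow_succ'] at hy
    refine Submodule.mul_induction_on hy ?_ ?_
    · intro a ha b hb
      obtain ⟨h, h'⟩ := ih b hb
      have hm := Ideal.mul_mem_mul (Ideal.subset_span ⟨⟨a, ha⟩, rfl⟩ : degOne Q ⟨a, ha⟩ ∈ irr Q) h'
      have e : ((degOne Q ⟨a, ha⟩ * ⟨monomial n b, h⟩ : reesAlgebra Q) : R[X]) =
          monomial (n + 1) (a * b) := by
        simp [degOne_coe, Polynomial.monomial_mul_monomial, add_comm]
      change _ ∈ irr Q * irr Q ^ n at hm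
      rw [← pow_succ'] at hm
      refine ⟨e ▸ Subtype.property _, ?_⟩
      convert hm
      exact e.symm
    · rintro a b ⟨ha, ha'⟩ ⟨hb, hb'⟩
      have e : monomial (n + 1) (a + b) = monomial (n + 1) a + monomial (n + 1) b := map_add _ _ _
      refine ⟨e ▸ add_mem ha hb, ?_⟩
      convert add_mem ha' hb'
      exact e

theorem mem_map_of_mem (n : ℕ) : ∀ y ∈ Q ^ (n + 1), ∃ h : monomial n y ∈ reesAlgebra Q,
    (⟨monomial n y, h⟩ : reesAlgebra Q) ∈ Q.map (algebraMap R (reesAlgebra Q)) := by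
  intro y hy
  rw [pow_succ'] at hy
  refine Submodule.mul_induction_on hy ?_ ?_
  · intro a ha b hb
    have hm := Ideal.mul_mem_right (⟨monomial n b, reesAlgebra.monomial_mem.2 hb⟩ : reesAlgebra Q)
      _ (Ideal.mem_map_of_mem (algebraMap R (reesAlgebra Q)) ha)
    have e : ((algebraMap R (reesAlgebra Q) a * ⟨monomial n b, reesAlgebra.monomial_mem.2 hb⟩ :
        reesAlgebra Q) : R[X]) = monomial n (a * b) := by
      change algebraMap R R[X] a * monomial n b = _
      rw [Polynomial.algebraMap_apply, Algebra.algebraMap_self_apply, Polynomial.C_mul_monomial]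
    refine ⟨e ▸ Subtype.property _, ?_⟩
    convert hm
    exact e.symm
  · rintro a b ⟨ha, ha'⟩ ⟨hb, hb'⟩
    have e : monomial n (a + b) = monomial n a + monomial n b := map_add _ _ _
    refine ⟨e ▸ add_mem ha hb, ?_⟩
    convert add_mem ha' hb'
    exact e

/-- elements with coefficients one step deeper -/
noncomputable def deeper : Ideal (reesAlgebra Q) where
  carrier := {f | ∀ i, (f : R[X]).coeff i ∈ Q ^ (i + 1)}
  add_mem' ha hb i := by simpa using add_mem (ha i) (hb i)
  zero_mem' i := by simp
  smul_mem' s f hf i := by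
    change ((s : R[X]) * (f : R[X])).coeff i ∈ _
    rw [Polynomial.coeff_mul]
    refine sum_mem ?_
    rintro ⟨a, b⟩ hab
    rw [Finset.HasAntidiagonal.mem_antidiagonal] at hab
    dsimp only at hab ⊢
    rw [← hab, add_assoc, pow_add]
    exact Ideal.mul_mem_mul (s.2 a) (hf b)

theorem map_le_deeper : Q.map (algebraMap R (reesAlgebra Q)) ≤ deeper Q := by
  rw [Ideal.map_le_iff_le_comap]
  intro a ha i
  change (algebraMap R R[X] a).coeff i ∈ _
  rw [Polynomial.algebraMap_apply, Algebra.algebraMap_self_apply, Polynomial.coeff_C]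
  split_ifs with h
  · subst h; simpa using ha
  · exact zero_mem _

theorem superficial_core {R S : Type u} [CommRing R] [IsLocalRing R] [Infinite (ResidueField R)]
    [CommRing S] [IsNoetherianRing S] [Algebra R S] {E : Type u} [AddCommGroup E] [Module R E]
    (φ : E →ₗ[R] S) (J : Ideal S) :
    ∃ x : E, ∃ c : ℕ, ∀ n, c ≤ n → ∀ t ∈ (Ideal.span (Set.range φ)) ^ n,
      φ x * t ∈ J → t ∈ J := by
  let T : Ideal S := Ideal.span (Set.range φ)
  let s : Set (Submodule R E) :=
    Set.image (fun P : Ideal S => (P.restrictScalars R).comap φ)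
      {P | P ∈ associatedPrimes S (S ⧸ J) ∧ ¬ T ≤ P}
  have hsf : s.Finite := ((associatedPrimes.finite S (S ⧸ J)).subset (fun P h => h.1)).image _
  obtain ⟨x, hx⟩ := avoid (R := R) s hsf (by
    rintro _ ⟨P, ⟨-, hP⟩, rfl⟩ htop
    apply hP
    refine Ideal.span_le.2 ?_
    rintro _ ⟨q, rfl⟩
    have : q ∈ (P.restrictScalars R).comap φ := by
      have h2 : q ∈ (⊤ : Submodule R E) := trivial
      rwa [← htop] at h2
    exact this)
  let K : Submodule S (S ⧸ J) := LinearMap.ker (LinearMap.lsmul S (S ⧸ J) (φ x))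
  have hxK : φ x ∈ Module.annihilator S K := by
    rw [Module.mem_annihilator]
    rintro ⟨k, hk⟩
    exact Subtype.ext hk
  have hrad : T ≤ (Module.annihilator S K).radical := by
    rw [← Ideal.sInf_minimalPrimes]
    refine le_sInf ?_
    intro p hp
    have hass := Module.associatedPrimes.minimalPrimes_annihilator_subset_associatedPrimes S K hp
    have hass' := associatedPrimes.subset_of_injective K.injective_subtype hass
    by_contra hcon
    exact hx _ ⟨p, ⟨hass', hcon⟩, rfl⟩ (hp.1.2 hxK)
  obtain ⟨N, hN⟩ := Ideal.exists_pow_le_of_le_radical_of_fg hrad (IsNoetherian.noetherian _)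
  obtain ⟨c, hc⟩ := Ideal.exists_pow_inf_eq_pow_smul T K
  have hzero : ∀ n, c + N ≤ n → T ^ n • (⊤ : Submodule S (S ⧸ J)) ⊓ K = ⊥ := by
    intro n hn
    rw [hc n (by omega), eq_bot_iff]
    refine Submodule.smul_le.2 ?_
    intro r hr k hk
    have h1 : r ∈ Module.annihilator S K := hN (Ideal.pow_le_pow_right (by omega) hr)
    exact congrArg Subtype.val (Module.mem_annihilator.1 h1 ⟨k, hk.2⟩)
  refine ⟨x, c + N, fun n hn t ht hxt => ?_⟩
  have hmem : (Ideal.Quotient.mk J t : S ⧸ J) ∈ T ^ n • (⊤ : Submodule S (S ⧸ J)) ⊓ K := by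
    constructor
    · have := Submodule.smul_mem_smul ht
        (Submodule.mem_top : (1 : S ⧸ J) ∈ (⊤ : Submodule S (S ⧸ J)))
      convert this
      rw [Algebra.smul_def, mul_one]
      rfl
    · change φ x • Ideal.Quotient.mk J t = 0
      rw [Algebra.smul_def]
      change Ideal.Quotient.mk J (φ x * t) = 0
      rwa [Ideal.Quotient.eq_zero_iff_mem]
  rw [hzero n hn, Submodule.mem_bot, Ideal.Quotient.eq_zero_iff_mem] at hmem
  exact hmem

theorem exists_superficial [IsLocalRing R] [IsNoetherianRing R] [Infinite (ResidueField R)] :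
    ∃ x ∈ Q, FR Q R x := by
  obtain ⟨x, c, hc⟩ := superficial_core (degOne Q) (Q.map (algebraMap R (reesAlgebra Q)))
  refine ⟨x, x.2, c, fun n hn y hy hxy => ?_⟩
  simp only [smul_eq_mul, Ideal.mul_top] at hy hxy ⊢
  obtain ⟨h1, h1'⟩ := mem_irr_pow Q n y hy
  obtain ⟨h2, h2'⟩ := mem_map_of_mem Q (n + 1) _ hxy
  have := map_le_deeper Q (hc n hn _ h1' (by
    convert h2'
    simp [degOne_coe, Polynomial.monomial_mul_monomial, add_comm])) n
  simpa using this
end Superficial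

section Reductions

theorem FR.inter {R : Type u} [CommRing R] [IsNoetherianRing R] {Q : Ideal R}
    {x : R} (h : FR Q R x) :
    ∃ n₀, ∀ n, n₀ ≤ n → ∀ b ∈ Ideal.span {x}, b ∈ Q ^ (n + 1) → b ∈ Ideal.span {x} * Q ^ n := by
  obtain ⟨c, hc⟩ := h
  simp only [smul_eq_mul, Ideal.mul_top] at hc
  obtain ⟨k, hk⟩ := Ideal.exists_pow_inf_eq_pow_smul Q (Ideal.span {x} : Submodule R R)
  refine ⟨c + k, fun n hn b hb hbQ => ?_⟩
  have h1 : b ∈ Q ^ (n + 1) • (⊤ : Submodule R R) ⊓ (Ideal.span {x} : Submodule R R) :=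
    ⟨by simpa using hbQ, hb⟩
  rw [hk (n + 1) (by omega)] at h1
  have h2 : b ∈ Q ^ (n + 1 - k) * Ideal.span {x} := Submodule.smul_mono le_rfl inf_le_right h1
  rw [mul_comm, Ideal.mem_span_singleton_mul] at h2
  obtain ⟨y, hy, rfl⟩ := h2
  have key : ∀ j, c + j ≤ n → y ∈ Q ^ (c + j) := by
    intro j
    induction j with
    | zero => intro _; exact Ideal.pow_le_pow_right (by omega) hy
    | succ j ih =>
      intro hj
      exact hc (c + j) (by omega) y (ih (by omega)) (Ideal.pow_le_pow_right (by omega) hbQ)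
  rw [Ideal.mem_span_singleton_mul]
  refine ⟨y, ?_, rfl⟩
  have := key (n - c) (by omega)
  rwa [show c + (n - c) = n by omega] at this

theorem exists_red (d : ℕ) : ∀ (R : Type u) [CommRing R] [IsLocalRing R] [IsNoetherianRing R]
    [Infinite (ResidueField R)] (Q : Ideal R) (k : ℕ),
    Module.supportDim R R ≤ (d : WithBot ℕ∞) → Q ≠ ⊤ → maximalIdeal R ^ k ≤ Q →
    ∃ rs : List R, rs.length = d ∧ (∀ y ∈ rs, y ∈ Q) ∧
      ∃ n₀, ∀ n, n₀ ≤ n → Q ^ (n + 1) ≤ Ideal.ofList rs * Q ^ n := by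
  induction d with
  | zero =>
    intro R _ _ _ _ Q k hR hQ hk
    refine ⟨[], rfl, by simp, ?_⟩
    obtain ⟨j, hj⟩ := exists_pow_le_ann (A := R) (N := R) (by simpa using hR)
    refine ⟨j, fun n hn => ?_⟩
    have h1 : Q ^ (n + 1) ≤ Module.annihilator R R :=
      (Ideal.pow_right_mono (le_maximalIdeal hQ) _).trans
        ((Ideal.pow_le_pow_right (by omega)).trans hj)
    intro z hz
    have := Module.mem_annihilator.1 (h1 hz) 1
    have hz0 : z = 0 := by simpa using this
    rw [hz0]
    exact zero_mem _
  | succ d ih =>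
    intro R _ _ _ _ Q k hR hQ hk
    obtain ⟨x, hxQ, hfr⟩ := exists_superficial Q
    have hxm : Ideal.span {x} ≤ Q := by
      rw [Ideal.span_singleton_le_iff_mem]; exact hxQ
    have hdim := dim_drop hQ k hk hfr d hR
    rw [smul_eq_mul, Ideal.mul_top, Module.supportDim_quotient_eq_ringKrullDim,
      ← Module.supportDim_self_eq_ringKrullDim] at hdim
    have hnt : Nontrivial (R ⧸ Ideal.span {x}) :=
      Ideal.Quotient.nontrivial_iff.2 (fun h => hQ (eq_top_iff.2 (h ▸ hxm)))
    let π := Ideal.Quotient.mk (Ideal.span {x})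
    have hπ : Function.Surjective π := Ideal.Quotient.mk_surjective
    have hloc : IsLocalRing (R ⧸ Ideal.span {x}) := IsLocalRing.of_surjective' π hπ
    have hlh : IsLocalHom π := hπ.isLocalHom
    have hinf : Infinite (ResidueField (R ⧸ Ideal.span {x})) :=
      Infinite.of_injective (ResidueField.map π) (ResidueField.map π).injective
    have hcm : ∀ L : Ideal R, (L.map π).comap π = L ⊔ Ideal.span {x} := by
      intro L
      rw [Ideal.comap_map_of_surjective' π hπ, Ideal.mk_ker]
    have hcQ : (Q.map π).comap π = Q := by rw [hcm, sup_eq_left.2 hxm]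
    have hQ' : Q.map π ≠ ⊤ := by
      intro h
      rw [h, Ideal.comap_top] at hcQ
      exact hQ hcQ.symm
    have hk' : maximalIdeal (R ⧸ Ideal.span {x}) ^ k ≤ Q.map π := by
      have hcmax : (maximalIdeal (R ⧸ Ideal.span {x})).comap π = maximalIdeal R :=
        ((IsLocalRing.local_hom_TFAE π).out 0 4).1 hlh
      have : maximalIdeal (R ⧸ Ideal.span {x}) = (maximalIdeal R).map π := by
        rw [← hcmax, Ideal.map_comap_of_surjective π hπ]
      rw [this, ← Ideal.map_pow]
      exact Ideal.map_mono hk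
    obtain ⟨rs', hlen, hmem, n₁, hn₁⟩ := ih (R ⧸ Ideal.span {x}) (Q.map π) k hdim hQ' hk'
    obtain ⟨rs, rfl⟩ := (List.map_surjective_iff.2 hπ) rs'
    obtain ⟨n₂, hn₂⟩ := hfr.inter
    have hrsQ : ∀ y ∈ rs, y ∈ Q := by
      intro y hy
      rw [← hcQ]
      exact hmem (π y) (List.mem_map_of_mem hy)
    refine ⟨x :: rs, by simpa using hlen, ?_, n₁ + n₂, ?_⟩
    · intro y hy
      rcases List.mem_cons.1 hy with rfl | hy
      · exact hxQ
      · exact hrsQ y hy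
    · intro n hn z hz
      have h1 := hn₁ n (by omega)
      rw [← Ideal.map_ofList, ← Ideal.map_pow, ← Ideal.map_pow, ← Ideal.map_mul,
        Ideal.map_le_iff_le_comap, hcm] at h1
      obtain ⟨a, ha, b, hb, rfl⟩ := Submodule.mem_sup.1 (h1 hz)
      have haQ : a ∈ Q ^ (n + 1) := by
        rw [pow_succ']
        refine Ideal.mul_mono_left ?_ ha
        exact Ideal.span_le.2 hrsQ
      have hbQ : b ∈ Q ^ (n + 1) := (Ideal.add_mem_iff_right _ haQ).1 hz
      have hb' := hn₂ n (by omega) b hb hbQ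
      rw [Ideal.ofList_cons, Ideal.sup_mul]
      exact add_mem (Submodule.mem_sup_right ha) (Submodule.mem_sup_left hb')

theorem minimalReduction_eq {R : Type u} [CommRing R] [IsLocalRing R] [IsNoetherianRing R]
    [Infinite (ResidueField R)] (J Q : Ideal R) (k d : ℕ)
    (hR : ringKrullDim R ≤ (d : WithBot ℕ∞)) (hJ : J ≠ ⊤) (hk : maximalIdeal R ^ k ≤ J)
    (hQ : IsMinimalReduction J Q) : ∃ rs : List R, rs.length = d ∧ Q = Ideal.ofList rs := by
  obtain ⟨⟨hQJ, n₀, hn₀⟩, hmin⟩ := hQ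
  have hQtop : Q ≠ ⊤ := fun h => hJ (eq_top_iff.2 (h ▸ hQJ))
  have hkQ : maximalIdeal R ^ (k * (n₀ + 1)) ≤ Q := by
    rw [pow_mul]
    refine (Ideal.pow_right_mono hk _).trans ?_
    rw [hn₀ n₀ le_rfl]
    exact Ideal.mul_le_inf.trans inf_le_left
  obtain ⟨rs, hlen, hmem, n₁, hn₁⟩ := exists_red d R Q _
    (by rwa [Module.supportDim_self_eq_ringKrullDim]) hQtop hkQ
  have hle : Ideal.ofList rs ≤ Q := Ideal.span_le.2 hmem
  refine ⟨rs, hlen, (hmin _ ⟨hle.trans hQJ, n₀ + n₁, ?_⟩ hle).symm⟩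
  have hpow : ∀ i m, n₀ ≤ m → J ^ (m + i) = Q ^ i * J ^ m := by
    intro i
    induction i with
    | zero => intro m _; simp
    | succ i ih =>
      intro m hm
      rw [← add_assoc, hn₀ (m + i) (by omega), ih m hm, ← mul_assoc, ← pow_succ']
  intro n hn
  apply le_antisymm
  · obtain ⟨m, rfl⟩ : ∃ m, n = m + n₁ := ⟨n - n₁, by omega⟩
    rw [add_assoc, hpow (n₁ + 1) m (by omega), hpow n₁ m (by omega), ← mul_assoc]
    exact Ideal.mul_mono_left (hn₁ n₁ le_rfl)
  · rw [pow_succ']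
    exact Ideal.mul_mono_left (hle.trans hQJ)

end Reductions

/-- **Lemma 1.8.** Let `dim M = d ≥ 1` and `I` an `𝔪`-primary ideal.  Then
(i)  `ℓ(M/I^{n+1}M) ≤ C(n+d, d)·ℓ(M/QM)` for every `n ≥ 0`, where `Q` is a minimal
     reduction of the ideal `I(A/Ann(M))`;
(ii) `ℓ(M/I^{n+1}M) ≤ C(n+d, d)·D(I,M)` for every `n ≥ 0` and any extended degree `D`.
The minimal reduction `Q` is an ideal of `A/Ann(M)`, and `QM` is realized via the
preimage of `Q` in `A` acting on `M`. -/
theorem hilbertSamuel_le_choose_mul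
    {A : Type u} [CommRing A] [IsLocalRing A] [IsNoetherianRing A]
    [Infinite (ResidueField A)]
    {M : Type u} [AddCommGroup M] [Module A M] [Module.Finite A M]
    (I : Ideal A) (hI : IsMaxPrimary I)
    (d : ℕ) (hd : 1 ≤ d)
    (hdim : ringKrullDim (A ⧸ Module.annihilator A M) = (d : WithBot ℕ∞))
    -- the Hilbert–Samuel function of `M` w.r.t. `I`
    (HIM : ℕ → ℕ)
    (hHIM : ∀ n : ℕ,
      moduleLength A (M ⧸ (I ^ (n + 1) • (⊤ : Submodule A M))) = (HIM n : WithBot ℕ∞))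
    -- a minimal reduction `Q` of `I(A/Ann M)`
    (Q : Ideal (A ⧸ Module.annihilator A M))
    (hQ : IsMinimalReduction (I.map (Ideal.Quotient.mk (Module.annihilator A M))) Q)
    (LQ : ℕ)
    (hLQ : moduleLength A
      (M ⧸ ((Q.comap (Ideal.Quotient.mk (Module.annihilator A M))) • (⊤ : Submodule A M)))
      = (LQ : WithBot ℕ∞))
    -- an arbitrary extended degree
    (D : (N : Type u) → [AddCommGroup N] → [Module A N] → ℕ)
    (hD : IsExtendedDegree I D) :
    (∀ n : ℕ, HIM n ≤ (n + d).choose d * LQ) ∧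
    (∀ n : ℕ, HIM n ≤ (n + d).choose d * D M) := by
  have hSup : Module.supportDim A M ≤ (d : WithBot ℕ∞) := by
    rw [Module.supportDim_eq_ringKrullDim_quotient_annihilator, hdim]
  have hH : ∀ n, Module.length A (M ⧸ (I ^ (n + 1) • (⊤ : Submodule A M))) = (HIM n : ℕ∞) := by
    intro n
    have := hHIM n
    rw [moduleLength, ← Module.coe_length] at this
    exact_mod_cast this
  refine ⟨fun n => ?_, fun n => ?_⟩
  · have hnt : Nontrivial (A ⧸ Module.annihilator A M) := by
      by_contra hcon
      rw [not_nontrivial_iff_subsingleton] at hcon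
      rw [ringKrullDim_eq_bot_of_subsingleton] at hdim
      simp at hdim
    have hatop : (Module.annihilator A M) ≠ ⊤ := Ideal.Quotient.nontrivial_iff.1 hnt
    have hsurj : Function.Surjective (Ideal.Quotient.mk (Module.annihilator A M)) := Ideal.Quotient.mk_surjective
    have hloc : IsLocalRing (A ⧸ (Module.annihilator A M)) := IsLocalRing.of_surjective' (Ideal.Quotient.mk (Module.annihilator A M)) hsurj
    have hlh : IsLocalHom (Ideal.Quotient.mk (Module.annihilator A M)) := hsurj.isLocalHom
    have hinf : Infinite (ResidueField (A ⧸ (Module.annihilator A M))) :=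
      Infinite.of_injective (ResidueField.map (Ideal.Quotient.mk (Module.annihilator A M))) (ResidueField.map (Ideal.Quotient.mk (Module.annihilator A M))).injective
    have hcm : ∀ L : Ideal A, (L.map (Ideal.Quotient.mk (Module.annihilator A M))).comap (Ideal.Quotient.mk (Module.annihilator A M)) = L ⊔ (Module.annihilator A M) := by
      intro L
      rw [Ideal.comap_map_of_surjective' (Ideal.Quotient.mk (Module.annihilator A M)) hsurj, Ideal.mk_ker]
    obtain ⟨k, hk⟩ := hI.exists_pow
    have hJ : I.map (Ideal.Quotient.mk (Module.annihilator A M)) ≠ ⊤ := by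
      intro h
      have h1 := hcm I
      rw [h, Ideal.comap_top] at h1
      have h2 : I ⊔ (Module.annihilator A M) ≤ maximalIdeal A :=
        sup_le (le_maximalIdeal hI.1) (le_maximalIdeal hatop)
      rw [← h1] at h2
      exact (maximalIdeal.isMaximal A).ne_top (top_le_iff.1 h2)
    have hk' : maximalIdeal (A ⧸ (Module.annihilator A M)) ^ k ≤ I.map (Ideal.Quotient.mk (Module.annihilator A M)) := by
      have hcmax : (maximalIdeal (A ⧸ (Module.annihilator A M))).comap (Ideal.Quotient.mk (Module.annihilator A M)) = maximalIdeal A :=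
        ((IsLocalRing.local_hom_TFAE (Ideal.Quotient.mk (Module.annihilator A M))).out 0 4).1 hlh
      have : maximalIdeal (A ⧸ (Module.annihilator A M)) = (maximalIdeal A).map (Ideal.Quotient.mk (Module.annihilator A M)) := by
        rw [← hcmax, Ideal.map_comap_of_surjective (Ideal.Quotient.mk (Module.annihilator A M)) hsurj]
      rw [this, ← Ideal.map_pow]
      exact Ideal.map_mono hk
    obtain ⟨rs', hlen, hQrs⟩ := minimalReduction_eq (I.map (Ideal.Quotient.mk (Module.annihilator A M))) Q k d hdim.le hJ hk' hQ
    obtain ⟨rs, rfl⟩ := (List.map_surjective_iff.2 hsurj) rs'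
    rw [List.length_map] at hlen
    have hann : (Module.annihilator A M) • (⊤ : Submodule A M) = ⊥ := by
      rw [eq_bot_iff]
      refine Submodule.smul_le.2 ?_
      intro r hr y _
      exact Module.mem_annihilator.1 hr y
    have hqI : Ideal.ofList rs ≤ I ⊔ (Module.annihilator A M) := by
      have h1 := hQ.1.1
      rw [hQrs, ← Ideal.map_ofList, Ideal.map_le_iff_le_comap, hcm] at h1
      exact h1
    have hqpow : ∀ m : ℕ, Ideal.ofList rs ^ m • (⊤ : Submodule A M) ≤ I ^ m • ⊤ := by
      intro m
      induction m with
      | zero => simp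
      | succ m ih =>
        rw [pow_succ', mul_smul, pow_succ', mul_smul]
        refine (Submodule.smul_mono hqI ih).trans ?_
        rw [Submodule.sup_smul]
        refine sup_le le_rfl ?_
        refine (Submodule.smul_mono le_rfl le_top).trans ?_
        rw [hann]
        exact bot_le
    have hL : Module.length A (M ⧸ (Ideal.ofList rs • (⊤ : Submodule A M))) = (LQ : ℕ∞) := by
      rw [hQrs, ← Ideal.map_ofList, hcm, Submodule.sup_smul, hann, sup_bot_eq, moduleLength,
        ← Module.coe_length] at hLQ
      exact_mod_cast hLQ
    have h1 := length_ofList rs M n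
    rw [hL, hlen] at h1
    have h2 : Module.length A (M ⧸ (I ^ (n + 1) • (⊤ : Submodule A M))) ≤
        Module.length A (M ⧸ (Ideal.ofList rs ^ (n + 1) • (⊤ : Submodule A M))) :=
      Module.length_le_of_surjective _ (Submodule.factor_surjective (hqpow (n + 1)))
    rw [hH n] at h2
    exact_mod_cast h2.trans h1
  · have h1 := length_le_extDeg I hI D hD d M hSup n
    rw [hH n] at h1
    exact_mod_cast h1
end

section
/- Let M be a finitely generated A-module with dim M = d ≥ 1, 𝓜 = {M_n}_{n≥0} a good I-filtration of M, and D(I,M) any extended degree. Then: (i) e_0(𝓜) = e(I,M) ≤ D(I,M); (ii) |e_1(𝓜)| ≤ (D(I,M) + r(𝓜) − 1) · D(I,M); (iii) |e_i(𝓜)| ≤ (D(I,M) + r(𝓜) + 1)^{3·i! − i + 1} for every i with 2 ≤ i ≤ d. -/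
/-!
Formalization of results from:
L.X. Dung, L.T. Hoa, "Castelnuovo-Mumford regularity of associated graded modules
and fiber cones of filtered modules".

Setting: `(A, 𝔪)` is a Noetherian local ring with infinite residue field, `I` an
`𝔪`-primary ideal, `M` a finitely generated `A`-module, and `𝓜 = {M_n}` a good
`I`-filtration of `M`.

Notions that are not available in Mathlib (the Castelnuovo–Mumford regularity of the
associated graded module `G(𝓜) = ⊕ M_n/M_{n+1}` over `G_I(A)`, defined via graded local
cohomology, and similar graded invariants) are taken as explicit parameters of the
theorems, documented where they occur.  Everything else is defined concretely below.
-/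

open Filter IsLocalRing

universe u

namespace HCB

section Length

variable {A : Type u} [CommRing A] {N N' : Type u} [AddCommGroup N] [Module A N]
  [AddCommGroup N'] [Module A N']

def FinCl (W : Submodule A N) : Prop := Module.length A (N ⧸ W) ≠ ⊤

/-- Colength as an integer. -/
noncomputable def cl (W : Submodule A N) : ℤ := ((Module.length A (N ⧸ W)).toNat : ℤ)

lemma cl_nonneg (W : Submodule A N) : 0 ≤ cl W := Int.natCast_nonneg _

lemma len_split {B C : Submodule A N} (h : B ≤ C) :
    Module.length A (N ⧸ B) =
      Module.length A (C ⧸ B.comap C.subtype) + Module.length A (N ⧸ C) := by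
  refine Module.length_eq_add_of_exact
    (Submodule.mapQ (B.comap C.subtype) B C.subtype le_rfl) (Submodule.factor h) ?_ ?_ ?_
  · rw [← LinearMap.ker_eq_bot, Submodule.ker_mapQ, Submodule.eq_bot_iff]
    rintro _ ⟨y, hy, rfl⟩
    simpa using hy
  · exact Submodule.factor_surjective h
  · intro y
    obtain ⟨y, rfl⟩ := Submodule.mkQ_surjective _ y
    constructor
    · intro hy
      have : y ∈ C := by simpa [Submodule.factor] using hy
      exact ⟨Submodule.Quotient.mk ⟨y, this⟩, by simp⟩
    · rintro ⟨z, hz⟩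
      obtain ⟨z, rfl⟩ := Submodule.mkQ_surjective _ z
      rw [← hz]
      simp [Submodule.factor]

/-- transfer of lengths along a linear map -/
lemma len_transfer (f : N →ₗ[A] N') (A' B : Submodule A N) (C' D' : Submodule A N')
    (h1 : A'.map f ⊔ D' = C') (h2 : A' ⊓ D'.comap f = B) :
    Module.length A (N ⧸ B) + Module.length A (N' ⧸ C') =
      Module.length A (N ⧸ A') + Module.length A (N' ⧸ D') := by
  have hB : B ≤ A' := h2 ▸ inf_le_left
  have hD : D' ≤ C' := h1 ▸ le_sup_right
  have hmap : ∀ v ∈ A', f v ∈ C' := fun v hv =>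
    h1 ▸ Submodule.mem_sup_left (Submodule.mem_map_of_mem hv)
  have key : Module.length A (A' ⧸ B.comap A'.subtype) =
      Module.length A (C' ⧸ D'.comap C'.subtype) := by
    let g : A' →ₗ[A] (C' ⧸ D'.comap C'.subtype) :=
      (D'.comap C'.subtype).mkQ ∘ₗ f.restrict hmap
    have hker : LinearMap.ker g = B.comap A'.subtype := by
      ext v
      simp only [g, LinearMap.mem_ker, LinearMap.comp_apply, Submodule.mkQ_apply,
        Submodule.Quotient.mk_eq_zero, Submodule.mem_comap, Submodule.subtype_apply,
        LinearMap.coe_restrict_apply]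
      rw [← h2]
      simp
    have hsurj : Function.Surjective g := by
      intro y
      obtain ⟨⟨y, hy⟩, rfl⟩ := Submodule.mkQ_surjective _ y
      have hy' := hy
      rw [← h1] at hy'
      obtain ⟨_, ⟨a, ha, rfl⟩, c, hc, hac⟩ := Submodule.mem_sup.mp hy'
      refine ⟨⟨a, ha⟩, ?_⟩
      simp only [g, LinearMap.comp_apply, Submodule.mkQ_apply]
      rw [Submodule.Quotient.eq, Submodule.mem_comap]
      simp only [Submodule.subtype_apply, Submodule.coe_sub, LinearMap.coe_restrict_apply]
      rw [← hac]
      simpa using hc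
    rw [← hker]
    exact (LinearMap.quotKerEquivOfSurjective g hsurj).length_eq
  rw [len_split hB, len_split hD, key]
  ac_rfl

lemma FinCl.mono {B C : Submodule A N} (h : B ≤ C) (hB : FinCl B) : FinCl C := by
  intro hC
  apply hB
  rw [len_split h, hC]; simp

lemma cl_coe {W : Submodule A N} (h : FinCl W) :
    ((Module.length A (N ⧸ W)).toNat : ℕ∞) = Module.length A (N ⧸ W) := ENat.natCast_toNat h

lemma cl_transfer (f : N →ₗ[A] N') (A' B : Submodule A N) (C' D' : Submodule A N')
    (h1 : A'.map f ⊔ D' = C') (h2 : A' ⊓ D'.comap f = B)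
    (hB : FinCl B) (hD : FinCl D') :
    cl B + cl C' = cl A' + cl D' := by
  have hA : FinCl A' := hB.mono (h2 ▸ inf_le_left)
  have hC : FinCl C' := hD.mono (h1 ▸ le_sup_right)
  have h := len_transfer f A' B C' D' h1 h2
  rw [← cl_coe hA, ← cl_coe hB, ← cl_coe hC, ← cl_coe hD] at h
  unfold cl
  exact_mod_cast h

lemma cl_top : cl (⊤ : Submodule A N) = 0 := by
  have : Subsingleton (N ⧸ (⊤ : Submodule A N)) := Submodule.Quotient.subsingleton_iff.mpr rfl
  simp [cl, Module.length_eq_zero]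

lemma finCl_top : FinCl (⊤ : Submodule A N) := by
  have : Subsingleton (N ⧸ (⊤ : Submodule A N)) := Submodule.Quotient.subsingleton_iff.mpr rfl
  simp [FinCl, Module.length_eq_zero]

lemma cl_anti {B C : Submodule A N} (h : B ≤ C) (hB : FinCl B) : cl C ≤ cl B := by
  have h1 := len_split h
  have hC := hB.mono h
  rw [← cl_coe hC, ← cl_coe hB] at h1
  have : (Module.length A (N ⧸ C)).toNat ≤ (Module.length A (N ⧸ B)).toNat := by
    have h2 : ((Module.length A (N ⧸ C)).toNat : ℕ∞) ≤ (Module.length A (N ⧸ B)).toNat := by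
      rw [h1]; exact le_add_self
    exact_mod_cast h2
  unfold cl; exact_mod_cast this

lemma eq_of_cl_eq {B C : Submodule A N} (h : B ≤ C) (hB : FinCl B) (he : cl B ≤ cl C) :
    B = C := by
  have he := le_antisymm he (cl_anti h hB)
  have h1 := len_split h
  have hC := hB.mono h
  have h3 : Module.length A (N ⧸ B) = Module.length A (N ⧸ C) := by
    rw [← cl_coe hC, ← cl_coe hB]
    unfold cl at he
    exact_mod_cast he
  rw [h3] at h1
  have h4 : Module.length A (C ⧸ B.comap C.subtype) = 0 := by
    have : (0 : ℕ∞) + Module.length A (N ⧸ C) =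
        Module.length A (C ⧸ B.comap C.subtype) + Module.length A (N ⧸ C) := by
      rw [zero_add]; exact h1
    exact ((ENat.add_left_injective_of_ne_top hC) this).symm
  rw [Module.length_eq_zero_iff, Submodule.Quotient.subsingleton_iff] at h4
  refine le_antisymm h fun v hv => ?_
  have : (⟨v, hv⟩ : C) ∈ B.comap C.subtype := by rw [h4]; trivial
  exact this

lemma finCl_comap (f : N →ₗ[A] N') (hf : Function.Surjective f) (W : Submodule A N') :
    FinCl (W.comap f) ↔ FinCl W := by
  have h := len_transfer f ⊤ (W.comap f) ⊤ W
    (by rw [Submodule.map_top, LinearMap.range_eq_top.mpr hf, top_sup_eq]) (by simp)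
  have e1 : Module.length A (N' ⧸ (⊤ : Submodule A N')) = 0 :=
    Module.length_eq_zero_iff.mpr (Submodule.Quotient.subsingleton_iff.mpr rfl)
  have e2 : Module.length A (N ⧸ (⊤ : Submodule A N)) = 0 :=
    Module.length_eq_zero_iff.mpr (Submodule.Quotient.subsingleton_iff.mpr rfl)
  rw [e1, e2, add_zero, zero_add] at h
  unfold FinCl
  rw [h]

lemma cl_comap (f : N →ₗ[A] N') (hf : Function.Surjective f) (W : Submodule A N') :
    cl (W.comap f) = cl W := by
  have h := len_transfer f ⊤ (W.comap f) ⊤ W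
    (by rw [Submodule.map_top, LinearMap.range_eq_top.mpr hf, top_sup_eq]) (by simp)
  have e1 : Module.length A (N' ⧸ (⊤ : Submodule A N')) = 0 :=
    Module.length_eq_zero_iff.mpr (Submodule.Quotient.subsingleton_iff.mpr rfl)
  have e2 : Module.length A (N ⧸ (⊤ : Submodule A N)) = 0 :=
    Module.length_eq_zero_iff.mpr (Submodule.Quotient.subsingleton_iff.mpr rfl)
  rw [e1, e2, add_zero, zero_add] at h
  unfold cl
  rw [h]

lemma cl_map_mkQ (U W : Submodule A N) : cl (W.map U.mkQ) = cl (W ⊔ U) := by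
  rw [← cl_comap U.mkQ (Submodule.mkQ_surjective U), Submodule.comap_map_mkQ, sup_comm]

lemma finCl_map_mkQ (U W : Submodule A N) : FinCl (W.map U.mkQ) ↔ FinCl (W ⊔ U) := by
  rw [← finCl_comap U.mkQ (Submodule.mkQ_surjective U), Submodule.comap_map_mkQ, sup_comm]

/-- multiplication by `x` as a linear map -/
noncomputable abbrev mulx (A : Type u) [CommRing A] (N : Type u) [AddCommGroup N] [Module A N]
    (x : A) : N →ₗ[A] N := LinearMap.lsmul A N x

lemma mulx_apply (x : A) (v : N) : mulx A N x v = x • v := rfl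

/-- `xN`. -/
abbrev xN (A : Type u) [CommRing A] (N : Type u) [AddCommGroup N] [Module A N]
    (x : A) : Submodule A N := Ideal.span {x} • (⊤ : Submodule A N)

lemma mem_xN {x : A} {v : N} : v ∈ xN A N x ↔ ∃ w : N, x • w = v := by
  rw [xN, Submodule.ideal_span_singleton_smul, Submodule.mem_smul_pointwise_iff_exists]
  simp

lemma cl_x (x : A) (W : Submodule A N) (hW : FinCl W) (hW' : FinCl (W.comap (mulx A N x))) :
    cl W = cl (W ⊔ xN A N x) + cl (W.comap (mulx A N x)) := by
  have h := cl_transfer (mulx A N x) ⊤ (W.comap (mulx A N x)) (W ⊔ xN A N x) W (by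
    rw [sup_comm]
    congr 1
    ext v
    rw [mem_xN]
    simp) (by simp) hW' hW
  rw [cl_top] at h
  linarith

end Length
end HCB

namespace HCB

section Poly

/-- backward difference -/
def nab (P : ℤ → ℤ) : ℤ → ℤ := fun t => P t - P (t - 1)

lemma nab_sub_const (P : ℤ → ℤ) (c : ℤ) : nab (fun t => P t - c) = nab P := by
  funext t; simp [nab]

lemma nab_iter_succ (P : ℤ → ℤ) (k : ℕ) : nab^[k] (nab P) = nab^[k+1] P :=
  (Function.iterate_succ_apply nab k P).symm

lemma nab_iter_succ' (P : ℤ → ℤ) (k : ℕ) : nab (nab^[k] P) = nab^[k+1] P :=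
  (Function.iterate_succ_apply' nab k P).symm

lemma nab_zero : nab 0 = 0 := by funext t; simp [nab]

lemma nab_iter_zero (k : ℕ) : nab^[k] 0 = 0 := by
  induction k with
  | zero => rfl
  | succ k ih => rw [Function.iterate_succ_apply, nab_zero, ih]

lemma nab_iter_sub_const (P : ℤ → ℤ) (c : ℤ) (k : ℕ) (hk : 1 ≤ k) :
    nab^[k] (fun t => P t - c) = nab^[k] P := by
  obtain ⟨k, rfl⟩ : ∃ j, k = j + 1 := ⟨k - 1, by omega⟩
  rw [← nab_iter_succ, ← nab_iter_succ, nab_sub_const]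

lemma nab_sub (P Q : ℤ → ℤ) : nab (P - Q) = nab P - nab Q := by
  funext t; simp [nab]; ring

lemma nab_iter_sub (P Q : ℤ → ℤ) (k : ℕ) : nab^[k] (P - Q) = nab^[k] P - nab^[k] Q := by
  induction k generalizing P Q with
  | zero => rfl
  | succ k ih => rw [Function.iterate_succ_apply, nab_sub, ih]; rfl

lemma const_of_nab {P : ℤ → ℤ} (h : nab P = 0) (t s : ℤ) : P t = P s := by
  have hstep : ∀ t, P t = P (t - 1) := fun t => by
    have := congrFun h t
    simp [nab] at this
    linarith
  have h0 : ∀ t, P t = P 0 := by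
    intro t
    induction t using Int.induction_on with
    | zero => rfl
    | succ i ih => rw [hstep]; simpa using ih
    | pred i ih => rw [← hstep]; exact ih
  rw [h0 t, h0 s]

lemma ev_zero (k : ℕ) (P : ℤ → ℤ) (h : nab^[k] P = 0) (hev : ∀ᶠ n : ℕ in atTop, P n = 0) :
    P = 0 := by
  induction k generalizing P with
  | zero => exact h
  | succ k ih =>
    have h1 : nab P = 0 := by
      apply ih
      · rwa [nab_iter_succ]
      · obtain ⟨n0, hn0⟩ := eventually_atTop.mp hev
        refine eventually_atTop.mpr ⟨n0 + 1, fun n hn => ?_⟩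
        have a1 := hn0 n (by omega)
        have a2 := hn0 (n - 1) (by omega)
        rw [Nat.cast_sub (by omega)] at a2
        simp only [nab, a1]
        simp at a2
        rw [a2]; simp
    obtain ⟨n, hn⟩ := hev.exists
    funext t
    rw [const_of_nab h1 t n, hn]; rfl

end Poly

section Filt

variable {A : Type u} [CommRing A] {I : Ideal A} {N : Type u} [AddCommGroup N] [Module A N]

/-- `Ṽ_n = {v : ∃ k, I^k v ⊆ V_{n+k}}` -/
def tl (F : I.Filtration N) (n : ℕ) : Submodule A N where
  carrier := {v | ∃ k0, ∀ k ≥ k0, ∀ a ∈ I ^ k, a • v ∈ F.N (n + k)}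
  zero_mem' := ⟨0, fun k _ a _ => by simp⟩
  add_mem' := by
    rintro v w ⟨k, hk⟩ ⟨l, hl⟩
    refine ⟨max k l, fun j hj a ha => ?_⟩
    rw [smul_add]
    exact add_mem (hk j (le_trans (le_max_left _ _) hj) a ha)
      (hl j (le_trans (le_max_right _ _) hj) a ha)
  smul_mem' := by
    rintro c v ⟨k, hk⟩
    refine ⟨k, fun j hj a ha => ?_⟩
    rw [smul_comm]
    exact Submodule.smul_mem _ _ (hk j hj a ha)

lemma mem_tl {F : I.Filtration N} {n : ℕ} {v : N} :
    v ∈ tl F n ↔ ∃ k0, ∀ k ≥ k0, ∀ a ∈ I ^ k, a • v ∈ F.N (n + k) := Iff.rfl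

lemma smul_mem_N (F : I.Filtration N) {n k : ℕ} {a : A} {v : N} (ha : a ∈ I ^ k)
    (hv : v ∈ F.N n) : a • v ∈ F.N (n + k) := by
  have := F.pow_smul_le k n (Submodule.smul_mem_smul ha hv)
  rwa [add_comm]

lemma mem_tl_of_pow {F : I.Filtration N} {n k : ℕ} {v : N}
    (h : ∀ a ∈ I ^ k, a • v ∈ F.N (n + k)) : v ∈ tl F n := by
  refine ⟨k, fun j hj a ha => ?_⟩
  obtain ⟨i, rfl⟩ := Nat.exists_eq_add_of_le hj
  rw [pow_add] at ha
  refine Submodule.mul_induction_on ha (fun b hb c hc => ?_) (fun b c hb hc => ?_)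
  · rw [mul_comm, mul_smul, ← add_assoc]
    exact smul_mem_N F hc (h b hb)
  · rw [add_smul]; exact add_mem hb hc

lemma le_tl (F : I.Filtration N) (n : ℕ) : F.N n ≤ tl F n :=
  fun v hv => mem_tl_of_pow (k := 0) fun a _ => by simpa using Submodule.smul_mem _ a hv

lemma tl_succ_le (F : I.Filtration N) (n : ℕ) : tl F (n + 1) ≤ tl F n := by
  rintro v ⟨k, hk⟩
  exact ⟨k, fun j hj a ha => F.antitone (by omega) (hk j hj a ha)⟩

lemma tl_anti (F : I.Filtration N) : Antitone (tl F) := antitone_nat_of_succ_le (tl_succ_le F)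

lemma smul_mem_tl (F : I.Filtration N) {n : ℕ} {b : A} (hb : b ∈ I) {v : N} (hv : v ∈ tl F n) :
    b • v ∈ tl F (n + 1) := by
  obtain ⟨k, hk⟩ := hv
  refine ⟨k, fun j hj a ha => ?_⟩
  rw [smul_comm, show n + 1 + j = n + j + 1 by omega]
  exact F.smul_le _ (Submodule.smul_mem_smul hb (hk j hj a ha))

/-- `K_n = V_n ∩ Ṽ_{n+1}` -/
def kf (F : I.Filtration N) : I.Filtration N where
  N n := F.N n ⊓ tl F (n + 1)
  mono n := inf_le_inf (F.mono n) (tl_succ_le F _)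
  smul_le n := by
    rw [Submodule.smul_le]
    rintro b hb v ⟨h1, h2⟩
    exact ⟨F.smul_le _ (Submodule.smul_mem_smul hb h1), smul_mem_tl F hb h2⟩

lemma mem_kf {F : I.Filtration N} {n : ℕ} {v : N} :
    v ∈ (kf F).N n ↔ v ∈ F.N n ∧ v ∈ tl F (n + 1) := Iff.rfl

lemma kf_le (F : I.Filtration N) (n : ℕ) : (kf F).N n ≤ F.N n := inf_le_left

lemma le_kf (F : I.Filtration N) (n : ℕ) : F.N (n + 1) ≤ (kf F).N n :=
  le_inf (F.mono n) (le_tl F _)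

lemma tl_map {N' : Type u} [AddCommGroup N'] [Module A N'] (F : I.Filtration N)
    (F' : I.Filtration N') (f : N →ₗ[A] N') (h : ∀ n, (F.N n).map f ≤ F'.N n) {n : ℕ} {v : N}
    (hv : v ∈ tl F n) : f v ∈ tl F' n := by
  obtain ⟨k, hk⟩ := hv
  refine ⟨k, fun j hj a ha => ?_⟩
  rw [← map_smul]
  exact h _ (Submodule.mem_map_of_mem (hk j hj a ha))

lemma kf_map {N' : Type u} [AddCommGroup N'] [Module A N'] (F : I.Filtration N)
    (F' : I.Filtration N') (f : N →ₗ[A] N') (h : ∀ n, (F.N n).map f ≤ F'.N n) {n : ℕ} {v : N}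
    (hv : v ∈ (kf F).N n) : f v ∈ (kf F').N n :=
  ⟨h _ (Submodule.mem_map_of_mem hv.1), tl_map F F' f h hv.2⟩

lemma tl_uniform (F : I.Filtration N) (n : ℕ) (S : Submodule A N) (hS : S.FG) :
    S ≤ tl F n → ∃ k0, ∀ k ≥ k0, ∀ a ∈ I ^ k, ∀ v ∈ S, a • v ∈ F.N (n + k) := by
  refine Submodule.fg_induction (motive := fun S _ =>
    S ≤ tl F n → ∃ k0, ∀ k ≥ k0, ∀ a ∈ I ^ k, ∀ v ∈ S, a • v ∈ F.N (n + k)) ?_ ?_ S hS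
  · intro x hx
    obtain ⟨k0, hk⟩ := hx (Submodule.mem_span_singleton_self x)
    refine ⟨k0, fun k hk' a ha v hv => ?_⟩
    obtain ⟨c, rfl⟩ := Submodule.mem_span_singleton.mp hv
    rw [smul_comm]
    exact Submodule.smul_mem _ _ (hk k hk' a ha)
  · intro S T _ _ h1 h2 hST
    obtain ⟨k1, h1⟩ := h1 (le_sup_left.trans hST)
    obtain ⟨k2, h2⟩ := h2 (le_sup_right.trans hST)
    refine ⟨max k1 k2, fun k hk a ha v hv => ?_⟩
    obtain ⟨s, hs, t, ht, rfl⟩ := Submodule.mem_sup.mp hv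
    rw [smul_add]
    exact add_mem (h1 k (le_trans (le_max_left _ _) hk) a ha s hs)
      (h2 k (le_trans (le_max_right _ _) hk) a ha t ht)

lemma kf_eventually [IsNoetherianRing A] [Module.Finite A N] (F : I.Filtration N)
    (hF : F.Stable) : ∃ n0, ∀ n ≥ n0, (kf F).N n = F.N (n + 1) := by
  have hK : (kf F).Stable := Ideal.Filtration.Stable.of_le hF (fun n => kf_le F n)
  obtain ⟨n1, hn1⟩ := hK.exists_pow_smul_eq_of_ge
  obtain ⟨k0, hk⟩ := tl_uniform F (n1 + 1) ((kf F).N n1) (IsNoetherian.noetherian _)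
    (inf_le_right)
  refine ⟨n1 + k0, fun n hn => le_antisymm ?_ (le_kf F n)⟩
  rw [hn1 n (by omega), Submodule.smul_le]
  intro a ha v hv
  have := hk (n - n1) (by omega) a ha v hv
  rwa [show n1 + 1 + (n - n1) = n + 1 by omega] at this

/-- basic hypotheses on a filtration -/
structure Setup (F : I.Filtration N) (r : ℕ) : Prop where
  top : F.N 0 = ⊤
  gen : ∀ n ≥ r, F.N (n + 1) = I • F.N n
  fin : ∀ n, FinCl (F.N n)

lemma Setup.mono {F : I.Filtration N} {r s : ℕ} (h : Setup F r) (hrs : r ≤ s) : Setup F s :=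
  ⟨h.top, fun n hn => h.gen n (le_trans hrs hn), h.fin⟩

lemma Setup.stable {F : I.Filtration N} {r : ℕ} (h : Setup F r) : F.Stable :=
  ⟨r, fun n hn => (h.gen n hn).symm⟩

lemma Setup.quot {F : I.Filtration N} {r : ℕ} (h : Setup F r) (U : Submodule A N) :
    Setup (F.quot U) r where
  top := by
    change (F.N 0).map U.mkQ = ⊤
    rw [h.top, Submodule.map_top, Submodule.range_mkQ]
  gen n hn := by
    change (F.N (n+1)).map U.mkQ = I • (F.N n).map U.mkQ
    rw [h.gen n hn, Submodule.map_smul'']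
  fin n := by
    change FinCl ((F.N n).map U.mkQ)
    rw [finCl_map_mkQ]
    exact (h.fin n).mono le_sup_left

/-- the I-adic filtration -/
abbrev ad (I : Ideal A) (N : Type u) [AddCommGroup N] [Module A N] : I.Filtration N :=
  Ideal.stableFiltration I (⊤ : Submodule A N)

lemma ad_N (n : ℕ) : (ad I N).N n = I ^ n • (⊤ : Submodule A N) := rfl

lemma ad_quot (U : Submodule A N) : (ad I N).quot U = ad I (N ⧸ U) := by
  ext n : 2
  change (I ^ n • (⊤ : Submodule A N)).map U.mkQ = I ^ n • ⊤
  rw [Submodule.map_smul'', Submodule.map_top, Submodule.range_mkQ]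

lemma ad_le {F : I.Filtration N} (h0 : F.N 0 = ⊤) (n : ℕ) : (ad I N).N n ≤ F.N n := by
  have := F.pow_smul_le n 0
  rwa [h0, add_zero] at this

lemma ad_setup {r : ℕ} (h : ∀ n, FinCl ((ad I N).N n)) :
    Setup (ad I N) r where
  top := by rw [ad_N]; simp
  gen n _ := by rw [ad_N, ad_N, pow_succ', Submodule.mul_smul]
  fin := h

lemma Setup.le_ad {F : I.Filtration N} {r : ℕ} (h : Setup F r) (n : ℕ) :
    F.N (r + n) ≤ (ad I N).N n := by
  induction n with
  | zero => rw [ad_N]; simp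
  | succ n ih =>
    rw [← add_assoc, h.gen _ (by omega), ad_N, pow_succ', Submodule.mul_smul]
    exact smul_mono_right _ ih

/-- Hilbert polynomial of degree at most `d` -/
def HasHP (F : I.Filtration N) (d : ℕ) (P : ℤ → ℤ) : Prop :=
  nab^[d + 1] P = 0 ∧ ∀ᶠ n : ℕ in atTop, cl (F.N (n + 1)) = P n

/-- elementwise filter-regularity -/
def FR (F : I.Filtration N) (x : A) : Prop :=
  ∃ n0, ∀ n ≥ n0, ∀ v ∈ F.N n, x • v ∈ F.N (n + 2) → v ∈ F.N (n + 1)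

lemma FR_of_filterRegular {F : I.Filtration N} {x : A} (h : F.FilterRegular x) : FR F x := by
  obtain ⟨n0, hn0⟩ := eventually_atTop.mp h
  refine ⟨n0, fun n hn v hv hxv => ?_⟩
  rw [← hn0 n hn]
  exact ⟨hxv, hv⟩

/-- strong goodness -/
def Good (F : I.Filtration N) (x : A) : Prop :=
  ∀ n, ∀ v ∈ F.N n, x • v ∈ (kf F).N (n + 1) → v ∈ (kf F).N n

lemma Good.fr [IsNoetherianRing A] [Module.Finite A N] {F : I.Filtration N} {x : A}
    (hF : F.Stable) (h : Good F x) : FR F x := by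
  obtain ⟨n0, hn0⟩ := kf_eventually F hF
  refine ⟨n0, fun n hn v hv hxv => ?_⟩
  rw [← hn0 n hn]
  apply h n v hv
  rwa [hn0 (n+1) (by omega)]

lemma FR.cancel {F : I.Filtration N} {x : A} (h : FR F x) (h0 : F.N 0 = ⊤) {w : N} (j : ℕ)
    (hw : x • w ∈ tl F (j + 1)) : w ∈ tl F j := by
  obtain ⟨n0, hn0⟩ := h
  have : ∀ i ≤ j, w ∈ tl F i := by
    intro i
    induction i with
    | zero => intro _; exact le_tl F 0 (h0 ▸ Submodule.mem_top)
    | succ i ih =>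
      intro hi
      obtain ⟨k1, hk1⟩ := ih (by omega)
      obtain ⟨k2, hk2⟩ := tl_anti F (show i + 2 ≤ j + 1 by omega) hw
      refine ⟨max n0 (max k1 k2), fun k hk a ha => ?_⟩
      have hk' : n0 ≤ k ∧ k1 ≤ k ∧ k2 ≤ k := by simpa using hk
      rw [show i + 1 + k = i + k + 1 by omega]
      apply hn0 (i + k) (by omega) _ (hk1 k (by omega) a ha)
      rw [smul_comm, show i + k + 2 = i + 2 + k by omega]
      exact hk2 k (by omega) a ha
  exact this j le_rfl

end Filt
end HCB

namespace HCB

section Exist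

variable {A : Type u} [CommRing A] 

lemma exists_avoid [IsLocalRing A] [Infinite (ResidueField A)] (I : Ideal A) (S : Set (Ideal A))
    (hS : S.Finite) (h : ∀ J ∈ S, ¬ I ≤ J) : ∃ x ∈ I, ∀ J ∈ S, x ∉ J := by
  induction S, hS using Set.Finite.induction_on with
  | empty => exact ⟨0, I.zero_mem, fun J hJ => absurd hJ (Set.notMem_empty J)⟩
  | @insert J₀ S _ hSf ih =>
    obtain ⟨x, hxI, hx⟩ := ih fun J hJ => h J (Set.mem_insert_of_mem _ hJ)
    obtain ⟨y, hyI, hy⟩ := Set.not_subset.mp (h J₀ (Set.mem_insert _ _))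
    let sec : ResidueField A → A := fun κ => Function.surjInv (residue_surjective (R := A)) κ
    have hsec : ∀ κ, residue A (sec κ) = κ := fun κ =>
      Function.surjInv_eq (residue_surjective (R := A)) κ
    have hsub : ∀ J ∈ insert J₀ S, Set.Subsingleton {κ | x + sec κ * y ∈ J} := by
      intro J hJ κ hκ κ' hκ'
      by_contra hne
      have hu : IsUnit (sec κ - sec κ') := by
        rw [← residue_ne_zero_iff_isUnit, map_sub, hsec, hsec]
        exact sub_ne_zero.mpr hne
      have h1 : (sec κ - sec κ') * y ∈ J := by
        have := J.sub_mem hκ hκ'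
        convert this using 1; ring
      have h2 : y ∈ J := (Ideal.unit_mul_mem_iff_mem J hu).mp h1
      have h3 : x ∈ J := by
        have := J.sub_mem hκ (J.mul_mem_left (sec κ) h2)
        convert this using 1; ring
      rcases hJ with rfl | hJ
      · exact hy h2
      · exact hx J hJ h3
    have hfin : (⋃ J ∈ insert J₀ S, {κ | x + sec κ * y ∈ J}).Finite :=
      (hSf.insert J₀).biUnion fun J hJ => (hsub J hJ).finite
    obtain ⟨κ, hκ⟩ := hfin.exists_notMem
    refine ⟨x + sec κ * y, I.add_mem hxI (I.mul_mem_left _ hyI), fun J hJ hmem => hκ ?_⟩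
    simp only [Set.mem_iUnion]
    exact ⟨J, hJ, hmem⟩

variable {I : Ideal A} {N : Type u} [AddCommGroup N] [Module A N]

lemma mem_tl_of_smul [IsNoetherianRing A] (F : I.Filtration N) {n : ℕ} {v : N}
    (h : ∀ a ∈ I, a • v ∈ tl F (n + 1)) : v ∈ tl F n := by
  obtain ⟨k0, hk⟩ := tl_uniform F (n + 1) (Submodule.map (LinearMap.toSpanSingleton A N v) I)
    ((IsNoetherian.noetherian I).map _) (by
      rintro _ ⟨a, ha, rfl⟩
      exact h a ha)
  apply mem_tl_of_pow (k := k0 + 1)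
  intro a ha
  rw [pow_succ] at ha
  refine Submodule.mul_induction_on ha (fun b hb c hc => ?_) (fun b c hb hc => ?_)
  · rw [mul_smul, show n + (k0 + 1) = n + 1 + k0 by omega]
    exact hk k0 le_rfl b hb _ ⟨c, hc, rfl⟩
  · rw [add_smul]; exact add_mem hb hc

/-- degree-one part of an ideal of the Rees algebra -/
def degOne (p : Ideal (reesAlgebra I)) : Ideal A where
  carrier := {a | ∃ s : reesAlgebra I, s ∈ p ∧ (s : Polynomial A) = Polynomial.monomial 1 a}
  zero_mem' := ⟨0, p.zero_mem, by simp⟩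
  add_mem' := by
    rintro a b ⟨s, hs, hsa⟩ ⟨t, ht, htb⟩
    exact ⟨s + t, p.add_mem hs ht, by simp [hsa, htb]⟩
  smul_mem' := by
    rintro c a ⟨s, hs, hsa⟩
    refine ⟨c • s, ?_, ?_⟩
    · rw [Algebra.smul_def]; exact p.mul_mem_left _ hs
    · simp [hsa, Polynomial.smul_monomial]

lemma colon_finite {S : Type*} [CommRing S] [IsNoetherianRing S] {E : Type*} [AddCommGroup E]
    [Module S E] (Q K : Submodule S E) (hQ : Q.FG) :
    ∃ T : Set (Ideal S), T.Finite ∧ (∀ p ∈ T, ∃ f ∈ Q, f ∉ K ∧ ∀ s ∈ p, s • f ∈ K) ∧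
      ∀ s : S, ∀ f ∈ Q, f ∉ K → s • f ∈ K → ∃ p ∈ T, s ∈ p := by
  have : Module.Finite S Q := Module.Finite.of_fg hQ
  refine ⟨associatedPrimes S (Q ⧸ K.comap Q.subtype), associatedPrimes.finite _ _, ?_, ?_⟩
  · intro p hp
    rw [AssociatedPrimes.mem_iff, isAssociatedPrime_iff] at hp
    obtain ⟨hp, e, rfl⟩ := hp
    obtain ⟨f, rfl⟩ := Submodule.mkQ_surjective _ e
    refine ⟨f, f.2, fun hf => hp.ne_top ?_, fun s hs => ?_⟩
    · rw [Ideal.eq_top_iff_one, Submodule.mem_colon_singleton, one_smul, Submodule.mem_bot,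
        Submodule.mkQ_apply, Submodule.Quotient.mk_eq_zero, Submodule.mem_comap]
      exact hf
    · rw [Submodule.mem_colon_singleton, Submodule.mem_bot, ← map_smul,
        Submodule.mkQ_apply, Submodule.Quotient.mk_eq_zero, Submodule.mem_comap] at hs
      exact hs
  · intro s f hfQ hfK hsf
    have he : (K.comap Q.subtype).mkQ ⟨f, hfQ⟩ ≠ 0 := by
      intro h0
      rw [Submodule.mkQ_apply, Submodule.Quotient.mk_eq_zero, Submodule.mem_comap] at h0
      exact hfK h0
    obtain ⟨p, hp, hle⟩ := exists_le_isAssociatedPrime_of_isNoetherianRing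
      (R := S) _ he
    refine ⟨p, hp, hle ?_⟩
    rw [Submodule.mem_colon_singleton, Submodule.mem_bot, ← map_smul,
      Submodule.mkQ_apply, Submodule.Quotient.mk_eq_zero, Submodule.mem_comap]
    exact hsf

lemma good_finite [IsNoetherianRing A] [Module.Finite A N] (F : I.Filtration N)
    (hF : F.Stable) : ∃ S : Set (Ideal A), S.Finite ∧ (∀ J ∈ S, ¬ I ≤ J) ∧
      ∀ x ∈ I, (∀ J ∈ S, x ∉ J) → Good F x := by
  have hfg : F.submodule.FG :=
    (F.submodule_fg_iff_stable fun i => IsNoetherian.noetherian _).mpr hF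
  have mon : ∀ a ∈ I, Polynomial.monomial 1 a ∈ reesAlgebra I := fun a ha =>
    reesAlgebra.monomial_mem.mpr (by simpa using ha)
  obtain ⟨T, hT, h1, h2⟩ := colon_finite F.submodule (kf F).submodule hfg
  refine ⟨degOne '' T, hT.image _, ?_, ?_⟩
  · rintro _ ⟨p, hp, rfl⟩ hle
    obtain ⟨f, hf, hfK, hfp⟩ := h1 p hp
    apply hfK
    rw [Ideal.Filtration.mem_submodule]
    intro n
    refine ⟨hf n, mem_tl_of_smul F fun a ha => ?_⟩
    obtain ⟨s, hs, hsa⟩ := hle ha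
    have h1 := (hfp s hs (n + 1)).2
    have h2 : (s • f).coeff (n + 1) = a • f.coeff n := by
      change ((s : Polynomial A) • f).coeff (n + 1) = _
      rw [hsa, PolynomialModule.monomial_smul_apply]
      simp
    exact h2 ▸ h1
  · intro x hx hxS n v hv hxv
    by_contra hvK
    obtain ⟨p, hp, hxp⟩ := h2 ⟨_, mon x hx⟩ (PolynomialModule.single A n v) (by
        rw [Ideal.Filtration.mem_submodule]
        intro i
        rw [PolynomialModule.coeff_single, Finsupp.single_apply]
        split_ifs with h
        · exact h ▸ hv
        · exact zero_mem _) (by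
        rw [Ideal.Filtration.mem_submodule]
        intro h0
        have := h0 n
        simp at this
        exact hvK this) (by
        rw [Ideal.Filtration.mem_submodule]
        intro i
        change ((Polynomial.monomial 1 x : Polynomial A) •
          PolynomialModule.single A n v).coeff i ∈ _
        rw [PolynomialModule.monomial_smul_single, PolynomialModule.coeff_single,
          Finsupp.single_apply]
        split_ifs with h
        · rw [← h, add_comm]; exact hxv
        · exact zero_mem _)
    exact hxS (degOne p) ⟨p, hp, rfl⟩ ⟨_, hxp, rfl⟩

lemma exists_good [IsLocalRing A] [Infinite (ResidueField A)] [IsNoetherianRing A]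
    [Module.Finite A N] (F G : I.Filtration N) (hF : F.Stable) (hG : G.Stable) :
    ∃ x ∈ I, Good F x ∧ Good G x := by
  obtain ⟨S, hS, h1, h2⟩ := good_finite F hF
  obtain ⟨T, hT, h3, h4⟩ := good_finite G hG
  obtain ⟨x, hx, h⟩ := exists_avoid I (S ∪ T) (hS.union hT) (by
    rintro J (hJ | hJ)
    · exact h1 J hJ
    · exact h3 J hJ)
  exact ⟨x, hx, h2 x hx fun J hJ => h J (Or.inl hJ), h4 x hx fun J hJ => h J (Or.inr hJ)⟩

end Exist
end HCB

namespace HCB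

section Tor

variable {A : Type u} [CommRing A] {I : Ideal A} {N : Type u} [AddCommGroup N] [Module A N]

/-- the `I`-torsion vanishes -/
def NoTor (I : Ideal A) (N : Type u) [AddCommGroup N] [Module A N] : Prop :=
  ∀ (v : N) (k : ℕ), (∀ a ∈ I ^ k, a • v = 0) → v = 0

lemma lc_eq [IsLocalRing A] [IsNoetherianRing A] (hI : IsMaxPrimary I) :
    lcZero (maximalIdeal A) N = tl (⊥ : I.Filtration N) 0 := by
  obtain ⟨j, hj⟩ := I.exists_radical_pow_le_of_fg (IsNoetherian.noetherian _)
  rw [hI.2] at hj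
  have hle : I ≤ maximalIdeal A := le_maximalIdeal hI.1
  ext v
  rw [lcZero, Submodule.mem_iSup_of_directed]
  · constructor
    · rintro ⟨k, hk⟩
      rw [Submodule.mem_torsionBySet_iff] at hk
      apply mem_tl_of_pow (k := k)
      intro a ha
      have := hk ⟨a, Ideal.pow_right_mono hle k ha⟩
      simpa using this
    · rintro ⟨k, hk⟩
      refine ⟨j * k, ?_⟩
      rw [Submodule.mem_torsionBySet_iff]
      rintro ⟨a, ha⟩
      have := hk k le_rfl a (by
        rw [SetLike.mem_coe, pow_mul] at ha
        exact Ideal.pow_right_mono hj k ha)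
      simpa using this
  · apply Monotone.directed_le
    intro k l hkl v hv
    rw [Submodule.mem_torsionBySet_iff] at hv ⊢
    rintro ⟨a, ha⟩
    exact hv ⟨a, Ideal.pow_le_pow_right hkl ha⟩

lemma lc_uniform [IsLocalRing A] [IsNoetherianRing A] [Module.Finite A N] (hI : IsMaxPrimary I) :
    ∃ k, ∀ a ∈ I ^ k, ∀ v ∈ lcZero (maximalIdeal A) N, a • v = 0 := by
  obtain ⟨k0, hk⟩ := tl_uniform (⊥ : I.Filtration N) 0 (lcZero (maximalIdeal A) N)
    (IsNoetherian.noetherian _) (lc_eq hI).le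
  refine ⟨k0, fun a ha v hv => ?_⟩
  simpa using hk k0 le_rfl a ha v hv

lemma lc_of_pow [IsLocalRing A] [IsNoetherianRing A] (hI : IsMaxPrimary I) {v : N} {k : ℕ}
    (h : ∀ a ∈ I ^ k, a • v = 0) : v ∈ lcZero (maximalIdeal A) N := by
  rw [lc_eq hI]
  apply mem_tl_of_pow (k := k)
  intro a ha
  simp [h a ha]

lemma noTor_quot [IsLocalRing A] [IsNoetherianRing A] [Module.Finite A N] (hI : IsMaxPrimary I) :
    NoTor I (N ⧸ lcZero (maximalIdeal A) N) := by
  intro v k hv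
  obtain ⟨v, rfl⟩ := Submodule.mkQ_surjective _ v
  obtain ⟨l, hl⟩ := lc_uniform (N := N) hI
  rw [Submodule.mkQ_apply, Submodule.Quotient.mk_eq_zero]
  apply lc_of_pow hI (k := l + k)
  intro a ha
  rw [pow_add] at ha
  refine Submodule.mul_induction_on ha (fun b hb c hc => ?_) (fun b c hb hc => ?_)
  · rw [mul_smul]
    apply hl b hb
    have := hv c hc
    rwa [← map_smul, Submodule.mkQ_apply, Submodule.Quotient.mk_eq_zero] at this
  · rw [add_smul, hb, hc, add_zero]

lemma inf_lc [IsLocalRing A] [IsNoetherianRing A] [Module.Finite A N] (hI : IsMaxPrimary I)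
    {F : I.Filtration N} {r : ℕ} (hF : Setup F r) :
    ∃ n0, ∀ n ≥ n0, F.N n ⊓ lcZero (maximalIdeal A) N = ⊥ := by
  obtain ⟨c, hc⟩ := Ideal.exists_pow_inf_eq_pow_smul I (lcZero (maximalIdeal A) N)
  obtain ⟨l, hl⟩ := lc_uniform (N := N) hI
  refine ⟨r + c + l, fun n hn => ?_⟩
  rw [eq_bot_iff]
  have h1 : F.N n ⊓ lcZero (maximalIdeal A) N ≤
      I ^ (c + l) • ⊤ ⊓ lcZero (maximalIdeal A) N := by
    refine inf_le_inf_right _ ?_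
    exact (F.antitone (show r + (c + l) ≤ n by omega)).trans (hF.le_ad (c + l))
  refine h1.trans ?_
  rw [hc (c + l) (by omega), show c + l - c = l by omega, Submodule.smul_le]
  rintro a ha v ⟨_, hv⟩
  simp [hl a ha v hv]

/-- length of the zeroth local cohomology -/
noncomputable def ell (A : Type u) [CommRing A] [IsLocalRing A] (N : Type u) [AddCommGroup N]
    [Module A N] : ℤ := ((Module.length A (lcZero (maximalIdeal A) N)).toNat : ℤ)

lemma ell_nonneg [IsLocalRing A] : 0 ≤ ell A N := Int.natCast_nonneg _

lemma cl_lc [IsLocalRing A] [IsNoetherianRing A] [Module.Finite A N] 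
    {W : Submodule A N} (hW : FinCl W) (h : W ⊓ lcZero (maximalIdeal A) N = ⊥) :
    Module.length A (lcZero (maximalIdeal A) N) ≠ ⊤ ∧
      cl W = cl (W ⊔ lcZero (maximalIdeal A) N) + ell A N := by
  set L := lcZero (maximalIdeal A) N
  have h2 : (⊤ : Submodule A L) ⊓ W.comap L.subtype = ⊥ := by
    rw [top_inf_eq, eq_bot_iff]
    rintro ⟨v, hv⟩ hvW
    have : v ∈ W ⊓ L := ⟨hvW, hv⟩
    rw [h] at this
    simpa using this
  have h1 : (⊤ : Submodule A L).map L.subtype ⊔ W = W ⊔ L := by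
    rw [Submodule.map_top, Submodule.range_subtype, sup_comm]
  have e : Module.length A (L ⧸ (⊥ : Submodule A L)) = Module.length A L :=
    (Submodule.quotEquivOfEqBot (⊥ : Submodule A L) rfl).length_eq
  have hfin : FinCl (⊥ : Submodule A L) := by
    have := len_transfer L.subtype ⊤ ⊥ (W ⊔ L) W h1 h2
    intro htop
    rw [htop, top_add] at this
    have e2 : Module.length A (L ⧸ (⊤ : Submodule A L)) = 0 :=
      Module.length_eq_zero_iff.mpr (Submodule.Quotient.subsingleton_iff.mpr rfl)
    rw [e2, zero_add] at this
    exact hW this.symm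
  refine ⟨by rw [← e]; exact hfin, ?_⟩
  have := cl_transfer L.subtype ⊤ ⊥ (W ⊔ L) W h1 h2 hfin hW
  rw [cl_top] at this
  have e3 : cl (⊥ : Submodule A L) = ell A N := by
    unfold cl ell; rw [e]
  linarith

lemma ell_fin [IsLocalRing A] [IsNoetherianRing A] [Module.Finite A N] (hI : IsMaxPrimary I)
    {F : I.Filtration N} {r : ℕ} (hF : Setup F r) :
    Module.length A (lcZero (maximalIdeal A) N) ≠ ⊤ := by
  obtain ⟨n0, h⟩ := inf_lc hI hF
  exact (cl_lc (hF.fin n0) (h n0 le_rfl)).1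

lemma cl_quot {F : I.Filtration N} (U : Submodule A N) (n : ℕ) :
    cl ((F.quot U).N n) = cl (F.N n ⊔ U) := cl_map_mkQ _ _

lemma HasHP.mono {F : I.Filtration N} {d d' : ℕ} {P : ℤ → ℤ} (h : HasHP F d P) (hd : d ≤ d') :
    HasHP F d' P := by
  refine ⟨?_, h.2⟩
  obtain ⟨k, rfl⟩ := Nat.exists_eq_add_of_le hd
  rw [show d + k + 1 = k + (d + 1) by omega, Function.iterate_add_apply, h.1, nab_iter_zero]

lemma HasHP.lc [IsLocalRing A] [IsNoetherianRing A] [Module.Finite A N] (hI : IsMaxPrimary I)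
    {F : I.Filtration N} {r : ℕ} (hF : Setup F r) {d : ℕ} {P : ℤ → ℤ} (h : HasHP F d P) :
    HasHP (F.quot (lcZero (maximalIdeal A) N)) d (fun t => P t - ell A N) := by
  refine ⟨by rw [nab_iter_sub_const _ _ _ (by omega)]; exact h.1, ?_⟩
  obtain ⟨n0, h0⟩ := inf_lc hI hF
  filter_upwards [h.2, eventually_ge_atTop n0] with n hn hn0
  rw [cl_quot, ← hn, (cl_lc (hF.fin (n+1)) (h0 (n+1) (by omega))).2]
  ring

lemma krull [IsLocalRing A] [IsNoetherianRing A] [Module.Finite A N] (hI : IsMaxPrimary I)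
    {F : I.Filtration N} {r : ℕ} (hF : Setup F r) {v : N} (h : ∀ n, v ∈ F.N n) : v = 0 := by
  have : v ∈ (⨅ i : ℕ, I ^ i • ⊤ : Submodule A N) := by
    rw [Submodule.mem_iInf]
    exact fun i => hF.le_ad i (h _)
  rw [Ideal.iInf_pow_smul_eq_bot_of_isLocalRing I hI.1] at this
  simpa using this

lemma FR.climb {F : I.Filtration N} {x : A} {n0 : ℕ}
    (h : ∀ n ≥ n0, ∀ v ∈ F.N n, x • v ∈ F.N (n + 2) → v ∈ F.N (n + 1)) {n i : ℕ} (hi : n0 ≤ i)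
    {v : N} (hv : v ∈ F.N i) (hin : i ≤ n) (hxv : x • v ∈ F.N (n + 1)) : v ∈ F.N n := by
  induction n, hin using Nat.le_induction with
  | base => exact hv
  | succ n hn ih =>
    exact h n (by omega) v (ih (F.mono _ hxv)) hxv

lemma FR.nzd [IsLocalRing A] [IsNoetherianRing A] [Module.Finite A N] (hI : IsMaxPrimary I)
    {F : I.Filtration N} {r : ℕ} (hF : Setup F r) (hT : NoTor I N) {x : A} (h : FR F x)
    {w : N} (hw : x • w = 0) : w = 0 := by
  obtain ⟨n0, hn0⟩ := h
  apply hT w n0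
  intro a ha
  apply krull hI hF
  intro n
  have h1 : a • w ∈ F.N n0 := by
    have := smul_mem_N F (n := 0) ha (v := w) (by rw [hF.top]; trivial)
    simpa using this
  have h2 : x • a • w = 0 := by rw [smul_comm, hw, smul_zero]
  rcases le_total n0 n with hn | hn
  · exact FR.climb hn0 le_rfl h1 hn (by rw [h2]; exact zero_mem _)
  · exact F.antitone hn h1

lemma FR.colon [IsLocalRing A] [IsNoetherianRing A] [Module.Finite A N] (hI : IsMaxPrimary I)
    {F : I.Filtration N} {r : ℕ} (hF : Setup F r) (hT : NoTor I N) {x : A} (h : FR F x) :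
    ∃ n1, ∀ n ≥ n1, ∀ w : N, x • w ∈ F.N (n + 1) → w ∈ F.N n := by
  have hz : ∀ w : N, x • w = 0 → w = 0 := fun w hw => h.nzd hI hF hT hw
  obtain ⟨n0, hn0⟩ := h
  obtain ⟨c, hc⟩ := Ideal.exists_pow_inf_eq_pow_smul I (xN A N x)
  refine ⟨n0 + r + c, fun n hn w hw => ?_⟩
  have h1 : x • w ∈ I ^ (n + 1 - r) • (⊤ : Submodule A N) ⊓ xN A N x := by
    refine ⟨hF.le_ad (n + 1 - r) ?_, mem_xN.mpr ⟨w, rfl⟩⟩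
    rwa [show r + (n + 1 - r) = n + 1 by omega]
  rw [hc _ (by omega)] at h1
  have h2 : I ^ (n + 1 - r - c) • (I ^ c • (⊤ : Submodule A N) ⊓ xN A N x) ≤
      (I ^ (n + 1 - r - c) • (⊤ : Submodule A N)).map (mulx A N x) := by
    rw [Submodule.map_smul'']
    refine smul_mono_right _ (inf_le_right.trans ?_)
    intro v hv
    obtain ⟨u, rfl⟩ := mem_xN.mp hv
    exact ⟨u, trivial, rfl⟩
  obtain ⟨w', hw', he⟩ := h2 h1
  have hww : w = w' := by
    have : x • (w - w') = 0 := by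
      rw [smul_sub, sub_eq_zero]; exact he.symm
    exact sub_eq_zero.mp (hz _ this)
  subst hww
  have h3 := ad_le hF.top _ hw'
  rcases le_total n (n + 1 - r - c) with h4 | h4
  · exact F.antitone h4 h3
  · exact FR.climb hn0 (by omega) h3 h4 hw

lemma HasHP.x [IsLocalRing A] [IsNoetherianRing A] [Module.Finite A N] (hI : IsMaxPrimary I)
    {F : I.Filtration N} {r : ℕ} (hF : Setup F r) (hT : NoTor I N) {x : A} (hx : x ∈ I)
    (hfr : FR F x) {d d' : ℕ} (hd : d ≤ d' + 1) {P : ℤ → ℤ} (h : HasHP F d P) :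
    HasHP (F.quot (xN A N x)) d' (nab P) := by
  refine ⟨by rw [nab_iter_succ]; exact (h.mono hd).1, ?_⟩
  obtain ⟨n1, hn1⟩ := hfr.colon hI hF hT
  obtain ⟨n2, hn2⟩ := eventually_atTop.mp h.2
  refine eventually_atTop.mpr ⟨n1 + n2 + 1, fun n hn => ?_⟩
  have hcm : (F.N (n + 1)).comap (mulx A N x) = F.N n := by
    apply le_antisymm
    · intro w hw
      exact hn1 n (by omega) w hw
    · intro w hw
      exact F.smul_le _ (Submodule.smul_mem_smul hx hw)
  have := cl_x x (F.N (n + 1)) (hF.fin _) (by rw [hcm]; exact hF.fin _)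
  rw [hcm] at this
  rw [cl_quot]
  have e1 := hn2 n (by omega)
  have e2 := hn2 (n - 1) (by omega)
  rw [show n - 1 + 1 = n by omega, Nat.cast_sub (by omega)] at e2
  simp only [nab]
  rw [← e1]
  simp only [Nat.cast_one] at e2
  rw [← e2]; linarith

end Tor
end HCB

namespace HCB

section Core

variable {A : Type u} [CommRing A] {I : Ideal A} {N : Type u} [AddCommGroup N] [Module A N]

/-- generation in low degree of the kernel filtrations, in relative form -/
def Syz (m : ℕ) (F : I.Filtration N) : Prop :=
  ∀ (M' : Type u) [AddCommGroup M'] [Module A M'] (G : I.Filtration M') (π : M' →ₗ[A] N),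
    (∀ n, (G.N n).map π = F.N n) → ∀ n ≥ m + 1, G.N (n + 1) = I • G.N n →
      G.N (n + 1) ⊓ ((kf F).N (n + 1)).comap π ≤ I • (G.N n ⊓ ((kf F).N n).comap π)

lemma ev_const {f : ℕ → ℤ} {m : ℕ} (h : ∀ n ≥ m, f (n + 1) = f n)
    (hev : ∀ᶠ n in atTop, f n = 0) {n : ℕ} (hn : m ≤ n) : f n = 0 := by
  obtain ⟨n1, h1⟩ := eventually_atTop.mp hev
  have : ∀ k, f (n + k) = f n := by
    intro k
    induction k with
    | zero => rfl
    | succ k ih => rw [← add_assoc, h _ (by omega), ih]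
  rw [← this n1, h1 _ (by omega)]

lemma ev_mono {f : ℕ → ℤ} {m : ℕ} (h : ∀ n ≥ m, f n ≤ f (n + 1))
    (hev : ∀ᶠ n in atTop, f n = 0) {n : ℕ} (hn : m ≤ n) : f n ≤ 0 := by
  obtain ⟨n1, h1⟩ := eventually_atTop.mp hev
  have : ∀ k, f n ≤ f (n + k) := by
    intro k
    induction k with
    | zero => rfl
    | succ k ih => rw [← add_assoc]; exact ih.trans (h _ (by omega))
  have h2 := this n1
  rw [h1 (n + n1) (by omega)] at h2
  exact h2

/-- Conclusions of the regularity theorem. -/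
structure Reg (F : I.Filtration N) (P : ℤ → ℤ) (m : ℕ) : Prop where
  syz : Syz m F
  kf_eq : ∀ n ≥ m, (kf F).N n = F.N (n + 1)
  hp : ∀ n : ℕ, m ≤ n → cl (F.N (n + 1)) = P n

lemma core [IsLocalRing A] [IsNoetherianRing A] [Module.Finite A N] (hI : IsMaxPrimary I)
    {F : I.Filtration N} {r : ℕ} (hF : Setup F r) (hT : NoTor I N) {d : ℕ} {P : ℤ → ℤ}
    (hP : HasHP F d P) {x : A} (hx : x ∈ I) (hg : Good F x)
    {N1 : Type u} [AddCommGroup N1] [Module A N1] {F1 : I.Filtration N1} {P1 : ℤ → ℤ}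
    (hF1 : Setup F1 r)
    (π : N →ₗ[A] N1) (hπ : ∀ n, (F.N n).map π = F1.N n) (hπx : ∀ w, π (x • w) = 0)
    {m B : ℕ} (hrm : r ≤ m) (hR : Reg F1 P1 m) (hP1 : nab P1 = nab (nab P)) (hB : 1 ≤ B)
    (hPB : nab P m ≤ B) :
    Reg F P (m + B - 1) ∧ (Subsingleton N1 → nab P ((m + B - 1 : ℕ) + 1) ≤
      cl (F.N (m + B - 1 + 1))) := by
  have hfr : FR F x := hg.fr hF.stable
  obtain ⟨n0, hK⟩ := kf_eventually F hF.stable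
  obtain ⟨n1, hcol⟩ := hfr.colon hI hF hT
  obtain ⟨n2, hev⟩ := eventually_atTop.mp hP.2
  have hxV : ∀ n, ∀ v ∈ F.N n, x • v ∈ F.N (n + 1) := fun n v hv =>
    F.smul_le _ (Submodule.smul_mem_smul hx hv)
  have hKfin : ∀ n, FinCl ((kf F).N n) := fun n => (hF.fin (n + 1)).mono (le_kf F n)
  have hK1fin : ∀ n, FinCl ((kf F1).N n) := fun n => (hF1.fin (n + 1)).mono (le_kf F1 n)
  let T : ℕ → Submodule A N := fun n => F.N n ⊓ ((kf F1).N n).comap π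
  let Q : ℕ → Submodule A N := fun n => (F.N n).map (mulx A N x) ⊔ (kf F).N (n + 1)
  have hπle : ∀ n, (F.N n).map π ≤ F1.N n := fun n => (hπ n).le
  have hKT : ∀ n, (kf F).N n ≤ T n := fun n v hv => ⟨hv.1, kf_map F F1 π hπle hv⟩
  have hQT : ∀ n, Q n ≤ T (n + 1) := by
    intro n
    refine sup_le ?_ (hKT _)
    rintro _ ⟨v, hv, rfl⟩
    refine ⟨hxV n v hv, ?_⟩
    change π (x • v) ∈ (kf F1).N (n + 1)
    rw [hπx]; exact zero_mem _
  have hQfin : ∀ n, FinCl (Q n) := fun n => (hKfin (n + 1)).mono le_sup_right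
  have hTfin : ∀ n, FinCl (T n) := fun n => (hKfin n).mono (hKT n)
  let h : ℕ → ℤ := fun n => cl ((kf F).N n) - cl (F.N n)
  have hh0 : ∀ n, 0 ≤ h n := fun n => sub_nonneg.mpr (cl_anti (kf_le F n) (hKfin n))
  -- relation for Q
  have hQ : ∀ n, cl (Q n) - cl (F.N (n + 1)) = h (n + 1) - h n := by
    intro n
    have := cl_transfer (mulx A N x) (F.N n) ((kf F).N n) (Q n) ((kf F).N (n + 1)) rfl (by
      apply le_antisymm
      · rintro v ⟨hv, hv'⟩
        exact hg n v hv hv'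
      · intro v hv
        exact ⟨hv.1, (kf F).smul_le _ (Submodule.smul_mem_smul hx hv)⟩) (hKfin n) (hKfin (n + 1))
    simp only [h]
    linarith
  -- relation for T
  have hTc : ∀ n ≥ m, cl (T (n + 1)) - cl (F.N (n + 1)) = nab (nab P) (n + 1) := by
    intro n hn
    have h1 := cl_transfer π (F.N (n + 1)) (T (n + 1)) (F1.N (n + 1)) ((kf F1).N (n + 1)) (by
      rw [hπ]; exact sup_eq_left.mpr (kf_le F1 _)) rfl (hTfin _) (hK1fin _)
    rw [hR.kf_eq (n + 1) (by omega), hR.hp (n + 1) (by omega), hR.hp n hn] at h1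
    rw [← hP1]
    simp only [nab]
    push_cast at h1 ⊢
    rw [show (n : ℤ) + 1 - 1 = n by ring]
    linarith
  let g : ℕ → ℤ := fun n => h n - nab P n
  have hq : ∀ n ≥ m, cl (Q n) - cl (T (n + 1)) = g (n + 1) - g n := by
    intro n hn
    have e1 := hQ n
    have e2 := hTc n hn
    simp only [g]
    have e3 : nab (nab P) ((n : ℤ) + 1) = nab P ((n + 1 : ℕ) : ℤ) - nab P n := by
      rw [nab]; push_cast; rw [show (n : ℤ) + 1 - 1 = n by ring]
    rw [e3] at e2
    linarith
  have hgev : ∀ᶠ n in atTop, g n = 0 := by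
    refine eventually_atTop.mpr ⟨n0 + n2 + 1, fun n hn => ?_⟩
    simp only [g, h, nab]
    rw [hK n (by omega), hev n (by omega)]
    have := hev (n - 1) (by omega)
    rw [show n - 1 + 1 = n by omega] at this
    rw [this, Nat.cast_sub (by omega)]
    simp
  have hgmono : ∀ n ≥ m, g n ≤ g (n + 1) := by
    intro n hn
    have := cl_anti (hQT n) (hQfin n)
    have := hq n hn
    linarith
  -- S1
  have hTstep : ∀ n ≥ m + 1, T (n + 1) ≤ I • T n := fun n hn =>
    hR.syz N F π hπ n hn (hF.gen n (by omega))
  have hpersist1 : ∀ n ≥ m, T (n + 1) ≤ Q n → T (n + 2) ≤ Q (n + 1) := by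
    intro n hn hle
    refine (hTstep (n + 1) (by omega)).trans ((smul_mono_right _ hle).trans ?_)
    change I • ((F.N n).map (mulx A N x) ⊔ (kf F).N (n + 1)) ≤ _
    rw [Submodule.smul_sup]
    refine sup_le_sup ?_ ((kf F).smul_le _)
    rw [← Submodule.map_smul'']
    exact Submodule.map_mono (F.smul_le n)
  have hpersist : ∀ n ≥ m, T (n + 1) ≤ Q n → ∀ k ≥ n, T (k + 1) ≤ Q k := by
    intro n hn hle k hk
    induction k, hk using Nat.le_induction with
    | base => exact hle
    | succ k hk ih => exact hpersist1 k (by omega) ih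
  -- S2
  have hex : ∃ n, m ≤ n ∧ n ≤ m + B - 1 ∧ T (n + 1) ≤ Q n := by
    by_contra hcon
    push Not at hcon
    have hlt : ∀ n ≥ m, n ≤ m + B - 1 → g n + 1 ≤ g (n + 1) := by
      intro n hn hn'
      have e1 := hq n hn
      by_contra hc
      apply hcon n hn hn'
      have : cl (Q n) ≤ cl (T (n + 1)) := by linarith
      exact (eq_of_cl_eq (hQT n) (hQfin n) this).ge
    have hsum : ∀ k ≤ B, g m + k ≤ g (m + k) := by
      intro k
      induction k with
      | zero => intro _; simp
      | succ k ih =>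
        intro hk
        have e1 := ih (by omega)
        have e2 := hlt (m + k) (by omega) (by omega)
        rw [← add_assoc]; push_cast; linarith
    have e1 := hsum B le_rfl
    have e2 := ev_mono hgmono hgev (show m ≤ m + B by omega)
    have e3 : h m ≤ 0 := by
      have : g m = h m - nab P m := rfl
      linarith
    have e4 : (kf F).N m = F.N m := eq_of_cl_eq (kf_le F m) (hKfin m) (by
      have : h m = cl ((kf F).N m) - cl (F.N m) := rfl
      linarith)
    have e5 : F.N (m + 1) ≤ (kf F).N (m + 1) := by
      rw [hF.gen m hrm, ← e4]; exact (kf F).smul_le m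
    exact hcon m le_rfl (by omega) (inf_le_left.trans (e5.trans le_sup_right))
  obtain ⟨j0, hj0, hj1, hj2⟩ := hex
  set m' := m + B - 1 with hm'
  have hTQ : ∀ n ≥ m', T (n + 1) ≤ Q n := fun n hn => hpersist j0 hj0 hj2 n (by omega)
  have hcancel : ∀ (j : ℕ) (w : N), x • w ∈ tl F (j + 1) → w ∈ tl F j := fun j w hw =>
    hfr.cancel hF.top j hw
  -- S4
  have htlbig : ∀ j ≥ n1, tl F j ≤ F.N j := by
    intro j hj b hb
    obtain ⟨k, hk⟩ := hb
    have h1 := hk k le_rfl (x ^ k) (Ideal.pow_mem_pow hx k)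
    clear hk
    induction k with
    | zero => simpa using h1
    | succ k ih =>
      apply ih
      apply hcol (j + k) (by omega)
      rw [← mul_smul, ← pow_succ']
      exact h1
  have htlstep : ∀ n ≥ m', tl F n ≤ F.N n ⊔ tl F (n + 1) := by
    intro n hn b hb
    obtain ⟨k, hk⟩ := hb
    have h1 : x ^ k • b ∈ F.N (n + k) ⊔ tl F (n + k + 1) :=
      Submodule.mem_sup_left (hk k le_rfl (x ^ k) (Ideal.pow_mem_pow hx k))
    clear hk
    induction k with
    | zero => simpa using h1
    | succ k ih =>
      apply ih
      obtain ⟨v, hv, c, hc, hvc⟩ := Submodule.mem_sup.mp h1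
      have hvT : v ∈ T (n + k + 1) := by
        refine ⟨hv, hπle _ (Submodule.mem_map_of_mem hv), ?_⟩
        have : π v = - π c := by
          rw [eq_neg_iff_add_eq_zero, ← map_add, hvc, pow_succ', mul_smul, hπx]
        rw [this]
        exact neg_mem (tl_map F F1 π hπle hc)
      obtain ⟨_, ⟨v', hv', rfl⟩, κ, hκ, hvκ⟩ := Submodule.mem_sup.mp (hTQ (n + k) (by omega) hvT)
      have h2 : x • (x ^ k • b - v') ∈ tl F (n + k + 2) := by
        have : x • (x ^ k • b - v') = κ + c := by
          rw [smul_sub, ← mul_smul, ← pow_succ', ← hvc, ← hvκ, mulx_apply]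
          abel
        rw [this]
        exact add_mem hκ.2 hc
      have h3 := hcancel _ _ h2
      have : x ^ k • b = v' + (x ^ k • b - v') := by abel
      rw [this]
      exact Submodule.add_mem_sup hv' h3
  have htl : ∀ n ≥ m', tl F n ≤ F.N n := by
    intro n hn
    have : ∀ k, tl F n ≤ F.N n ⊔ tl F (n + k) := by
      intro k
      induction k with
      | zero => exact le_sup_right
      | succ k ih =>
        refine ih.trans (sup_le le_sup_left ((htlstep (n + k) (by omega)).trans ?_))
        exact sup_le_sup_right (F.antitone (by omega)) _
    refine (this n1).trans (sup_le le_rfl ?_)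
    exact (htlbig _ (by omega)).trans (F.antitone (by omega))
  have hKeq : ∀ n ≥ m', (kf F).N n = F.N (n + 1) := fun n hn =>
    le_antisymm (inf_le_right.trans (htl (n + 1) (by omega))) (le_kf F n)
  -- S5
  have hgconst : ∀ n ≥ m', g (n + 1) = g n := by
    intro n hn
    have e1 := hq n (by omega)
    have e2 : Q n = T (n + 1) := le_antisymm (hQT n) (hTQ n hn)
    rw [e2] at e1
    linarith
  have hg0 : ∀ n ≥ m', g n = 0 := fun n hn => ev_const hgconst hgev hn
  have hHP : ∀ n : ℕ, m' ≤ n → cl (F.N (n + 1)) = P n := by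
    intro n hn
    have := ev_const (f := fun n => cl (F.N (n + 1)) - P n) (m := m') (by
      intro n hn
      have e1 := hg0 (n + 1) (by omega)
      simp only [g, h, nab] at e1
      rw [hKeq (n + 1) (by omega)] at e1
      push_cast at e1 ⊢
      rw [show (n : ℤ) + 1 - 1 = n by ring] at e1
      linarith) (eventually_atTop.mpr ⟨n2, fun n hn => by rw [hev n hn]; simp⟩) hn
    linarith
  refine ⟨⟨?_, hKeq, hHP⟩, ?_⟩
  · -- Syz
    intro M' _ _ G ρ hρ n hn hgen
    obtain ⟨n, rfl⟩ : ∃ k, n = k + 1 := ⟨n - 1, by omega⟩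
    set Kh : ℕ → Submodule A M' := fun n => G.N n ⊓ ((kf F).N n).comap ρ with hKh
    have hc : ∀ n, (G.N n).map (π ∘ₗ ρ) = F1.N n := by
      intro n; rw [Submodule.map_comp, hρ, hπ]
    have h1 := hR.syz M' G (π ∘ₗ ρ) hc (n + 1) (by omega) hgen
    have h2 : G.N (n + 1) ⊓ ((kf F1).N (n + 1)).comap (π ∘ₗ ρ) ≤
        (G.N n).map (mulx A M' x) ⊔ Kh (n + 1) := by
      rintro u ⟨hu, hu'⟩
      have huT : ρ u ∈ T (n + 1) := ⟨hρ (n + 1) ▸ Submodule.mem_map_of_mem hu, hu'⟩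
      obtain ⟨_, ⟨v, hv, rfl⟩, κ, hκ, hvκ⟩ := Submodule.mem_sup.mp (hTQ n (by omega) huT)
      have hv2 : v ∈ (G.N n).map ρ := by rw [hρ]; exact hv
      obtain ⟨w, hw, rfl⟩ := hv2
      have : u = x • w + (u - x • w) := by abel
      rw [this]
      refine Submodule.add_mem_sup ⟨w, hw, rfl⟩ ⟨sub_mem hu ?_, ?_⟩
      · exact G.smul_le _ (Submodule.smul_mem_smul hx hw)
      · change ρ (u - x • w) ∈ (kf F).N (n + 1)
        rw [map_sub, map_smul, ← hvκ, mulx_apply]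
        simpa using hκ
    intro y hy
    have hy1 : y ∈ I • ((G.N n).map (mulx A M' x) ⊔ Kh (n + 1)) := by
      apply smul_mono_right I h2
      apply h1
      exact ⟨hy.1, kf_map F F1 π hπle hy.2⟩
    rw [Submodule.smul_sup, ← Submodule.map_smul''] at hy1
    obtain ⟨_, ⟨w, hw, rfl⟩, z, hz, hyz⟩ := Submodule.mem_sup.mp hy1
    have hwG : w ∈ G.N (n + 1) := G.smul_le n hw
    have hzK : ρ z ∈ (kf F).N (n + 2) := by
      have hle : I • Kh (n + 1) ≤ ((kf F).N (n + 2)).comap ρ := by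
        rw [Submodule.smul_le]
        rintro a ha u hu
        rw [Submodule.mem_comap, map_smul]
        exact (kf F).smul_le _ (Submodule.smul_mem_smul ha hu.2)
      exact hle hz
    have hwK : ρ w ∈ (kf F).N (n + 1) := by
      apply hg (n + 1)
      · rw [← hρ]; exact Submodule.mem_map_of_mem hwG
      · have : x • ρ w = ρ y - ρ z := by
          rw [← hyz, map_add, mulx_apply, map_smul]; abel
        rw [this]
        exact sub_mem hy.2 hzK
    rw [← hyz]
    refine add_mem ?_ hz
    exact Submodule.smul_mem_smul hx ⟨hwG, hwK⟩
  · intro hsub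
    have hle : F.N (m' + 1) ≤ F.N (m' + 2) ⊔ xN A N x := by
      intro v hv
      have hvT : v ∈ T (m' + 1) := ⟨hv, by
        change π v ∈ (kf F1).N (m' + 1)
        rw [Subsingleton.elim (π v) 0]; exact zero_mem _⟩
      obtain ⟨_, ⟨w, hw, rfl⟩, κ, hκ, rfl⟩ := Submodule.mem_sup.mp (hTQ m' le_rfl hvT)
      rw [hKeq (m' + 1) (by omega)] at hκ
      exact add_mem (Submodule.mem_sup_right (mem_xN.mpr ⟨w, rfl⟩)) (Submodule.mem_sup_left hκ)
    have hcm : (F.N (m' + 2)).comap (mulx A N x) = F.N (m' + 1) := by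
      apply le_antisymm
      · intro w hw
        exact htl _ (by omega) (hcancel _ _ (le_tl F _ hw))
      · intro w hw
        exact hxV _ _ hw
    have e1 := cl_x x (F.N (m' + 2)) (hF.fin _) (by rw [hcm]; exact hF.fin _)
    rw [hcm, hHP m' le_rfl] at e1
    have e2 := hHP (m' + 1) (by omega)
    have e3 := cl_anti hle (hF.fin _)
    rw [nab, show ((m' : ℕ) : ℤ) + 1 - 1 = m' by ring]
    push_cast at e2
    rw [← e2]
    change cl (F.N (m' + 2)) - _ ≤ _
    linarith

end Core
end HCB

namespace HCB

section RegThm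

variable {A : Type u} [CommRing A] {I : Ideal A}

/-- the regularity bounds -/
def mreg (D r : ℕ) : ℕ → ℕ
  | 0 => r
  | (j + 1) => mreg D r j + D * (mreg D r j + j).choose j - 1

lemma mreg_le_succ {D r : ℕ} (hD : 1 ≤ D) (j : ℕ) : mreg D r j ≤ mreg D r (j + 1) := by
  have : 1 ≤ D * (mreg D r j + j).choose j :=
    Nat.mul_pos hD (Nat.choose_pos (by omega))
  rw [mreg]; omega

lemma r_le_mreg {D r : ℕ} (hD : 1 ≤ D) (j : ℕ) : r ≤ mreg D r j := by
  induction j with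
  | zero => exact le_rfl
  | succ j ih => exact ih.trans (mreg_le_succ hD j)

lemma cl_subsingleton {N : Type u} [AddCommGroup N] [Module A N] [Subsingleton N]
    (W : Submodule A N) : cl W = 0 := by
  rw [Subsingleton.elim W ⊤, cl_top]

lemma hp_subsingleton {N : Type u} [AddCommGroup N] [Module A N] [Subsingleton N]
    {F : I.Filtration N} {d : ℕ} {P : ℤ → ℤ} (hP : HasHP F d P) : P = 0 := by
  refine ev_zero _ P hP.1 ?_
  filter_upwards [hP.2] with n hn
  rw [← hn, cl_subsingleton]

lemma reg_subsingleton {N : Type u} [AddCommGroup N] [Module A N] [Subsingleton N]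
    {F : I.Filtration N} {d : ℕ} {P : ℤ → ℤ} (hP : HasHP F d P) (m : ℕ) : Reg F P m where
  syz := by
    intro M' _ _ G π _ n _ hgen
    have h1 : ((kf F).N n).comap π = ⊤ := by
      rw [Subsingleton.elim ((kf F).N n) ⊤, Submodule.comap_top]
    rw [h1, inf_top_eq, ← hgen]
    exact inf_le_left
  kf_eq n _ := Subsingleton.elim _ _
  hp n _ := by rw [cl_subsingleton, hp_subsingleton hP]; rfl

lemma noTor_deg_zero [IsLocalRing A] [IsNoetherianRing A] (hI : IsMaxPrimary I)
    {N : Type u} [AddCommGroup N] [Module A N] [Module.Finite A N]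
    {F : I.Filtration N} {r : ℕ} (hF : Setup F r) (hT : NoTor I N) {P : ℤ → ℤ}
    (hP : HasHP F 0 P) : Subsingleton N := by
  obtain ⟨n2, hev⟩ := eventually_atTop.mp hP.2
  have hst : ∀ k, F.N (n2 + 1) ≤ F.N (n2 + 1 + k) := by
    intro k
    induction k with
    | zero => exact le_rfl
    | succ k ih =>
      refine ih.trans (ge_of_eq ?_)
      apply eq_of_cl_eq (F.mono _) (hF.fin _)
      have e1 := hev (n2 + k) (by omega)
      have e2 := hev (n2 + k + 1) (by omega)
      change cl (F.N (n2 + 1 + k + 1)) ≤ cl (F.N (n2 + 1 + k))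
      rw [show n2 + 1 + k + 1 = n2 + k + 1 + 1 by omega, show n2 + 1 + k = n2 + k + 1 by omega,
        e1, e2]
      exact (const_of_nab hP.1 _ _).le
  refine subsingleton_of_forall_eq 0 fun v => hT v (n2 + 1) fun a ha => ?_
  apply krull hI hF
  intro n
  have h1 : a • v ∈ F.N (0 + (n2 + 1)) := smul_mem_N F ha (by rw [hF.top]; trivial)
  rw [zero_add] at h1
  exact F.antitone (by omega) (hst n h1)

theorem regR [IsLocalRing A] [IsNoetherianRing A] [Infinite (ResidueField A)]
    (hI : IsMaxPrimary I) (D r : ℕ) (hD : 1 ≤ D) (d : ℕ) :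
    ∀ (N : Type u) [AddCommGroup N] [Module A N] [Module.Finite A N] (F : I.Filtration N)
      (P PI : ℤ → ℤ), Setup F r → NoTor I N → Setup (ad I N) r → HasHP F d P →
      HasHP (ad I N) d PI →
      (∀ j < d, ∀ n : ℕ, mreg D r j ≤ n → nab^[d - j] PI n ≤ D * ((n + j).choose j : ℕ)) →
      Reg F P (mreg D r d) ∧ (d = 0 → Subsingleton N) ∧
        (d = 1 → nab P ((mreg D r 1 : ℕ) + 1) ≤ cl (F.N (mreg D r 1 + 1))) := by
  induction d with
  | zero =>
    intro N _ _ _ F P PI hF hT hA hP hPI _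
    have : Subsingleton N := noTor_deg_zero hI hF hT hP
    exact ⟨reg_subsingleton hP _, fun _ => this, fun h => by omega⟩
  | succ d ih =>
    intro N _ _ _ F P PI hF hT hA hP hPI hY
    obtain ⟨x, hx, hgF, hgA⟩ := exists_good F (ad I N) hF.stable hA.stable
    let N' := N ⧸ xN A N x
    let N1 := N' ⧸ lcZero (maximalIdeal A) N'
    let F' : I.Filtration N' := F.quot (xN A N x)
    let F1 : I.Filtration N1 := F'.quot (lcZero (maximalIdeal A) N')
    have hF' : Setup F' r := hF.quot _
    have hF1 : Setup F1 r := hF'.quot _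
    have hA' : Setup (ad I N') r := by
      have := hA.quot (xN A N x); rwa [ad_quot] at this
    have hA1 : Setup (ad I N1) r := by
      have := hA'.quot (lcZero (maximalIdeal A) N'); rwa [ad_quot] at this
    have hP' : HasHP F' d (nab P) := hP.x hI hF hT hx (hgF.fr hF.stable) le_rfl
    have hPI' : HasHP (ad I N') d (nab PI) := by
      have := hPI.x hI hA hT hx (hgA.fr hA.stable) le_rfl
      rwa [ad_quot] at this
    have hP1 : HasHP F1 d (fun t => nab P t - ell A N') := hP'.lc hI hF'
    have hPI1 : HasHP (ad I N1) d (fun t => nab PI t - ell A N') := by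
      have := hPI'.lc hI hA'
      rwa [ad_quot] at this
    have hT1 : NoTor I N1 := noTor_quot hI
    have hY1 : ∀ j < d, ∀ n : ℕ, mreg D r j ≤ n →
        nab^[d - j] (fun t => nab PI t - ell A N') n ≤ D * ((n + j).choose j : ℕ) := by
      intro j hj n hn
      rw [nab_iter_sub_const _ _ _ (by omega), nab_iter_succ, show d - j + 1 = d + 1 - j by omega]
      exact hY j (by omega) n hn
    obtain ⟨hR1, hz1, -⟩ := ih N1 F1 _ _ hF1 hT1 hA1 hP1 hPI1 hY1
    obtain ⟨hR2, -, -⟩ := ih N1 (ad I N1) _ _ hA1 hT1 hA1 hPI1 hPI1 hY1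
    have hB : nab P (mreg D r d) ≤
        ((D * (mreg D r d + d).choose d : ℕ) : ℤ) := by
      have e1 := hR1.hp _ le_rfl
      have e2 := hR2.hp _ le_rfl
      have e3 := cl_anti (ad_le hF1.top (mreg D r d + 1)) (hA1.fin _)
      have e4 := hY d (by omega) (mreg D r d) le_rfl
      rw [show d + 1 - d = 1 by omega] at e4
      simp only [Function.iterate_one] at e4
      push_cast at e4 ⊢
      linarith
    have hc := core hI hF hT hP hx hgF hF1
      ((lcZero (maximalIdeal A) N').mkQ ∘ₗ (xN A N x).mkQ)
      (fun n => by rw [Submodule.map_comp]; rfl) (fun w => by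
        have : (xN A N x).mkQ (x • w) = 0 := by
          rw [Submodule.mkQ_apply, Submodule.Quotient.mk_eq_zero]
          exact mem_xN.mpr ⟨w, rfl⟩
        rw [LinearMap.comp_apply, this, map_zero]) (r_le_mreg hD d) hR1 (nab_sub_const _ _)
      (Nat.mul_pos hD (Nat.choose_pos (by omega))) hB
    refine ⟨hc.1, fun h => by omega, fun h => ?_⟩
    obtain rfl : d = 0 := by omega
    exact hc.2 (hz1 rfl)

end RegThm
end HCB

namespace HCB

section Bounds

set_option linter.unusedSectionVars false

variable {A : Type u} [CommRing A] {I : Ideal A}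

lemma cl_le_lc [IsLocalRing A] {N : Type u} [AddCommGroup N] [Module A N]
    (hfin : Module.length A (lcZero (maximalIdeal A) N) ≠ ⊤)
    {W : Submodule A N} (hW : FinCl W) :
    cl W ≤ cl (W ⊔ lcZero (maximalIdeal A) N) + ell A N := by
  set L := lcZero (maximalIdeal A) N with hL
  have hbot : FinCl (⊥ : Submodule A L) := by
    unfold FinCl
    rwa [(Submodule.quotEquivOfEqBot (⊥ : Submodule A L) rfl).length_eq]
  have h1 := cl_transfer L.subtype ⊤ (W.comap L.subtype) (W ⊔ L) W (by
    rw [Submodule.map_top, Submodule.range_subtype, sup_comm]) (by rw [top_inf_eq])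
    (hbot.mono bot_le) hW
  rw [cl_top] at h1
  have h2 := cl_anti (bot_le : ⊥ ≤ W.comap L.subtype) hbot
  have h3 : cl (⊥ : Submodule A L) = ell A N := by
    unfold cl ell
    rw [(Submodule.quotEquivOfEqBot (⊥ : Submodule A L) rfl).length_eq]
  linarith

variable [IsLocalRing A] [IsNoetherianRing A]
variable {D : (N : Type u) → [AddCommGroup N] → [Module A N] → ℕ}

lemma D_split (hD : IsExtendedDegree I D) (N : Type u) [AddCommGroup N] [Module A N]
    [Module.Finite A N] (hfin : Module.length A (lcZero (maximalIdeal A) N) ≠ ⊤) :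
    (D N : ℤ) = D (N ⧸ lcZero (maximalIdeal A) N) + ell A N := by
  have h := hD.h0_add N
  rw [moduleLength, ← Module.coe_length, ← ENat.natCast_toNat hfin] at h
  have h2 : D N = D (N ⧸ lcZero (maximalIdeal A) N) +
    (Module.length A (lcZero (maximalIdeal A) N)).toNat := by exact_mod_cast h
  rw [h2, ell]; push_cast; rfl

lemma ad_setup_quot {N : Type u} [AddCommGroup N] [Module A N] {r : ℕ} (h : Setup (ad I N) r)
    (U : Submodule A N) : Setup (ad I (N ⧸ U)) r := by
  have := h.quot U; rwa [ad_quot] at this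

theorem boundHB (hI : IsMaxPrimary I) (hD : IsExtendedDegree I D) (r d : ℕ) :
    ∀ (N : Type u) [AddCommGroup N] [Module A N] [Module.Finite A N] (P : ℤ → ℤ),
      Setup (ad I N) r → HasHP (ad I N) d P →
      ∀ n, cl ((ad I N).N (n + 1)) ≤ D N * ((n + d).choose d : ℕ) := by
  induction d with
  | zero =>
    intro N _ _ _ P hA hP n
    have hA1 := ad_setup_quot hA (lcZero (maximalIdeal A) N)
    have hP1 := hP.lc hI hA
    rw [ad_quot] at hP1
    have : Subsingleton (N ⧸ lcZero (maximalIdeal A) N) :=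
      noTor_deg_zero hI hA1 (noTor_quot hI) hP1
    have e1 := D_split hD N (ell_fin hI hA)
    have e2 := cl_le_lc (ell_fin hI hA) (hA.fin (n + 1))
    rw [← cl_quot, cl_subsingleton (((ad I N).quot (lcZero (maximalIdeal A) N)).N (n + 1))] at e2
    simp only [add_zero, Nat.choose_zero_right, Nat.cast_one, mul_one]
    linarith [Int.natCast_nonneg (D (N ⧸ lcZero (maximalIdeal A) N))]
  | succ d ih =>
    intro N' _ _ _ P hA hP n
    have e1 := D_split hD N' (ell_fin hI hA)
    have e2 := cl_le_lc (ell_fin hI hA) (hA.fin (n + 1))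
    have hP1 := hP.lc hI hA
    have hA1 := ad_setup_quot hA (lcZero (maximalIdeal A) N')
    rw [← cl_quot, ad_quot] at e2
    rw [ad_quot] at hP1
    have hch : (1 : ℤ) ≤ ((n + (d + 1)).choose (d + 1) : ℕ) := by
      exact_mod_cast Nat.choose_pos (by omega)
    have hT : NoTor I (N' ⧸ lcZero (maximalIdeal A) N') := noTor_quot hI
    set N := N' ⧸ lcZero (maximalIdeal A) N' with hN
    have hl : 0 ≤ ell A N' := ell_nonneg
    have hDN : (0 : ℤ) ≤ D N := Int.natCast_nonneg _
    suffices h : ∀ n, cl ((ad I N).N (n + 1)) ≤ D N * ((n + (d + 1)).choose (d + 1) : ℕ) by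
      rw [e1]
      nlinarith [h n]
    rcases subsingleton_or_nontrivial N with hs | hs
    · intro n
      rw [cl_subsingleton]
      positivity
    · obtain ⟨y, hy, -, hyr, hyD⟩ := hD.generic N hs
      have hP2 := hP1.x hI hA1 hT hy (FR_of_filterRegular hyr) le_rfl
      rw [ad_quot] at hP2
      have h3 := ih (N ⧸ xN A N y) _ (ad_setup_quot hA1 _) hP2
      have key : ∀ n, cl ((ad I N).N (n + 1)) ≤
          D N * ((n + d).choose d : ℕ) + cl ((ad I N).N n) := by
        intro n
        have hle : (ad I N).N n ≤ ((ad I N).N (n + 1)).comap (mulx A N y) := fun v hv =>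
          (ad I N).smul_le _ (Submodule.smul_mem_smul hy hv)
        have f1 := cl_x y ((ad I N).N (n + 1)) (hA1.fin _) ((hA1.fin n).mono hle)
        have f2 := cl_anti hle (hA1.fin n)
        have f3 := h3 n
        rw [← ad_quot, cl_quot] at f3
        have f4 : (D (N ⧸ xN A N y) : ℤ) ≤ D N := by exact_mod_cast hyD
        have f5 : (0 : ℤ) ≤ ((n + d).choose d : ℕ) := Int.natCast_nonneg _
        nlinarith
      intro n
      induction n with
      | zero =>
        have := key 0
        rw [hA1.top, cl_top] at this
        simpa using this
      | succ n ihn =>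
        have f1 := key (n + 1)
        have f2 : (n + 1 + (d + 1)).choose (d + 1) =
            (n + 1 + d).choose d + (n + (d + 1)).choose (d + 1) := by
          rw [show n + 1 + (d + 1) = (n + 1 + d) + 1 by omega, Nat.choose_succ_succ,
            show n + 1 + d = n + (d + 1) by omega]
        rw [f2]; push_cast
        push_cast at f1 ihn
        linarith

variable [Infinite (ResidueField A)]

lemma hp_of_subsingleton_lc (hI : IsMaxPrimary I) {N : Type u} [AddCommGroup N] [Module A N]
    [Module.Finite A N] {F : I.Filtration N} {r d : ℕ} (hF : Setup F r) {P : ℤ → ℤ}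
    (hP : HasHP F d P) (hs : Subsingleton (N ⧸ lcZero (maximalIdeal A) N)) :
    P = fun _ => ell A N := by
  have h := hp_subsingleton (hP.lc hI hF)
  funext t
  have := congrFun h t
  simp at this
  linarith

theorem boundY (hI : IsMaxPrimary I) (hD : IsExtendedDegree I D) (δ r : ℕ) (hδ : 1 ≤ δ) (d : ℕ) :
    ∀ (N : Type u) [AddCommGroup N] [Module A N] [Module.Finite A N] (P : ℤ → ℤ),
      D N ≤ δ → Setup (ad I N) r → HasHP (ad I N) d P →
      ∀ j ≤ d, ∀ n : ℕ, mreg δ r j ≤ n → nab^[d - j] P n ≤ δ * ((n + j).choose j : ℕ) := by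
  induction d with
  | zero =>
    intro N _ _ _ P hDN hA hP j hj n hn
    obtain rfl : j = 0 := by omega
    have hA1 := ad_setup_quot hA (lcZero (maximalIdeal A) N)
    have hP1 := hP.lc hI hA
    rw [ad_quot] at hP1
    have : Subsingleton (N ⧸ lcZero (maximalIdeal A) N) :=
      noTor_deg_zero hI hA1 (noTor_quot hI) hP1
    rw [hp_of_subsingleton_lc hI hA hP this]
    have e1 := D_split hD N (ell_fin hI hA)
    have e2 : (D N : ℤ) ≤ δ := by exact_mod_cast hDN
    simp
    linarith [Int.natCast_nonneg (D (N ⧸ lcZero (maximalIdeal A) N))]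
  | succ d ih =>
    intro N' _ _ _ P hDN hA hP j hj n hn
    have e1 := D_split hD N' (ell_fin hI hA)
    have hP1 := hP.lc hI hA
    have hA1 := ad_setup_quot hA (lcZero (maximalIdeal A) N')
    rw [ad_quot] at hP1
    have hT : NoTor I (N' ⧸ lcZero (maximalIdeal A) N') := noTor_quot hI
    have hsub := hp_of_subsingleton_lc hI hA hP
    set N := N' ⧸ lcZero (maximalIdeal A) N' with hN
    have hl : 0 ≤ ell A N' := ell_nonneg
    have hDN0 : (0 : ℤ) ≤ D N := Int.natCast_nonneg _
    have hDN' : (D N' : ℤ) ≤ δ := by exact_mod_cast hDN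
    have hch : (1 : ℤ) ≤ ((n + j).choose j : ℕ) := by
      exact_mod_cast Nat.choose_pos (by omega)
    rcases subsingleton_or_nontrivial N with hs | hs
    · rcases Nat.lt_or_ge j (d + 1) with h | h
      · have : nab^[d + 1 - j] P = 0 := by
          rw [← nab_iter_sub_const P (ell A N') _ (by omega), hp_subsingleton hP1, nab_iter_zero]
        rw [this]
        simp only [Pi.zero_apply]
        positivity
      · obtain rfl : j = d + 1 := by omega
        rw [hsub hs]
        simp only [Nat.sub_self, Function.iterate_zero, id]
        nlinarith
    · obtain ⟨y, hy, -, hyr, hyD⟩ := hD.generic N hs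
      have hP2 := hP1.x hI hA1 hT hy (FR_of_filterRegular hyr) le_rfl
      rw [ad_quot, nab_sub_const] at hP2
      have hDle : D (N ⧸ xN A N y) ≤ δ := by
        have h1 : (D (N ⧸ xN A N y) : ℤ) ≤ D N := by exact_mod_cast hyD
        have h2 : (D N' : ℤ) = D N + ell A N' := e1
        have h3 : (D (N ⧸ xN A N y) : ℤ) ≤ δ := by linarith
        exact_mod_cast h3
      have h3 : ∀ j ≤ d, ∀ n : ℕ, mreg δ r j ≤ n →
          nab^[d + 1 - j] P n ≤ δ * ((n + j).choose j : ℕ) := by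
        intro j hj n hn
        have := ih (N ⧸ xN A N y) _ hDle (ad_setup_quot hA1 _) hP2 j hj n hn
        rwa [nab_iter_succ, show d - j + 1 = d + 1 - j by omega] at this
      rcases Nat.lt_or_ge j (d + 1) with h | h
      · exact h3 j (by omega) n hn
      · obtain rfl : j = d + 1 := by omega
        have hR := (regR hI δ r hδ (d + 1) N (ad I N) _ _ hA1 hT hA1 hP1 hP1 (by
          intro j hj n hn
          rw [nab_iter_sub_const _ _ _ (by omega)]
          exact h3 j (by omega) n hn)).1.hp n hn
        have hb := boundHB hI hD r (d + 1) N _ hA1 hP1 n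
        rw [hR] at hb
        simp only [Nat.sub_self, Function.iterate_zero, id]
        nlinarith

theorem boundFin (hI : IsMaxPrimary I) (δ r : ℕ) (hδ : 1 ≤ δ) (d : ℕ) :
    ∀ (N : Type u) [AddCommGroup N] [Module A N] [Module.Finite A N] (F : I.Filtration N)
      (P PI : ℤ → ℤ), Setup F r → Setup (ad I N) r → HasHP F d P → HasHP (ad I N) d PI →
      (∀ j ≤ d, ∀ n : ℕ, mreg δ r j ≤ n → nab^[d - j] PI n ≤ δ * ((n + j).choose j : ℕ)) →
      (∀ j ≤ d, ∀ n : ℕ, mreg δ r j ≤ n → 0 ≤ nab^[d - j] P n ∧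
        nab^[d - j] P n ≤ δ * ((n + j).choose j : ℕ)) ∧
      nab^[d] P = nab^[d] PI ∧
      (1 ≤ d → nab^[d] P ((mreg δ r 1 : ℕ) + 1) ≤ nab^[d - 1] P (mreg δ r 1 : ℕ)) := by
  induction d with
  | zero =>
    intro N _ _ _ F P PI hF hA hP hPI hY
    have : Subsingleton (N ⧸ lcZero (maximalIdeal A) N) :=
      noTor_deg_zero hI (hF.quot _) (noTor_quot hI) (hP.lc hI hF)
    have e1 := hp_of_subsingleton_lc hI hF hP this
    have e2 := hp_of_subsingleton_lc hI hA hPI this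
    rw [e2, ← e1] at hY
    refine ⟨fun j hj n hn => ⟨?_, hY j hj n hn⟩, by rw [e1, e2], fun h => by omega⟩
    rw [e1, Nat.zero_sub]
    exact ell_nonneg
  | succ d ih =>
    intro N' _ _ _ F' P PI hF' hA' hP' hPI' hY
    have hF : Setup (F'.quot (lcZero (maximalIdeal A) N')) r := hF'.quot _
    have hA := ad_setup_quot hA' (lcZero (maximalIdeal A) N')
    have hP := hP'.lc hI hF'
    have hPI := hPI'.lc hI hA'
    rw [ad_quot] at hPI
    have hl : 0 ≤ ell A N' := ell_nonneg
    have hT : NoTor I (N' ⧸ lcZero (maximalIdeal A) N') := noTor_quot hI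
    set N := N' ⧸ lcZero (maximalIdeal A) N' with hN
    set F : I.Filtration N := F'.quot (lcZero (maximalIdeal A) N') with hFdef
    obtain ⟨x, hx, hgF, hgA⟩ := exists_good F (ad I N) hF.stable hA.stable
    have hY' : ∀ j < d + 1, ∀ n : ℕ, mreg δ r j ≤ n →
        nab^[d + 1 - j] (fun t => PI t - ell A N') n ≤ δ * ((n + j).choose j : ℕ) := by
      intro j hj n hn
      rw [nab_iter_sub_const _ _ _ (by omega)]
      exact hY j (by omega) n hn
    obtain ⟨hR1, -, hγ⟩ := regR hI δ r hδ (d + 1) N F _ _ hF hT hA hP hPI hY'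
    obtain ⟨hR2, -, -⟩ := regR hI δ r hδ (d + 1) N (ad I N) _ _ hA hT hA hPI hPI hY'
    have hPx := hP.x hI hF hT hx (hgF.fr hF.stable) le_rfl
    have hPIx := hPI.x hI hA hT hx (hgA.fr hA.stable) le_rfl
    rw [ad_quot, nab_sub_const] at hPIx
    rw [nab_sub_const] at hPx
    obtain ⟨iα, iβ, iγ⟩ := ih (N ⧸ xN A N x) _ _ _ (hF.quot _) (ad_setup_quot hA _) hPx hPIx (by
      intro j hj n hn
      rw [nab_iter_succ, show d - j + 1 = d + 1 - j by omega]
      exact hY j (by omega) n hn)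
    refine ⟨?_, iβ, ?_⟩
    · intro j hj n hn
      rcases Nat.lt_or_ge j (d + 1) with h | h
      · have := iα j (by omega) n hn
        rwa [nab_iter_succ, show d - j + 1 = d + 1 - j by omega] at this
      · obtain rfl : j = d + 1 := by omega
        have e1 := hR1.hp n hn
        have e2 := hR2.hp n hn
        have e3 := cl_anti (ad_le hF.top (n + 1)) (hA.fin _)
        have e4 := hY (d + 1) le_rfl n hn
        have e5 := cl_nonneg (F.N (n + 1))
        simp only [Nat.sub_self, Function.iterate_zero, id] at e4 ⊢
        constructor <;> linarith
    · intro _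
      rcases Nat.eq_zero_or_pos d with rfl | h
      · have e1 := hγ rfl
        have e2 := hR1.hp (mreg δ r 1) le_rfl
        rw [nab_sub_const] at e1
        simp only [zero_add, Nat.sub_self, Function.iterate_zero, id, Function.iterate_one]
        linarith
      · have := iγ h
        rwa [nab_iter_succ, nab_iter_succ, show d - 1 + 1 = d + 1 - 1 by omega] at this

end Bounds
end HCB

namespace HCB

section Dim

variable {A : Type u} [CommRing A] {I : Ideal A} [IsLocalRing A] [IsNoetherianRing A]

lemma supp_lc (hI : IsMaxPrimary I) (N : Type u) [AddCommGroup N] [Module A N]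
    [Module.Finite A N] (p : PrimeSpectrum A) (hp : p ∈ Module.support A N) :
    p ∈ Module.support A (N ⧸ lcZero (maximalIdeal A) N) ∨ p = closedPoint A := by
  obtain ⟨k, hk⟩ := lc_uniform (N := N) hI
  obtain ⟨v, hv⟩ := Module.mem_support_iff'.mp hp
  by_contra hcon
  push Not at hcon
  obtain ⟨h1, h2⟩ := hcon
  apply h1
  have hIp : ¬ I ≤ p.asIdeal := by
    intro hle
    apply h2
    have h3 : maximalIdeal A ≤ p.asIdeal := by
      rw [← hI.2]; exact p.isPrime.radical_le_iff.mpr hle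
    ext1
    exact ((maximalIdeal.isMaximal A).eq_of_le p.isPrime.ne_top h3).symm
  obtain ⟨a, ha, hap⟩ := SetLike.not_le_iff_exists.mp hIp
  rw [Module.mem_support_iff']
  refine ⟨Submodule.mkQ _ v, fun s hs h0 => ?_⟩
  rw [← map_smul, Submodule.mkQ_apply, Submodule.Quotient.mk_eq_zero] at h0
  have h4 := hk (a ^ k) (Ideal.pow_mem_pow ha k) _ h0
  rw [← mul_smul] at h4
  refine hv _ ?_ h4
  intro h5
  rcases p.isPrime.mem_or_mem h5 with h6 | h6
  · exact hap (p.isPrime.mem_of_pow_mem _ h6)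
  · exact hs h6

theorem dimLe [Infinite (ResidueField A)] (hI : IsMaxPrimary I) (r d : ℕ) :
    ∀ (N : Type u) [AddCommGroup N] [Module A N] [Module.Finite A N] (P : ℤ → ℤ),
      Setup (ad I N) r → HasHP (ad I N) d P → Module.supportDim A N ≤ d := by
  have hsub : ∀ (N : Type u) [AddCommGroup N] [Module A N] [Module.Finite A N],
      Subsingleton (N ⧸ lcZero (maximalIdeal A) N) → Module.supportDim A N ≤ 0 := by
    intro N _ _ _ hs
    have : Subsingleton (Module.support A N) := by
      constructor
      rintro ⟨p, hp⟩ ⟨q, hq⟩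
      have hp := supp_lc hI N p hp
      have hq := supp_lc hI N q hq
      rw [Module.support_eq_empty] at hp hq
      simp at hp hq
      simp [hp, hq]
    exact Order.krullDim_nonpos_of_subsingleton
  induction d with
  | zero =>
    intro N _ _ _ P hA hP
    have hA1 := ad_setup_quot hA (lcZero (maximalIdeal A) N)
    have hP1 := hP.lc hI hA
    rw [ad_quot] at hP1
    exact hsub N (noTor_deg_zero hI hA1 (noTor_quot hI) hP1)
  | succ d ih =>
    intro N' _ _ _ P hA hP
    have hP1 := hP.lc hI hA
    have hA1 := ad_setup_quot hA (lcZero (maximalIdeal A) N')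
    rw [ad_quot] at hP1
    have hT : NoTor I (N' ⧸ lcZero (maximalIdeal A) N') := noTor_quot hI
    have hsub' := hsub N'
    have hsupp := supp_lc hI N'
    set N := N' ⧸ lcZero (maximalIdeal A) N' with hN
    rcases subsingleton_or_nontrivial N with hs | hs
    · refine (hsub' hs).trans ?_
      exact_mod_cast Nat.zero_le _
    · obtain ⟨x, hx, hg, -⟩ := exists_good (ad I N) (ad I N) hA1.stable hA1.stable
      have hP2 := hP1.x hI hA1 hT hx (hg.fr hA1.stable) le_rfl
      rw [ad_quot] at hP2
      have h3 := ih (N ⧸ xN A N x) _ (ad_setup_quot hA1 _) hP2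
      have h4 : Module.supportDim A N' ≤ Module.supportDim A N := by
        refine Order.krullDim_le_of_strictMono (fun a => ⟨a.1, ?_⟩) (fun {_ _} lt => lt)
        rcases hsupp a.1 a.2 with h | h
        · exact h
        · rw [h]; exact closedPoint_mem_support A N
      have hxm : x ∈ maximalIdeal A := le_maximalIdeal hI.1 hx
      have h5 := Module.supportDim_le_supportDim_quotSMulTop_succ (M := N) hxm
      have h6 : Module.supportDim A (QuotSMulTop x N) = Module.supportDim A (N ⧸ xN A N x) :=
        Module.supportDim_eq_of_equiv (Submodule.quotEquivOfEq _ _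
          (Submodule.ideal_span_singleton_smul _ _).symm)
      rw [h6] at h5
      refine h4.trans (h5.trans ?_)
      push_cast
      gcongr

end Dim
end HCB

namespace HCB

section Numeric

lemma choose_le_pow (m j : ℕ) : (m + j).choose j ≤ (m + 1) ^ j := by
  induction j with
  | zero => simp
  | succ j ih =>
    have h := Nat.add_one_mul_choose_eq (m + j) j
    have h2 : (m + j + 1).choose (j + 1) * (j + 1) ≤ ((m + 1) ^ (j + 1)) * (j + 1) := by
      calc (m + j + 1).choose (j + 1) * (j + 1) = (m + j + 1) * (m + j).choose j := h.symm
        _ ≤ ((m + 1) * (j + 1)) * (m + 1) ^ j := Nat.mul_le_mul (by nlinarith) ih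
        _ = _ := by ring
    exact Nat.le_of_mul_le_mul_right h2 (by omega)

/-- bound for the absolute values -/
def bet (D r : ℕ) : ℕ → ℕ
  | 0 => D
  | (j + 1) => D * (mreg D r (j + 1) + (j + 1)).choose (j + 1) + (mreg D r j + 1) * bet D r j

lemma mreg_bound {D r : ℕ} (hD : 1 ≤ D) (j : ℕ) :
    mreg D r (j + 2) + 1 ≤ (D + r + 1) ^ (3 * (j + 1).factorial - 1) := by
  induction j with
  | zero =>
    have h1 : mreg D r 1 = D + r - 1 := by simp [mreg]; omega
    have h2 : mreg D r 2 + 1 = (D + 1) * (D + r) - 1 := by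
      rw [mreg, h1, show D + r - 1 + 1 = D + r by omega, Nat.choose_one_right]
      have : 1 ≤ D * (D + r) := Nat.mul_pos hD (by omega)
      rw [Nat.add_mul, one_mul]
      omega
    rw [h2]
    simp
    nlinarith
  | succ j ih =>
    set s := D + r + 1 with hs
    set a := 3 * (j + 1).factorial - 1 with ha
    have hf : j + 1 ≤ (j + 1).factorial := Nat.self_le_factorial _
    have hs1 : 1 ≤ s := by omega
    have h1 : mreg D r (j + 1 + 2) + 1 ≤ (mreg D r (j + 2) + 1) +
        D * (mreg D r (j + 2) + 1) ^ (j + 2) := by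
      rw [show j + 1 + 2 = (j + 2) + 1 by omega, mreg]
      have := Nat.mul_le_mul_left D (choose_le_pow (mreg D r (j + 2)) (j + 2))
      omega
    have h2 : (mreg D r (j + 2) + 1) ^ (j + 2) ≤ s ^ (a * (j + 2)) := by
      rw [pow_mul]; exact Nat.pow_le_pow_left ih _
    have h3 : s ^ a ≤ s ^ (a * (j + 2)) := Nat.pow_le_pow_right hs1 (by nlinarith)
    calc mreg D r (j + 1 + 2) + 1 ≤ s ^ (a * (j + 2)) + D * s ^ (a * (j + 2)) := by
          refine h1.trans (Nat.add_le_add (ih.trans h3) (Nat.mul_le_mul_left _ h2))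
      _ = (D + 1) * s ^ (a * (j + 2)) := by ring
      _ ≤ s * s ^ (a * (j + 2)) := Nat.mul_le_mul_right _ (by omega)
      _ = s ^ (a * (j + 2) + 1) := by ring
      _ ≤ s ^ (3 * (j + 1 + 1).factorial - 1) := by
          apply Nat.pow_le_pow_right hs1
          rw [Nat.factorial_succ (j + 1)]
          have : a + 1 = 3 * (j + 1).factorial := by omega
          have h5 : 3 * ((j + 1 + 1) * (j + 1).factorial) = (j + 2) * (a + 1) := by
            rw [this]; ring
          rw [h5]
          have : (j + 2) * (a + 1) = a * (j + 2) + j + 2 := by ring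
          omega

lemma bet_bound {D r : ℕ} (hD : 1 ≤ D) (i : ℕ) :
    bet D r (i + 2) ≤ (D + r + 1) ^ (3 * (i + 2).factorial - (i + 2) + 1) := by
  set s := D + r + 1 with hs
  have hs1 : 1 ≤ s := by omega
  have hf0 : ∀ i : ℕ, i ≤ i.factorial := Nat.self_le_factorial
  have hfirst : ∀ i : ℕ, D * (mreg D r (i + 2) + (i + 2)).choose (i + 2) ≤
      D * s ^ (3 * (i + 2).factorial - (i + 2)) := by
    intro i
    apply Nat.mul_le_mul_left
    refine (choose_le_pow _ _).trans ((Nat.pow_le_pow_left (mreg_bound hD i) _).trans ?_)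
    rw [← pow_mul]
    apply Nat.pow_le_pow_right hs1
    rw [Nat.factorial_succ (i + 1), Nat.sub_mul]
    apply le_of_eq
    congr 1
    · ring
    · omega
  induction i with
  | zero =>
    rw [bet]
    have h1 : mreg D r 1 = D + r - 1 := by simp [mreg]; omega
    have hb : bet D r 1 = D * (D + r) + (r + 1) * D := by
      rw [bet, h1, show D + r - 1 + (0 + 1) = D + r by omega, zero_add, Nat.choose_one_right]
      rfl
    have e1 := hfirst 0
    have e2 : (mreg D r (0 + 1) + 1) * bet D r (0 + 1) ≤ s ^ 4 := by
      rw [zero_add, hb, h1, show D + r - 1 + 1 = D + r by omega]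
      have : D * (D + r) + (r + 1) * D ≤ s * s := by
        rw [hs]; nlinarith
      calc _ ≤ s * (s * s) := Nat.mul_le_mul (by omega) this
        _ = s ^ 3 := by ring
        _ ≤ s ^ 4 := Nat.pow_le_pow_right hs1 (by omega)
    have e3 : 3 * (0 + 2).factorial - (0 + 2) = 4 := by decide
    rw [e3] at e1 ⊢
    calc _ ≤ D * s ^ 4 + s ^ 4 := Nat.add_le_add e1 e2
      _ = (D + 1) * s ^ 4 := by ring
      _ ≤ s * s ^ 4 := Nat.mul_le_mul_right _ (by omega)
      _ = _ := by ring
  | succ i ih =>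
    rw [bet]
    have e1 := hfirst (i + 1)
    have e2 : (mreg D r (i + 1 + 1) + 1) * bet D r (i + 1 + 1) ≤
        s ^ (3 * (i + 1 + 2).factorial - (i + 1 + 2)) := by
      refine (Nat.mul_le_mul (mreg_bound hD i) ih).trans ?_
      rw [← pow_add]
      apply Nat.pow_le_pow_right hs1
      have f1 : (i + 1 + 2).factorial = (i + 3) * ((i + 2) * (i + 1).factorial) := by
        rw [show i + 1 + 2 = (i + 2) + 1 by omega, Nat.factorial_succ, Nat.factorial_succ (i + 1)]
      have f2 : (i + 2).factorial = (i + 2) * (i + 1).factorial := Nat.factorial_succ (i + 1)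
      have f3 := hf0 (i + 1)
      have f4 := hf0 (i + 2)
      have f5 := hf0 (i + 1 + 2)
      rw [f1] at f5 ⊢
      rw [f2] at f4 ⊢
      generalize (i + 1).factorial = f at *
      have f6 : (i + 2) * f ≥ 2 * f := Nat.mul_le_mul_right _ (by omega)
      have f7 : (i + 3) * ((i + 2) * f) ≥ 3 * ((i + 2) * f) := Nat.mul_le_mul_right _ (by omega)
      omega
    calc _ ≤ D * s ^ _ + s ^ _ := Nat.add_le_add e1 e2
      _ = (D + 1) * s ^ (3 * (i + 1 + 2).factorial - (i + 1 + 2)) := by ring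
      _ ≤ s * s ^ (3 * (i + 1 + 2).factorial - (i + 1 + 2)) := Nat.mul_le_mul_right _ (by omega)
      _ = _ := by rw [pow_succ]; ring

lemma bet_spec {D r d : ℕ} (hD : 1 ≤ D) (Q : ℕ → ℤ → ℤ) (h0 : nab (Q 0) = 0)
    (hQ : ∀ j < d, nab (Q (j + 1)) = Q j)
    (hα : ∀ j ≤ d, ∀ n : ℕ, mreg D r j ≤ n → 0 ≤ Q j n ∧ Q j n ≤ D * ((n + j).choose j : ℕ))
    (j : ℕ) (hj : j ≤ d) : ∀ t : ℤ, -1 ≤ t → t ≤ mreg D r j → |Q j t| ≤ bet D r j := by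
  induction j with
  | zero =>
    intro t _ _
    have h1 := hα 0 (by omega) (mreg D r 0) le_rfl
    rw [const_of_nab h0 t (mreg D r 0), abs_of_nonneg h1.1]
    simpa [bet] using h1.2
  | succ j ih =>
    have ih := ih (by omega)
    have hstep : ∀ t : ℤ, Q (j + 1) (t - 1) = Q (j + 1) t - Q j t := by
      intro t
      rw [← hQ j (by omega)]; simp [nab]
    set m := mreg D r j with hm
    set m' := mreg D r (j + 1) with hm'
    have hmm : m ≤ m' := mreg_le_succ hD j
    set E : ℤ := D * ((m' + (j + 1)).choose (j + 1) : ℕ) with hE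
    have hup : ∀ k : ℕ, ∀ n : ℕ, n + k = m' → m ≤ n →
        Q (j + 1) n ≤ E ∧ -(E - D * ((n + (j + 1)).choose (j + 1) : ℕ)) ≤ Q (j + 1) n := by
      intro k
      induction k with
      | zero =>
        intro n hn hmn
        obtain rfl : n = m' := by omega
        have h1 := hα (j + 1) hj m' le_rfl
        refine ⟨h1.2, ?_⟩
        rw [← hE]; linarith [h1.1]
      | succ k ihk =>
        intro n hn hmn
        obtain ⟨h1, h2⟩ := ihk (n + 1) (by omega) (by omega)
        have h3 := hα j (by omega) (n + 1) (by omega)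
        have h4 := hstep ((n + 1 : ℕ) : ℤ)
        rw [show ((n + 1 : ℕ) : ℤ) - 1 = n by push_cast; ring] at h4
        have h5 : ((n + 1 + (j + 1)).choose (j + 1)) =
            (n + 1 + j).choose j + (n + (j + 1)).choose (j + 1) := by
          rw [show n + 1 + (j + 1) = (n + 1 + j) + 1 by omega, Nat.choose_succ_succ,
            show n + 1 + j = n + (j + 1) by omega]
        rw [h5] at h2
        push_cast at h1 h2 h3 h4
        refine ⟨by linarith [h3.1], ?_⟩
        rw [h4]
        push_cast
        linarith [h3.2]
    have hup' : ∀ n : ℕ, m ≤ n → n ≤ m' → |Q (j + 1) n| ≤ E := by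
      intro n h1 h2
      obtain ⟨h3, h4⟩ := hup (m' - n) n (by omega) h1
      rw [abs_le]
      refine ⟨?_, h3⟩
      have : (0 : ℤ) ≤ D * ((n + (j + 1)).choose (j + 1) : ℕ) := by positivity
      linarith
    have hlow : ∀ k : ℕ, k ≤ m + 1 → |Q (j + 1) ((m : ℤ) - k)| ≤ E + k * bet D r j := by
      intro k
      induction k with
      | zero => intro _; simpa using hup' m le_rfl hmm
      | succ k ihk =>
        intro hk
        have h1 := ihk (by omega)
        have h2 := ih ((m : ℤ) - k) (by push_cast at *; omega) (by push_cast at *; omega)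
        have h3 := hstep ((m : ℤ) - k)
        rw [show (m : ℤ) - ((k + 1 : ℕ) : ℤ) = (m : ℤ) - k - 1 by push_cast; ring, h3]
        have h4 := abs_sub (Q (j + 1) ((m : ℤ) - k)) (Q j ((m : ℤ) - k))
        push_cast
        linarith
    intro t ht1 ht2
    have hbet : ((bet D r (j + 1) : ℕ) : ℤ) = E + (m + 1) * bet D r j := by
      rw [bet]; push_cast; rfl
    have hb0 : (0 : ℤ) ≤ bet D r j := Int.natCast_nonneg _
    rw [hbet]
    rcases le_or_gt (m : ℤ) t with h | h
    · obtain ⟨n, rfl⟩ := Int.eq_ofNat_of_zero_le (show 0 ≤ t by omega)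
      have := hup' n (by exact_mod_cast h) (by exact_mod_cast ht2)
      have h2 : (0 : ℤ) ≤ (m + 1) * bet D r j := by positivity
      linarith
    · obtain ⟨k, hk⟩ := Int.eq_ofNat_of_zero_le (show 0 ≤ (m : ℤ) - t by omega)
      obtain rfl : t = (m : ℤ) - k := by omega
      have h1 := hlow k (by omega)
      have h2 : (k : ℤ) ≤ m + 1 := by omega
      nlinarith

lemma e1_spec {D r : ℕ} (hD : 1 ≤ D) (Q0 Q1 : ℤ → ℤ) (h0 : nab Q0 = 0) (h1 : nab Q1 = Q0)
    (he0 : 1 ≤ Q0 0) (he1 : Q0 0 ≤ D)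
    (hub : Q1 (mreg D r 1) ≤ D * ((mreg D r 1 + 1).choose 1 : ℕ))
    (hlb : Q0 ((mreg D r 1 : ℕ) + 1) ≤ Q1 (mreg D r 1)) :
    |Q1 (-1)| ≤ ((D : ℤ) + r - 1) * D := by
  have hlin : ∀ n : ℕ, Q1 ((n : ℤ) - 1) = Q1 (-1) + n * Q0 0 := by
    intro n
    induction n with
    | zero => simp
    | succ n ih =>
      have h2 := congrFun h1 (n : ℤ)
      rw [const_of_nab h0 (n : ℤ) 0] at h2
      simp only [nab] at h2
      push_cast
      rw [show (n : ℤ) + 1 - 1 = n by ring]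
      linarith
  have hm : mreg D r 1 + 1 = D + r := by simp [mreg]; omega
  have h2 := hlin (D + r)
  have hmz : ((mreg D r 1 : ℕ) : ℤ) = ((D + r : ℕ) : ℤ) - 1 := by rw [← hm]; push_cast; ring
  rw [hm, Nat.choose_one_right, hmz] at hub
  rw [hmz, const_of_nab h0 _ 0] at hlb
  rw [h2] at hub hlb
  push_cast at hub hlb
  have hDz : (1 : ℤ) ≤ D := by exact_mod_cast hD
  have hr : (0 : ℤ) ≤ r := Int.natCast_nonneg _
  rw [abs_le]
  constructor <;> nlinarith

end Numeric
end HCB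

namespace HCB

section Final

/-- binomial polynomial -/
noncomputable def bin (k : ℕ) (t : ℤ) : ℤ := Ring.choose (t + k) k

lemma bin_zero (t : ℤ) : bin 0 t = 1 := by simp [bin]

lemma bin_nat (k n : ℕ) : bin k n = ((n + k).choose k : ℕ) := by
  rw [bin, ← Nat.cast_add, Ring.choose_natCast]

lemma bin_neg (k : ℕ) : bin (k + 1) (-1) = 0 := by
  rw [bin, show (-1 : ℤ) + ((k + 1 : ℕ) : ℤ) = (k : ℕ) by push_cast; ring, Ring.choose_natCast]
  simp

lemma nab_bin (k : ℕ) (t : ℤ) : bin (k + 1) t - bin (k + 1) (t - 1) = bin k t := by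
  have h := Ring.choose_succ_succ (t + k) k
  unfold bin
  push_cast
  rw [show t + ((k : ℤ) + 1) = t + k + 1 by ring, h, show t - 1 + ((k : ℤ) + 1) = t + k by ring]
  ring

/-- polynomial with given Hilbert coefficients -/
noncomputable def pol (e : ℕ → ℤ) (j : ℕ) (t : ℤ) : ℤ :=
  ∑ i ∈ Finset.range (j + 1), (-1) ^ i * e i * bin (j - i) t

lemma nab_pol_zero (e : ℕ → ℤ) : nab (pol e 0) = 0 := by
  funext t
  simp [nab, pol, bin_zero]

lemma nab_pol (e : ℕ → ℤ) (j : ℕ) : nab (pol e (j + 1)) = pol e j := by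
  funext t
  simp only [nab, pol]
  rw [Finset.sum_range_succ, Finset.sum_range_succ _ (j + 1), Nat.sub_self, bin_zero, bin_zero]
  rw [add_sub_add_right_eq_sub, ← Finset.sum_sub_distrib]
  apply Finset.sum_congr rfl
  intro i hi
  have : i ≤ j := by simp at hi; omega
  rw [show j + 1 - i = (j - i) + 1 by omega, ← mul_sub, nab_bin]

lemma nab_iter_pol (e : ℕ → ℤ) (k j : ℕ) : nab^[k] (pol e (j + k)) = pol e j := by
  induction k with
  | zero => rfl
  | succ k ih => rw [← nab_iter_succ, ← add_assoc, nab_pol, ih]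

lemma pol_neg (e : ℕ → ℤ) (j : ℕ) : pol e j (-1) = (-1) ^ j * e j := by
  rw [pol, Finset.sum_range_succ, Nat.sub_self, bin_zero, Finset.sum_eq_zero, zero_add, mul_one]
  intro i hi
  have : i < j := by simpa using hi
  obtain ⟨k, hk⟩ : ∃ k, j - i = k + 1 := ⟨j - i - 1, by omega⟩
  rw [hk, bin_neg, mul_zero]

lemma pol_zero (e : ℕ → ℤ) (t : ℤ) : pol e 0 t = e 0 := by
  simp [pol, bin_zero]

lemma pol_nat (e : ℕ → ℤ) (d n : ℕ) : pol e d n =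
    ∑ i ∈ Finset.range (d + 1), (-1) ^ i * e i * ((n + d - i).choose (d - i) : ℤ) := by
  rw [pol]
  apply Finset.sum_congr rfl
  intro i hi
  have : i ≤ d := by simp at hi; omega
  rw [bin_nat, show n + (d - i) = n + d - i by omega]

variable {A : Type u} [CommRing A]

lemma fin_of_moduleLength {N : Type u} [AddCommGroup N] [Module A N] {W : Submodule A N} {h : ℕ}
    (hW : moduleLength A (N ⧸ W) = (h : WithBot ℕ∞)) : FinCl W ∧ cl W = h := by
  rw [moduleLength, ← Module.coe_length] at hW
  have h1 : Module.length A (N ⧸ W) = (h : ℕ∞) := by exact_mod_cast hW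
  unfold FinCl cl
  rw [h1]
  exact ⟨ENat.natCast_ne_top h, rfl⟩

lemma genDeg_spec {I : Ideal A} {M : Type u} [AddCommGroup M] [Module A M] (F : I.Filtration M)
    (hF : F.Stable) : ∀ n, F.genDeg ≤ n → F.N (n + 1) = I • F.N n := by
  obtain ⟨n0, h⟩ := hF
  exact Nat.sInf_mem (s := {t | ∀ n, t ≤ n → F.N (n + 1) = I • F.N n})
    ⟨n0, fun n hn => (h n hn).symm⟩

lemma hasHP_pol {I : Ideal A} {M : Type u} [AddCommGroup M] [Module A M] (F : I.Filtration M)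
    (d : ℕ) (H : ℕ → ℕ) (hH : ∀ n, cl (F.N (n + 1)) = H n) (e : ℕ → ℤ)
    (he : ∀ᶠ n : ℕ in atTop, (H n : ℤ) =
      ∑ i ∈ Finset.range (d + 1), (-1) ^ i * e i * ((n + d - i).choose (d - i) : ℤ)) :
    HasHP F d (pol e d) := by
  constructor
  · rw [← nab_iter_succ']
    have := nab_iter_pol e d 0
    rw [zero_add] at this
    rw [this, nab_pol_zero]
  · filter_upwards [he] with n hn
    rw [hH, hn, pol_nat]

end Final
end HCB

open HCB

/-- **Theorem 1.11.** Let `dim M = d ≥ 1`, `𝓜 = {M_n}` a good `I`-filtration of `M`,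
with Hilbert coefficients `e i = e_i(𝓜)` (defined by
`ℓ(M/M_{n+1}) = ∑_{i=0}^d (-1)^i e_i(𝓜) C(n+d-i, d-i)` for `n ≫ 0`), and let
`e' i = e_i({I^n M})`, so that `e' 0 = e(I,M)` is the multiplicity.  Then
(i)   `e_0(𝓜) = e(I,M) ≤ D(I,M)`;
(ii)  `|e_1(𝓜)| ≤ (D(I,M) + r(𝓜) - 1)·D(I,M)`;
(iii) `|e_i(𝓜)| ≤ (D(I,M) + r(𝓜) + 1)^(3·i! - i + 1)` for `2 ≤ i ≤ d`. -/
theorem hilbert_coefficients_bounds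
    {A : Type u} [CommRing A] [IsLocalRing A] [IsNoetherianRing A]
    [Infinite (ResidueField A)]
    {M : Type u} [AddCommGroup M] [Module A M] [Module.Finite A M]
    (I : Ideal A) (hI : IsMaxPrimary I)
    (F : I.Filtration M) (hF : F.IsGood)
    (d : ℕ) (hd : 1 ≤ d)
    (hdim : ringKrullDim (A ⧸ Module.annihilator A M) = (d : WithBot ℕ∞))
    -- the Hilbert–Samuel function of `𝓜` and its Hilbert coefficients
    (HF : ℕ → ℕ) (hHF : ∀ n : ℕ, moduleLength A (M ⧸ F.N (n + 1)) = (HF n : WithBot ℕ∞))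
    (e : ℕ → ℤ)
    (he : ∀ᶠ n : ℕ in atTop, (HF n : ℤ) =
      ∑ i ∈ Finset.range (d + 1), (-1) ^ i * e i * ((n + d - i).choose (d - i) : ℤ))
    -- the Hilbert–Samuel function of the `I`-adic filtration and its coefficients;
    -- `e' 0 = e(I,M)` is the multiplicity of `M` w.r.t. `I`
    (HI : ℕ → ℕ)
    (hHI : ∀ n : ℕ,
      moduleLength A (M ⧸ (I ^ (n + 1) • (⊤ : Submodule A M))) = (HI n : WithBot ℕ∞))
    (e' : ℕ → ℤ)
    (he' : ∀ᶠ n : ℕ in atTop, (HI n : ℤ) =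
      ∑ i ∈ Finset.range (d + 1), (-1) ^ i * e' i * ((n + d - i).choose (d - i) : ℤ))
    -- an arbitrary extended degree
    (D : (N : Type u) → [AddCommGroup N] → [Module A N] → ℕ)
    (hD : IsExtendedDegree I D) :
    (e 0 = e' 0 ∧ e' 0 ≤ (D M : ℤ)) ∧
    (|e 1| ≤ ((D M : ℤ) + (F.genDeg : ℤ) - 1) * (D M : ℤ)) ∧
    (∀ i : ℕ, 2 ≤ i → i ≤ d →
      |e i| ≤ ((D M : ℤ) + (F.genDeg : ℤ) + 1) ^ (3 * i.factorial - i + 1)) := by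
  have hFs : Setup F F.genDeg := ⟨hF.1, genDeg_spec F hF.2, fun n => by
    cases n with
    | zero => rw [hF.1]; exact finCl_top
    | succ n => exact (fin_of_moduleLength (hHF n)).1⟩
  have hAs : Setup (ad I M) F.genDeg := ad_setup (fun n => by
    cases n with
    | zero => rw [ad_N, pow_zero, Ideal.one_eq_top, Submodule.top_smul]; exact finCl_top
    | succ n => exact (fin_of_moduleLength (hHI n)).1)
  have hP : HasHP F d (pol e d) :=
    hasHP_pol F d HF (fun n => (fin_of_moduleLength (hHF n)).2) e he
  have hPI : HasHP (ad I M) d (pol e' d) :=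
    hasHP_pol (ad I M) d HI (fun n => (fin_of_moduleLength (hHI n)).2) e' he'
  rw [← Module.supportDim_eq_ringKrullDim_quotient_annihilator] at hdim
  set r := F.genDeg with hr
  have hD1 : 1 ≤ D M := by
    by_contra hcon
    have h0 : D M = 0 := by omega
    have hb := boundHB hI hD r d M _ hAs hPI
    have htop : ∀ n, (ad I M).N (n + 1) = ⊤ := fun n =>
      eq_of_cl_eq le_top (hAs.fin _) (by
        rw [cl_top]
        have := hb n
        rw [h0] at this
        simpa using this)
    have : Subsingleton M := subsingleton_of_forall_eq 0 fun v => krull hI hAs (fun n => by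
      apply (ad I M).mono n
      rw [htop]; trivial)
    rw [Module.supportDim_eq_bot_of_subsingleton] at hdim
    exact absurd hdim (by simp)
  have hY := boundY hI hD (D M) r hD1 d M _ le_rfl hAs hPI
  obtain ⟨hα, hβ, hγ⟩ := boundFin hI (D M) r hD1 d M F _ _ hFs hAs hP hPI hY
  have hpol : ∀ (c : ℕ → ℤ) (j : ℕ), j ≤ d → nab^[d - j] (pol c d) = pol c j := by
    intro c j hj
    have := nab_iter_pol c (d - j) j
    rwa [show j + (d - j) = d by omega] at this
  have hpd : ∀ c : ℕ → ℤ, nab^[d] (pol c d) = pol c 0 := fun c => hpol c 0 (by omega)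
  have he00 : e 0 = e' 0 := by
    rw [hpd, hpd] at hβ
    rw [← pol_zero e 0, hβ, pol_zero]
  have he0D : e' 0 ≤ D M := by
    have := hY 0 (by omega) _ le_rfl
    rw [hpol _ _ (by omega), pol_zero] at this
    simpa using this
  have he0n : 0 ≤ e 0 := by
    have := (hα 0 (by omega) _ le_rfl).1
    rwa [hpol _ _ (by omega), pol_zero] at this
  have he0 : 1 ≤ e 0 := by
    by_contra hcon
    have h0 : e' 0 = 0 := by omega
    have hPI2 : HasHP (ad I M) (d - 1) (pol e' d) := by
      refine ⟨?_, hPI.2⟩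
      rw [show d - 1 + 1 = d by omega, hpd]
      funext t
      rw [pol_zero, h0]; rfl
    have h1 := dimLe hI r (d - 1) M _ hAs hPI2
    rw [hdim] at h1
    have h2 : d ≤ d - 1 := by exact_mod_cast h1
    omega
  have hα' : ∀ j ≤ d, ∀ n : ℕ, mreg (D M) r j ≤ n → 0 ≤ pol e j n ∧
      pol e j n ≤ D M * ((n + j).choose j : ℕ) := by
    intro j hj n hn
    have := hα j hj n hn
    rwa [hpol _ _ hj] at this
  refine ⟨⟨he00, he0D⟩, ?_, ?_⟩
  · have hg := hγ hd
    rw [hpd, hpol _ _ hd] at hg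
    have := e1_spec hD1 (pol e 0) (pol e 1) (nab_pol_zero e) (nab_pol e 0)
      (by rw [pol_zero]; exact he0) (by rw [pol_zero, he00]; exact he0D)
      (hα' 1 hd _ le_rfl).2 hg
    rw [pol_neg] at this
    simpa using this
  · intro i hi hid
    have h1 := bet_spec hD1 (pol e) (nab_pol_zero e) (fun j _ => nab_pol e j) hα' i hid (-1)
      le_rfl (by have := Int.natCast_nonneg (mreg (D M) r i); omega)
    rw [pol_neg, abs_mul, abs_pow, abs_neg, abs_one, one_pow, one_mul] at h1
    obtain ⟨k, rfl⟩ : ∃ k, i = k + 2 := ⟨i - 2, by omega⟩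
    have h2 := bet_bound (r := r) hD1 k
    refine h1.trans ?_
    exact_mod_cast h2
end

section
/- Let A be a Noetherian standard graded algebra over an Artinian local ring with infinite residue field, I a homogeneous m-primary ideal generated by homogeneous elements of a single degree Δ ≥ 1, M a finitely generated graded A-module, and 𝓜 a good I-filtration of M by homogeneous submodules. Let x ∈ I \ mI be a homogeneous element whose initial form x* in G_I(A) is a filter-regular element on G(𝓜). Then x is a filter-regular element on M, i.e. (0 :_M x)_p = 0 for all p ≫ 0. -/
/-!
Formalization of results from:
L.X. Dung, L.T. Hoa, "Castelnuovo-Mumford regularity of associated graded modules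
and fiber cones of filtered modules" (graded case).

Setting: `A = ⊕_{n ≥ 0} A_n` is a Noetherian standard graded algebra over an Artinian
local ring `(A₀, 𝔪₀)` with infinite residue field, `𝔪 = 𝔪₀ ⊕ (⊕_{n ≥ 1} A_n)` its
maximal homogeneous ideal, `I` a homogeneous `𝔪`-primary ideal and `𝓜` a good
`I`-filtration of a finitely generated graded `A`-module `M` by homogeneous submodules.

Gradings are indexed by `ℤ` (with the ring concentrated in nonnegative degrees).
Invariants defined via graded local cohomology (Castelnuovo–Mumford regularities) and
the homological degree `hdeg` (whose definition needs `Ext`-modules into a Gorenstein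
graded algebra having `A` as a quotient, which is not available in Mathlib) are taken
as explicit, documented parameters.  Everything else is defined concretely below.
-/

open Filter IsLocalRing

universe u

section Preliminaries

variable {A : Type u} [CommRing A] {M : Type u} [AddCommGroup M] [Module A M]

/-- The minimal number of generators `μ(M)` of a module `M`. -/
noncomputable def minGens (A : Type u) (M : Type u) [CommRing A] [AddCommGroup M]
    [Module A M] : ℕ :=
  sInf {k | ∃ s : Finset M, s.card = k ∧ Submodule.span A (s : Set M) = ⊤}

variable {A₀ : Type u} [CommRing A₀]

/-- The maximal homogeneous ideal `𝔪 = 𝔪₀ ⊕ (⊕_{n ≥ 1} A_n)` of a graded algebra `A`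
over a local ring `A₀`. -/
noncomputable def maxHomIdeal [IsLocalRing A₀] [Algebra A₀ A]
    (𝒜 : ℤ → Submodule A₀ A) : Ideal A :=
  (maximalIdeal A₀).map (algebraMap A₀ A) ⊔
    Ideal.span (⋃ (n : ℤ) (_ : 0 < n), (𝒜 n : Set A))

/-- A submodule `p` of a graded module `M = ⊕ M_j` is homogeneous (graded): it contains
the homogeneous components of all of its elements. -/
def IsHomogeneousSubmodule [Module A₀ M] (ℳ : ℤ → Submodule A₀ M)
    [DirectSum.Decomposition ℳ] (p : Submodule A M) : Prop :=
  ∀ m ∈ p, ∀ j : ℤ, (DirectSum.decompose ℳ m j : M) ∈ p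

/-- The initial degree `i(M) = min {p ∣ M_p ≠ 0}` of a graded module `M = ⊕ M_j`. -/
noncomputable def initialDegree [Module A₀ M] (ℳ : ℤ → Submodule A₀ M) : ℤ :=
  sInf {p : ℤ | ℳ p ≠ ⊥}

end Preliminaries

section Helpers

set_option linter.unusedSectionVars false

variable {A₀ : Type u} [CommRing A₀] {A : Type u} [CommRing A] [Algebra A₀ A]
  (𝒜 : ℤ → Submodule A₀ A) [GradedAlgebra 𝒜]
  {M : Type u} [AddCommGroup M] [Module A M] [Module A₀ M] [IsScalarTower A₀ A M]
  (ℳ : ℤ → Submodule A₀ M) [DirectSum.Decomposition ℳ]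

theorem helper_comp_smul
    (hsmul : ∀ (i j : ℤ), ∀ a ∈ 𝒜 i, ∀ m ∈ ℳ j, a • m ∈ ℳ (i + j))
    (i p : ℤ) (a : A) (ha : a ∈ 𝒜 i) (m : M) :
    (DirectSum.decompose ℳ (a • m) p : M) = a • (DirectSum.decompose ℳ m (p - i) : M) := by
  induction m using DirectSum.Decomposition.inductionOn ℳ with
  | zero => simp
  | @homogeneous j m =>
    have h := hsmul i j a ha m m.2
    by_cases hp : p = i + j
    · subst hp
      rw [DirectSum.decompose_of_mem_same ℳ h, show i + j - i = j by ring,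
        DirectSum.decompose_of_mem_same ℳ m.2]
    · rw [DirectSum.decompose_of_mem_ne ℳ h (by omega),
        DirectSum.decompose_of_mem_ne ℳ m.2 (by omega), smul_zero]
  | add m n hm hn =>
    simp only [smul_add, DirectSum.decompose_add, DirectSum.add_apply, Submodule.coe_add, hm, hn]

/-- The submodule of elements with all components in degrees at least `c`. -/
def helperGe (hneg : ∀ n : ℤ, n < 0 → 𝒜 n = ⊥)
    (hsmul : ∀ (i j : ℤ), ∀ a ∈ 𝒜 i, ∀ m ∈ ℳ j, a • m ∈ ℳ (i + j)) (c : ℤ) :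
    Submodule A M where
  carrier := {m | ∀ p, p < c → (DirectSum.decompose ℳ m p : M) = 0}
  zero_mem' := by intro p _; simp
  add_mem' := by
    intro m n hm hn p hp
    simp [DirectSum.decompose_add, DirectSum.add_apply, hm p hp, hn p hp]
  smul_mem' := by
    intro a m hm p hp
    induction a using DirectSum.Decomposition.inductionOn 𝒜 with
    | zero => simp
    | @homogeneous i a =>
      rw [helper_comp_smul 𝒜 ℳ hsmul i p a a.2]
      by_cases hi : i < 0
      · have : (a : A) = 0 := by
          rw [← Submodule.mem_bot A₀, ← hneg i hi]
          exact a.2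
        rw [this, zero_smul]
      · rw [hm _ (by omega), smul_zero]
    | add a b ha hb =>
      simp [add_smul, DirectSum.decompose_add, DirectSum.add_apply, ha, hb]

theorem helper_pow (hneg : ∀ n : ℤ, n < 0 → 𝒜 n = ⊥)
    (hsmul : ∀ (i j : ℤ), ∀ a ∈ 𝒜 i, ∀ m ∈ ℳ j, a • m ∈ ℳ (i + j)) (c : ℤ)
    (htop : helperGe 𝒜 ℳ hneg hsmul c = ⊤) (Δ : ℕ) (s : Set A)
    (hs : s ⊆ ((𝒜 (Δ : ℤ) : Submodule A₀ A) : Set A)) (k : ℕ) :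
    (Ideal.span s) ^ k • (⊤ : Submodule A M) ≤ helperGe 𝒜 ℳ hneg hsmul (c + k * Δ) := by
  induction k with
  | zero => simp [htop]
  | succ k ih =>
    rw [pow_succ', mul_smul]
    refine (smul_mono_right _ ih).trans ?_
    rw [Submodule.smul_le]
    intro r hr n hn
    have : Ideal.span s ≤ (helperGe 𝒜 ℳ hneg hsmul (c + (k + 1 : ℕ) * Δ)).comap
        (LinearMap.toSpanSingleton A M n) := by
      rw [Ideal.span, Submodule.span_le]
      intro a ha
      change a • n ∈ helperGe 𝒜 ℳ hneg hsmul (c + (k + 1 : ℕ) * Δ)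
      intro p hp
      rw [helper_comp_smul 𝒜 ℳ hsmul Δ p a (hs ha)]
      rw [hn, smul_zero]
      push_cast at hp
      linarith
    exact this hr

theorem helper_gen
    (hsmul : ∀ (i j : ℤ), ∀ a ∈ 𝒜 i, ∀ m ∈ ℳ j, a • m ∈ ℳ (i + j))
    (T : Set M) (hT : Submodule.span A T = ⊤) (hTh : ∀ t ∈ T, ∃ j, t ∈ ℳ j)
    (p : ℤ) (N : Submodule A M)
    (h : ∀ i j a t, t ∈ T → a ∈ 𝒜 i → t ∈ ℳ j → i + j = p → a • t ∈ N) :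
    ∀ m ∈ ℳ p, m ∈ N := by
  have key : ∀ m : M, (DirectSum.decompose ℳ m p : M) ∈ N := by
    intro m
    have hm : m ∈ Submodule.span A T := by rw [hT]; trivial
    induction hm using Submodule.closure_induction with
    | zero => simp
    | add m n _ _ hm hn =>
      rw [DirectSum.decompose_add, DirectSum.add_apply, Submodule.coe_add]
      exact N.add_mem hm hn
    | smul_mem a t ht =>
      obtain ⟨j, hj⟩ := hTh t ht
      induction a using DirectSum.Decomposition.inductionOn 𝒜 with
      | zero => simp
      | @homogeneous i a =>
        have h1 := hsmul i j a a.2 t hj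
        by_cases hp : i + j = p
        · have h2 := h i j a t ht a.2 hj hp
          rw [hp] at h1
          rwa [DirectSum.decompose_of_mem_same ℳ h1]
        · rw [DirectSum.decompose_of_mem_ne ℳ h1 hp]
          exact N.zero_mem
      | add a b ha hb =>
        rw [add_smul, DirectSum.decompose_add, DirectSum.add_apply, Submodule.coe_add]
        exact N.add_mem ha hb
  intro m hm
  have := key m
  rwa [DirectSum.decompose_of_mem_same ℳ hm] at this

theorem helper_fin [Module.Finite A M] :
    ∃ (T : Set M) (d D : ℤ), Submodule.span A T = ⊤ ∧
      (∀ t ∈ T, ∃ j, t ∈ ℳ j) ∧ ∀ t ∈ T, t ≠ 0 → ∀ j, t ∈ ℳ j → d ≤ j ∧ j ≤ D := by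
  classical
  obtain ⟨S, hS⟩ := (Module.Finite.fg_top : (⊤ : Submodule A M).FG)
  let E : Finset ℤ := S.biUnion fun s => (DirectSum.decompose ℳ s).support
  obtain ⟨d, hd⟩ := E.bddBelow
  obtain ⟨D, hD⟩ := E.bddAbove
  refine ⟨{t | ∃ s ∈ S, ∃ j, t = (DirectSum.decompose ℳ s j : M)}, d, D, ?_, ?_, ?_⟩
  · rw [eq_top_iff, ← hS, Submodule.span_le]
    intro s hs
    rw [SetLike.mem_coe, ← DirectSum.sum_support_decompose ℳ s]
    exact Submodule.sum_mem _ fun j _ => Submodule.subset_span ⟨s, hs, j, rfl⟩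
  · rintro t ⟨s, hs, j, rfl⟩
    exact ⟨j, SetLike.coe_mem _⟩
  · rintro t ⟨s, hs, j, rfl⟩ h0 i hi
    have hij : j = i := DirectSum.degree_eq_of_mem_mem ℳ (SetLike.coe_mem _) hi h0
    subst hij
    have : j ∈ E := by
      simp only [E, Finset.mem_biUnion, DFinsupp.mem_support_iff]
      exact ⟨s, hs, fun h => h0 (by rw [h]; rfl)⟩
    exact ⟨hd this, hD this⟩

theorem helper_std [IsLocalRing A₀]
    (hstd : Algebra.adjoin A₀ ((𝒜 1 : Submodule A₀ A) : Set A) = ⊤) (q : ℕ) :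
    ∀ a ∈ 𝒜 (q : ℤ), a ∈ maxHomIdeal 𝒜 ^ q := by
  have hcl : ∀ y ∈ Submonoid.closure ((𝒜 1 : Submodule A₀ A) : Set A),
      ∃ k : ℕ, y ∈ 𝒜 (k : ℤ) ∧ y ∈ maxHomIdeal 𝒜 ^ k := by
    intro y hy
    induction hy using Submonoid.closure_induction with
    | mem y hy =>
      refine ⟨1, by simpa using hy, ?_⟩
      rw [pow_one]
      refine Ideal.mem_sup_right (Ideal.subset_span ?_)
      simp only [Set.mem_iUnion]
      exact ⟨1, one_pos, hy⟩
    | one => exact ⟨0, by simpa using SetLike.GradedOne.one_mem, by simp⟩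
    | mul y z _ _ hy hz =>
      obtain ⟨k, h1, h2⟩ := hy
      obtain ⟨l, h3, h4⟩ := hz
      refine ⟨k + l, ?_, ?_⟩
      · push_cast
        exact SetLike.mul_mem_graded h1 h3
      · rw [pow_add]
        exact Ideal.mul_mem_mul h2 h4
  have key : ∀ a : A, (DirectSum.decompose 𝒜 a (q : ℤ) : A) ∈ maxHomIdeal 𝒜 ^ q := by
    intro a
    have ha : a ∈ Submodule.span A₀
        (Submonoid.closure ((𝒜 1 : Submodule A₀ A) : Set A) : Set A) := by
      rw [← Algebra.adjoin_eq_span, hstd]; trivial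
    induction ha using Submodule.span_induction with
    | mem y hy =>
      obtain ⟨k, h1, h2⟩ := hcl y hy
      by_cases hk : k = q
      · subst hk
        rwa [DirectSum.decompose_of_mem_same 𝒜 h1]
      · rw [DirectSum.decompose_of_mem_ne 𝒜 h1 (by exact_mod_cast hk)]
        exact Ideal.zero_mem _
    | zero => simp
    | add y z _ _ hy hz =>
      rw [DirectSum.decompose_add, DirectSum.add_apply, Submodule.coe_add]
      exact Ideal.add_mem _ hy hz
    | smul r y _ hy =>
      rw [DirectSum.decompose_smul, DirectSum.smul_apply, Submodule.coe_smul, Algebra.smul_def]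
      exact Ideal.mul_mem_left _ _ hy
  intro a ha
  have := key a
  rwa [DirectSum.decompose_of_mem_same 𝒜 ha] at this

end Helpers

/-- **Lemma 2.6.** Let `A` be a Noetherian standard graded algebra over an Artinian
local ring with infinite residue field, `I` a homogeneous `𝔪`-primary ideal generated
by homogeneous elements of a single degree `Δ ≥ 1`, `M` a finitely generated graded
`A`-module and `𝓜` a good `I`-filtration of `M` by homogeneous submodules.  Let
`x ∈ I ∖ 𝔪I` be a homogeneous element whose initial form `x*` in `G_I(A)` is a
filter-regular element on `G(𝓜)`.  Then `x` is a filter-regular element on `M`,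
i.e. `(0 :_M x)_p = 0` for all `p ≫ 0`. -/
theorem filterRegular_on_module_of_filterRegular_initial_form
    {A₀ : Type u} [CommRing A₀] [IsArtinianRing A₀] [IsLocalRing A₀]
    [Infinite (ResidueField A₀)]
    {A : Type u} [CommRing A] [Algebra A₀ A] [IsNoetherianRing A]
    (𝒜 : ℤ → Submodule A₀ A) [GradedAlgebra 𝒜]
    (hneg : ∀ n : ℤ, n < 0 → 𝒜 n = ⊥)
    (hstd : Algebra.adjoin A₀ ((𝒜 1 : Submodule A₀ A) : Set A) = ⊤)
    {M : Type u} [AddCommGroup M] [Module A M] [Module.Finite A M]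
    [Module A₀ M] [IsScalarTower A₀ A M]
    (ℳ : ℤ → Submodule A₀ M) [DirectSum.Decomposition ℳ]
    (hsmul : ∀ (i j : ℤ), ∀ a ∈ 𝒜 i, ∀ m ∈ ℳ j, a • m ∈ ℳ (i + j))
    (I : Ideal A) (hIhom : I.IsHomogeneous 𝒜)
    (hIne : I ≠ ⊤) (hIprim : I.radical = maxHomIdeal 𝒜)
    (Δ : ℕ) (hΔ : 1 ≤ Δ)
    (hIgen : ∃ s : Set A, s ⊆ ((𝒜 (Δ : ℤ) : Submodule A₀ A) : Set A) ∧ I = Ideal.span s)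
    (F : I.Filtration M) (hF : F.IsGood)
    (hFhom : ∀ k : ℕ, IsHomogeneousSubmodule ℳ (F.N k))
    (x : A) (hxI : x ∈ I) (hxmI : x ∉ maxHomIdeal 𝒜 * I)
    (hxhom : ∃ j : ℤ, x ∈ 𝒜 j)
    (hfr : F.FilterRegular x) :
    ∀ᶠ p : ℤ in atTop, ∀ m ∈ ℳ p, x • m = 0 → m = 0 := by
  obtain ⟨s, hs, rfl⟩ := hIgen
  obtain ⟨T, d, D, hT, hTh, hTb⟩ := helper_fin (A := A) ℳ
  obtain ⟨n1, hn1⟩ := eventually_atTop.1 hfr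
  -- lower bound on degrees
  have hlow : helperGe 𝒜 ℳ hneg hsmul d = ⊤ := by
    rw [eq_top_iff]
    intro m _ p hp
    rw [← Submodule.mem_bot A]
    refine helper_gen 𝒜 ℳ hsmul T hT hTh p ⊥ ?_ _ (SetLike.coe_mem _)
    intro i j a t ht ha hj hij
    rw [Submodule.mem_bot]
    by_cases h0 : t = 0
    · rw [h0, smul_zero]
    · have := (hTb t ht h0 j hj).1
      have hi : i < 0 := by omega
      rw [hneg i hi, Submodule.mem_bot] at ha
      rw [ha, zero_smul]
  -- the elements of large degree lie in `F.N n1`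
  obtain ⟨k, hk⟩ := Ideal.exists_radical_pow_le_of_fg (Ideal.span s ^ n1)
    (IsNoetherian.noetherian _)
  have hk' : maxHomIdeal 𝒜 ^ k ≤ Ideal.span s ^ n1 := by
    refine le_trans ?_ hk
    refine Ideal.pow_right_mono ?_ k
    rcases Nat.eq_zero_or_pos n1 with h | h
    · rw [h, pow_zero, Ideal.one_eq_top, Ideal.radical_top]
      exact le_top
    · rw [Ideal.radical_pow _ h.ne', hIprim]
  have hup : ∀ p : ℤ, D + k ≤ p → ∀ m ∈ ℳ p, m ∈ F.N n1 := by
    intro p hp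
    refine helper_gen 𝒜 ℳ hsmul T hT hTh p _ ?_
    intro i j a t ht ha hj hij
    by_cases h0 : t = 0
    · rw [h0, smul_zero]
      exact Submodule.zero_mem _
    · have := (hTb t ht h0 j hj).2
      obtain ⟨q, rfl⟩ : ∃ q : ℕ, i = q := ⟨i.toNat, by omega⟩
      have h1 := helper_std 𝒜 hstd q a ha
      have h2 := hk' (Ideal.pow_le_pow_right (by omega) h1)
      have h3 := F.pow_smul_le n1 0
      rw [hF.1, add_zero] at h3
      exact h3 (Submodule.smul_mem_smul h2 trivial)
  filter_upwards [eventually_ge_atTop (D + k : ℤ)] with p hp m hm hxm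
  have hall : ∀ n, n1 ≤ n → m ∈ F.N n := by
    intro n hn
    induction n, hn using Nat.le_induction with
    | base => exact hup p hp m hm
    | succ n hn ih =>
      rw [← hn1 n hn]
      refine ⟨?_, ih⟩
      change x • m ∈ F.N (n + 2)
      rw [hxm]
      exact Submodule.zero_mem _
  obtain ⟨n0, hn0⟩ := hF.2.exists_pow_smul_eq_of_ge
  let K : ℕ := (p - d + 1).toNat
  have h1 : m ∈ F.N (n0 + n1 + K) := hall _ (by omega)
  rw [hn0 _ (by omega)] at h1
  have h2 := helper_pow 𝒜 ℳ hneg hsmul d hlow Δ s hs _ ((smul_mono_right _ le_top : _ • F.N n0 ≤ _ • ⊤) h1)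
  have h3 := h2 p (by
    have hK : p - d + 1 ≤ (K : ℤ) := Int.self_le_toNat _
    have h4 : K ≤ n0 + n1 + K - n0 := by omega
    have h5 : K ≤ (n0 + n1 + K - n0) * Δ := h4.trans (Nat.le_mul_of_pos_right _ hΔ)
    have h6 : (K : ℤ) ≤ ((n0 + n1 + K - n0 : ℕ) : ℤ) * Δ := by exact_mod_cast h5
    linarith)
  rwa [DirectSum.decompose_of_mem_same ℳ hm] at h3
end
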